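/- Let K be an algebraically closed field and let Λ = KQ(i,j,m,n)/I be a finite dimensional basic K-algebra given by an admissible ideal I, where m+n = 1 and i+j = 1. Then Λ is τ-tilting infinite if and only if Λ has Γ₃ or the opposite algebra Γ₃^op as a factor algebra. -/

import Mathlib

/-!
Core definitions for τ-tilting theory of finite dimensional algebras.

Throughout, for an algebra `Λ`, *right* `Λ`-modules are formalized as left modules
over the opposite ring `Λᵐᵒᵖ` (the category `RMod Λ := ModuleCat Λᵐᵒᵖ`).

τ-rigidity is formalized via the standard projective-presentation criterion of
Auslander–Smalø/Adachi–Iyama–Reiten: a finitely generated module `M` is τ-rigid iff it admits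
a (finite) projective presentation `P₁ → P₀ → M → 0` such that
`Hom(P₀, M) → Hom(P₁, M)` is surjective.
-/

noncomputable section

namespace TwoPoint

/-- A module is indecomposable if it is nonzero and admits no nontrivial direct sum
decomposition. -/
def IsIndecModule (R : Type) [Ring R] (M : Type) [AddCommGroup M] [Module R M] : Prop :=
  Nontrivial M ∧ ∀ N₁ N₂ : Submodule R M, IsCompl N₁ N₂ → N₁ = ⊥ ∨ N₂ = ⊥

/-- `M` decomposes as a finite direct sum of indecomposable submodules having exactly `n`
isomorphism classes. -/
def HasIndecClassCount (R : Type) [Ring R] (M : ModuleCat.{0} R) (n : ℕ) : Prop :=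
  ∃ (k : ℕ) (N : Fin k → Submodule R M),
    DirectSum.IsInternal N ∧ (∀ i, IsIndecModule R (N i)) ∧
    ∃ c : Fin k → Fin n, Function.Surjective c ∧
      ∀ i j, (c i = c j ↔ Nonempty ((N i) ≃ₗ[R] (N j)))

/-- `M` is basic: it decomposes as a finite direct sum of pairwise nonisomorphic
indecomposable submodules. -/
def IsBasicModuleCat (R : Type) [Ring R] (M : ModuleCat.{0} R) : Prop :=
  ∃ (k : ℕ) (N : Fin k → Submodule R M),
    DirectSum.IsInternal N ∧ (∀ i, IsIndecModule R (N i)) ∧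
    ∀ i j, i ≠ j → IsEmpty ((N i) ≃ₗ[R] (N j))

/-- τ-rigidity, via the projective presentation criterion: there is a finite projective
presentation `P₁ —f→ P₀ —g→ M → 0` such that `Hom(—, M)` applied to `f` is surjective,
i.e. `Hom_Λ(M, τM) = 0`. -/
def IsTauRigidCat (R : Type) [Ring R] (M : ModuleCat.{0} R) : Prop :=
  Module.Finite R M ∧
  ∃ (P₁ P₀ : ModuleCat.{0} R) (f : P₁ →ₗ[R] P₀) (g : P₀ →ₗ[R] M),
    Module.Finite R P₁ ∧ Module.Projective R P₁ ∧
    Module.Finite R P₀ ∧ Module.Projective R P₀ ∧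
    Function.Surjective g ∧ LinearMap.range f = LinearMap.ker g ∧
    ∀ h : P₁ →ₗ[R] M, ∃ h' : P₀ →ₗ[R] M, h = h'.comp f

/-- Support τ-tilting module, via support τ-tilting pairs `(M, P)` (Adachi–Iyama–Reiten):
`M` is τ-rigid, `P` is finitely generated projective with `Hom(P, M) = 0`, and
`|M| + |P| = |R|` where `|X|` is the number of isomorphism classes of indecomposable
direct summands. -/
def IsSupportTauTiltingCat (R : Type) [Ring R] (M : ModuleCat.{0} R) : Prop :=
  IsTauRigidCat R M ∧
  ∃ (P : ModuleCat.{0} R) (p q r : ℕ),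
    Module.Finite R P ∧ Module.Projective R P ∧
    (∀ f : P →ₗ[R] M, f = 0) ∧
    HasIndecClassCount R M p ∧ HasIndecClassCount R P q ∧
    HasIndecClassCount R (ModuleCat.of R R) r ∧ p + q = r

/-- The category of (finitely generated) right `Λ`-modules, as left `Λᵐᵒᵖ`-modules. -/
abbrev RMod (Λ : Type) [Ring Λ] := ModuleCat.{0} Λᵐᵒᵖ

/-- Basic support τ-tilting right `Λ`-module. -/
def IsBasicSupportTauTilting (Λ : Type) [Ring Λ] (M : RMod Λ) : Prop :=
  IsSupportTauTiltingCat Λᵐᵒᵖ M ∧ IsBasicModuleCat Λᵐᵒᵖ M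

/-- `Λ` is τ-tilting finite: there are only finitely many isomorphism classes of basic
support τ-tilting right `Λ`-modules. -/
def IsTauTiltingFinite (Λ : Type) [Ring Λ] : Prop :=
  ∃ (n : ℕ) (L : Fin n → RMod Λ),
    ∀ M : RMod Λ, IsBasicSupportTauTilting Λ M → ∃ i, Nonempty (M ≃ₗ[Λᵐᵒᵖ] L i)

/-- `Λ` has exactly `n` isomorphism classes of basic support τ-tilting modules. -/
def SupportTauTiltingCount (Λ : Type) [Ring Λ] (n : ℕ) : Prop :=
  ∃ L : Fin n → RMod Λ,
    (∀ i, IsBasicSupportTauTilting Λ (L i)) ∧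
    (∀ i j, Nonempty ((L i) ≃ₗ[Λᵐᵒᵖ] (L j)) → i = j) ∧
    ∀ M : RMod Λ, IsBasicSupportTauTilting Λ M → ∃ i, Nonempty (M ≃ₗ[Λᵐᵒᵖ] L i)

/-- `Fac M ⊆ Fac N`: every factor module of a finite direct sum of copies of `M` is also a
factor module of a finite direct sum of copies of `N`.  This is the partial order on
support τ-tilting modules. -/
def FacLE (Λ : Type) [Ring Λ] (M N : RMod Λ) : Prop :=
  ∀ X : RMod Λ,
    (∃ (k : ℕ) (f : (Fin k → M) →ₗ[Λᵐᵒᵖ] X), Function.Surjective f) →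
    (∃ (k : ℕ) (f : (Fin k → N) →ₗ[Λᵐᵒᵖ] X), Function.Surjective f)

/-- The Hasse quiver of the poset `sτ-tilt Λ` is of type `H_{m,n}`: the poset of
isomorphism classes of basic support τ-tilting modules is isomorphic to the poset
consisting of a greatest element, a least element, and two incomparable chains with `m`
resp. `n` elements in between (hence two directed paths from `Λ` to `0` with `m` resp. `n`
intermediate vertices). -/
def HasseType (Λ : Type) [Ring Λ] (m n : ℕ) : Prop :=
  ∃ T : WithTop (WithBot (Fin m ⊕ Fin n)) → RMod Λ,
    (∀ x, IsBasicSupportTauTilting Λ (T x)) ∧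
    (∀ x y, Nonempty ((T x) ≃ₗ[Λᵐᵒᵖ] (T y)) → x = y) ∧
    (∀ M : RMod Λ, IsBasicSupportTauTilting Λ M → ∃ x, Nonempty (M ≃ₗ[Λᵐᵒᵖ] T x)) ∧
    ∀ x y, x ≤ y ↔ FacLE Λ (T x) (T y)

/-- `Λ` is τ-tilting finite with exactly `N` basic support τ-tilting modules and Hasse
quiver of type `H_{m,n}`. -/
def TauTiltingData (Λ : Type) [Ring Λ] (N m n : ℕ) : Prop :=
  IsTauTiltingFinite Λ ∧ SupportTauTiltingCount Λ N ∧ HasseType Λ m n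

/-- `B` is a factor algebra of `Λ`: there is a surjective `K`-algebra homomorphism
`Λ → B`. -/
def IsFactorAlgebra (K : Type) [CommRing K] (B Λ : Type) [Ring B] [Ring Λ]
    [Algebra K B] [Algebra K Λ] : Prop :=
  ∃ φ : Λ →ₐ[K] B, Function.Surjective φ

/-- `Λ` is a basic algebra: the regular right module decomposes into pairwise
nonisomorphic indecomposables. -/
def IsBasicAlgebra (Λ : Type) [Ring Λ] : Prop :=
  IsBasicModuleCat Λᵐᵒᵖ (ModuleCat.of Λᵐᵒᵖ Λᵐᵒᵖ)

/-- `Λ` is representation-finite: finitely many isomorphism classes of indecomposable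
finitely generated right modules. -/
def IsRepFinite (Λ : Type) [Ring Λ] : Prop :=
  ∃ (n : ℕ) (L : Fin n → RMod Λ), ∀ M : RMod Λ,
    Module.Finite Λᵐᵒᵖ M → IsIndecModule Λᵐᵒᵖ M → ∃ i, Nonempty (M ≃ₗ[Λᵐᵒᵖ] L i)

end TwoPoint

namespace TwoPoint

/-! ### Bound quiver algebras on two-point quivers

A two-point quiver is given by an arrow type `σ` together with source and target functions
`s t : σ → Fin 2`.  The corresponding bound quiver algebra `KQ/I` is presented as the
quotient of the free algebra on the two vertex idempotents and the arrows, by the path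
algebra relations together with the defining relations of `I` (paths are composed from
left to right, so a relation like `αμβ` is the product `α * μ * β`). -/

/-- Generators for the path algebra of a two-point quiver: two vertex idempotents and the
arrows. -/
inductive TPGen (σ : Type) : Type
  | v : Fin 2 → TPGen σ
  | ar : σ → TPGen σ

/-- The vertex idempotent generator. -/
def vtx (K : Type) [Field K] {σ : Type} (i : Fin 2) : FreeAlgebra K (TPGen σ) :=
  FreeAlgebra.ι K (TPGen.v i)

/-- The arrow generator. -/
def arr (K : Type) [Field K] {σ : Type} (a : σ) : FreeAlgebra K (TPGen σ) :=
  FreeAlgebra.ι K (TPGen.ar a)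

/-- The defining relations of a bound quiver algebra on a two-point quiver:
`e_i e_j = δ_{ij} e_i`, `e_1 + e_2 = 1`, `e_{s(a)} a = a = a e_{t(a)}`, together with the
prescribed relations `rels` (each pair `(x, y) ∈ rels` imposes `x = y`). -/
inductive QuivRel (K : Type) [Field K] (σ : Type) (s t : σ → Fin 2)
    (rels : Set (FreeAlgebra K (TPGen σ) × FreeAlgebra K (TPGen σ))) :
    FreeAlgebra K (TPGen σ) → FreeAlgebra K (TPGen σ) → Prop
  | idem (i : Fin 2) : QuivRel K σ s t rels (vtx K i * vtx K i) (vtx K i)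
  | orth (i j : Fin 2) : i ≠ j → QuivRel K σ s t rels (vtx K i * vtx K j) 0
  | vsum : QuivRel K σ s t rels (vtx K 0 + vtx K 1) 1
  | src (a : σ) : QuivRel K σ s t rels (vtx K (s a) * arr K a) (arr K a)
  | tgt (a : σ) : QuivRel K σ s t rels (arr K a * vtx K (t a)) (arr K a)
  | rel (p : FreeAlgebra K (TPGen σ) × FreeAlgebra K (TPGen σ)) :
      p ∈ rels → QuivRel K σ s t rels p.1 p.2

/-- The bound quiver algebra of a two-point quiver with relations `rels`. -/
abbrev BoundQuiverAlgebra (K : Type) [Field K] (σ : Type) (s t : σ → Fin 2)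
    (rels : Set (FreeAlgebra K (TPGen σ) × FreeAlgebra K (TPGen σ))) : Type :=
  RingQuot (QuivRel K σ s t rels)

/-! Concrete two-point quivers used below.  Vertices are `0` ("1") and `1` ("2"). -/

/- Quiver `μ : 1 → 2`, loop `β` at `2`. -/
namespace QA
def s : Fin 2 → Fin 2 := ![0, 1]
def t : Fin 2 → Fin 2 := ![1, 1]
def mu (K : Type) [Field K] : FreeAlgebra K (TPGen (Fin 2)) := arr K (0 : Fin 2)
def be (K : Type) [Field K] : FreeAlgebra K (TPGen (Fin 2)) := arr K (1 : Fin 2)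
end QA

/- Quiver: loop `α` at `1`, `μ : 1 → 2`, loop `β` at `2`. -/
namespace QB
def s : Fin 3 → Fin 2 := ![0, 0, 1]
def t : Fin 3 → Fin 2 := ![0, 1, 1]
def al (K : Type) [Field K] : FreeAlgebra K (TPGen (Fin 3)) := arr K (0 : Fin 3)
def mu (K : Type) [Field K] : FreeAlgebra K (TPGen (Fin 3)) := arr K (1 : Fin 3)
def be (K : Type) [Field K] : FreeAlgebra K (TPGen (Fin 3)) := arr K (2 : Fin 3)
end QB

/- Quiver: `μ : 1 → 2`, loops `β₁, β₂` at `2`. -/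
namespace QC
def s : Fin 3 → Fin 2 := ![0, 1, 1]
def t : Fin 3 → Fin 2 := ![1, 1, 1]
def mu (K : Type) [Field K] : FreeAlgebra K (TPGen (Fin 3)) := arr K (0 : Fin 3)
def b1 (K : Type) [Field K] : FreeAlgebra K (TPGen (Fin 3)) := arr K (1 : Fin 3)
def b2 (K : Type) [Field K] : FreeAlgebra K (TPGen (Fin 3)) := arr K (2 : Fin 3)
end QC

/- Quiver: loop `α` at `1`, `μ : 1 → 2`, `ν : 2 → 1`. -/
namespace QD
def s : Fin 3 → Fin 2 := ![0, 0, 1]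
def t : Fin 3 → Fin 2 := ![0, 1, 0]
def al (K : Type) [Field K] : FreeAlgebra K (TPGen (Fin 3)) := arr K (0 : Fin 3)
def mu (K : Type) [Field K] : FreeAlgebra K (TPGen (Fin 3)) := arr K (1 : Fin 3)
def nu (K : Type) [Field K] : FreeAlgebra K (TPGen (Fin 3)) := arr K (2 : Fin 3)
end QD

/- Quiver: loops `α` at `1` and `β` at `2`, `μ : 1 → 2`, `ν : 2 → 1`. -/
namespace QE
def s : Fin 4 → Fin 2 := ![0, 1, 0, 1]
def t : Fin 4 → Fin 2 := ![0, 1, 1, 0]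
def al (K : Type) [Field K] : FreeAlgebra K (TPGen (Fin 4)) := arr K (0 : Fin 4)
def be (K : Type) [Field K] : FreeAlgebra K (TPGen (Fin 4)) := arr K (1 : Fin 4)
def mu (K : Type) [Field K] : FreeAlgebra K (TPGen (Fin 4)) := arr K (2 : Fin 4)
def nu (K : Type) [Field K] : FreeAlgebra K (TPGen (Fin 4)) := arr K (3 : Fin 4)
end QE

/- Quiver: `μ : 1 → 2`, `ν : 2 → 1`. -/
namespace QF
def s : Fin 2 → Fin 2 := ![0, 1]
def t : Fin 2 → Fin 2 := ![1, 0]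
def mu (K : Type) [Field K] : FreeAlgebra K (TPGen (Fin 2)) := arr K (0 : Fin 2)
def nu (K : Type) [Field K] : FreeAlgebra K (TPGen (Fin 2)) := arr K (1 : Fin 2)
end QF

/- The Kronecker quiver: `μ₁, μ₂ : 1 → 2`. -/
namespace QG
def s : Fin 2 → Fin 2 := ![0, 0]
def t : Fin 2 → Fin 2 := ![1, 1]
end QG

/- Quiver: `μ₁, μ₂ : 1 → 2`, `ν₁, ν₂ : 2 → 1`. -/
namespace QH
def s : Fin 4 → Fin 2 := ![0, 0, 1, 1]
def t : Fin 4 → Fin 2 := ![1, 1, 0, 0]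
def mu1 (K : Type) [Field K] : FreeAlgebra K (TPGen (Fin 4)) := arr K (0 : Fin 4)
def mu2 (K : Type) [Field K] : FreeAlgebra K (TPGen (Fin 4)) := arr K (1 : Fin 4)
def nu1 (K : Type) [Field K] : FreeAlgebra K (TPGen (Fin 4)) := arr K (2 : Fin 4)
def nu2 (K : Type) [Field K] : FreeAlgebra K (TPGen (Fin 4)) := arr K (3 : Fin 4)
end QH

/- Quiver: loop `α` at `1`, `μ : 1 → 2`. -/
namespace QI
def s : Fin 2 → Fin 2 := ![0, 0]
def t : Fin 2 → Fin 2 := ![0, 1]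
def al (K : Type) [Field K] : FreeAlgebra K (TPGen (Fin 2)) := arr K (0 : Fin 2)
def mu (K : Type) [Field K] : FreeAlgebra K (TPGen (Fin 2)) := arr K (1 : Fin 2)
end QI

/- Quiver: loops `α₁, α₂` at `1`, `μ : 1 → 2`. -/
namespace QJ
def s : Fin 3 → Fin 2 := ![0, 0, 0]
def t : Fin 3 → Fin 2 := ![0, 0, 1]
def a1 (K : Type) [Field K] : FreeAlgebra K (TPGen (Fin 3)) := arr K (0 : Fin 3)
def a2 (K : Type) [Field K] : FreeAlgebra K (TPGen (Fin 3)) := arr K (1 : Fin 3)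
def mu (K : Type) [Field K] : FreeAlgebra K (TPGen (Fin 3)) := arr K (2 : Fin 3)
end QJ

/- Quiver: `μ₁, μ₂ : 1 → 2`, `ν : 2 → 1`. -/
namespace QK
def s : Fin 3 → Fin 2 := ![0, 0, 1]
def t : Fin 3 → Fin 2 := ![1, 1, 0]
def mu1 (K : Type) [Field K] : FreeAlgebra K (TPGen (Fin 3)) := arr K (0 : Fin 3)
def mu2 (K : Type) [Field K] : FreeAlgebra K (TPGen (Fin 3)) := arr K (1 : Fin 3)
def nu (K : Type) [Field K] : FreeAlgebra K (TPGen (Fin 3)) := arr K (2 : Fin 3)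
end QK

/- Quiver: `μ₁, μ₂, μ₃ : 1 → 2`. -/
namespace QL
def s : Fin 3 → Fin 2 := ![0, 0, 0]
def t : Fin 3 → Fin 2 := ![1, 1, 1]
end QL

/- Quiver: loop `α` at `1`, `μ₁, μ₂ : 1 → 2`. -/
namespace QM
def s : Fin 3 → Fin 2 := ![0, 0, 0]
def t : Fin 3 → Fin 2 := ![0, 1, 1]
def al (K : Type) [Field K] : FreeAlgebra K (TPGen (Fin 3)) := arr K (0 : Fin 3)
def mu1 (K : Type) [Field K] : FreeAlgebra K (TPGen (Fin 3)) := arr K (1 : Fin 3)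
def mu2 (K : Type) [Field K] : FreeAlgebra K (TPGen (Fin 3)) := arr K (2 : Fin 3)
end QM

end TwoPoint

namespace TwoPoint

/-! ### The path algebra of the quiver `Q(i,j,m,n)` and admissible presentations

`Q(i,j,m,n)` has two vertices `1, 2`, `i` loops at `1`, `j` loops at `2`, `m` arrows
`1 → 2` and `n` arrows `2 → 1`. -/

/-- Arrows of `Q(i,j,m,n)`. -/
def QArrow (i j m n : ℕ) : Type := (Fin i ⊕ Fin j) ⊕ (Fin m ⊕ Fin n)

/-- Sources of arrows of `Q(i,j,m,n)`. -/
def QSrc (i j m n : ℕ) : QArrow i j m n → Fin 2 :=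
  Sum.elim (Sum.elim (fun _ => 0) fun _ => 1) (Sum.elim (fun _ => 0) fun _ => 1)

/-- Targets of arrows of `Q(i,j,m,n)`. -/
def QTgt (i j m n : ℕ) : QArrow i j m n → Fin 2 :=
  Sum.elim (Sum.elim (fun _ => 0) fun _ => 1) (Sum.elim (fun _ => 1) fun _ => 0)

/-- The path algebra `KQ(i,j,m,n)` (no relations). -/
abbrev PathAlgebra (K : Type) [Field K] (i j m n : ℕ) : Type :=
  BoundQuiverAlgebra K (QArrow i j m n) (QSrc i j m n) (QTgt i j m n) ∅

/-- The image of an arrow in the path algebra. -/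
def pathArrow (K : Type) [Field K] {i j m n : ℕ} (x : QArrow i j m n) :
    PathAlgebra K i j m n :=
  RingQuot.mkAlgHom K _ (arr K x)

/-- The set of products of exactly `N` elements of `S`. -/
def NProd {R : Type} [Monoid R] (S : Set R) (N : ℕ) : Set R :=
  {x | ∃ l : List R, l.length = N ∧ (∀ y ∈ l, y ∈ S) ∧ x = l.prod}

/-- The two-sided ideal generated by `S`, as a `K`-submodule. -/
def twoSidedSpan (K : Type) [CommRing K] (R : Type) [Ring R] [Algebra K R] (S : Set R) :
    Submodule K R :=
  Submodule.span K {z | ∃ p s q : R, s ∈ S ∧ z = p * s * q}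

/-- `π` presents `Λ` as the quotient of the path algebra `KQ(i,j,m,n)` by an admissible
ideal `I = ker π`: `π` is surjective, `I` is contained in the square `R²` of the arrow
ideal `R`, and `Rᴺ ⊆ I` for some `N ≥ 2`. -/
def IsAdmissiblePresentation (K : Type) [Field K] {i j m n : ℕ} (Λ : Type) [Ring Λ]
    [Algebra K Λ] (π : PathAlgebra K i j m n →ₐ[K] Λ) : Prop :=
  Function.Surjective π ∧
  (∀ x, π x = 0 →
    x ∈ twoSidedSpan K (PathAlgebra K i j m n) (NProd (Set.range (pathArrow K)) 2)) ∧
  ∃ N : ℕ, 2 ≤ N ∧ ∀ x ∈ NProd (Set.range (pathArrow K (i := i) (j := j) (m := m) (n := n))) N,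
    π x = 0

end TwoPoint

namespace TwoPoint

/-! ### The algebras of Table Γ -/

/-- `Γ₁`: the Kronecker algebra. -/
abbrev Gamma1 (K : Type) [Field K] : Type :=
  BoundQuiverAlgebra K (Fin 2) QG.s QG.t ∅

/-- `Γ₂`: `μ : 1 → 2`, loop `β` at `2`, `β³ = 0`. -/
abbrev Gamma2 (K : Type) [Field K] : Type :=
  BoundQuiverAlgebra K (Fin 2) QA.s QA.t {(QA.be K ^ 3, 0)}

/-- `Γ₃`: `μ : 1 → 2`, loop `β` at `2`, `β⁴ = 0`. -/
abbrev Gamma3 (K : Type) [Field K] : Type :=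
  BoundQuiverAlgebra K (Fin 2) QA.s QA.t {(QA.be K ^ 4, 0)}

/-- `Γ₄`: `α² = β² = 0`. -/
abbrev Gamma4 (K : Type) [Field K] : Type :=
  BoundQuiverAlgebra K (Fin 3) QB.s QB.t {(QB.al K ^ 2, 0), (QB.be K ^ 2, 0)}

/-- `Γ₅`: `α² = β³ = 0`, `αμβ = μβ²`. -/
abbrev Gamma5 (K : Type) [Field K] : Type :=
  BoundQuiverAlgebra K (Fin 3) QB.s QB.t
    {(QB.al K ^ 2, 0), (QB.be K ^ 3, 0), (QB.al K * QB.mu K * QB.be K, QB.mu K * QB.be K ^ 2)}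

/-- `Γ₆`: `α² = β⁴ = 0`, `αμβ = μβ³`. -/
abbrev Gamma6 (K : Type) [Field K] : Type :=
  BoundQuiverAlgebra K (Fin 3) QB.s QB.t
    {(QB.al K ^ 2, 0), (QB.be K ^ 4, 0), (QB.al K * QB.mu K * QB.be K, QB.mu K * QB.be K ^ 3)}

/-- `Γ₇`: `β₁² = β₂² = β₁β₂ = β₂β₁ = 0`. -/
abbrev Gamma7 (K : Type) [Field K] : Type :=
  BoundQuiverAlgebra K (Fin 3) QC.s QC.t
    {(QC.b1 K ^ 2, 0), (QC.b2 K ^ 2, 0), (QC.b1 K * QC.b2 K, 0), (QC.b2 K * QC.b1 K, 0)}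

/-- `Γ₈`: `α² = μν = νμ = να = 0`. -/
abbrev Gamma8 (K : Type) [Field K] : Type :=
  BoundQuiverAlgebra K (Fin 3) QD.s QD.t
    {(QD.al K ^ 2, 0), (QD.mu K * QD.nu K, 0), (QD.nu K * QD.mu K, 0), (QD.nu K * QD.al K, 0)}

/-- `Γ₉`: `α³ = μν = νμ = να = 0`. -/
abbrev Gamma9 (K : Type) [Field K] : Type :=
  BoundQuiverAlgebra K (Fin 3) QD.s QD.t
    {(QD.al K ^ 3, 0), (QD.mu K * QD.nu K, 0), (QD.nu K * QD.mu K, 0), (QD.nu K * QD.al K, 0)}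

/-- `Γ₁₀`: `α² = μν = νμ = ναμ = 0`. -/
abbrev Gamma10 (K : Type) [Field K] : Type :=
  BoundQuiverAlgebra K (Fin 3) QD.s QD.t
    {(QD.al K ^ 2, 0), (QD.mu K * QD.nu K, 0), (QD.nu K * QD.mu K, 0),
     (QD.nu K * QD.al K * QD.mu K, 0)}

/-- `Γ₁₁` (`n ≥ 2`): `αⁿ = μν = να³ = α³μ = 0`. -/
abbrev Gamma11 (K : Type) [Field K] (n : ℕ) : Type :=
  BoundQuiverAlgebra K (Fin 3) QD.s QD.t
    {(QD.al K ^ n, 0), (QD.mu K * QD.nu K, 0), (QD.nu K * QD.al K ^ 3, 0),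
     (QD.al K ^ 3 * QD.mu K, 0)}

/-- `Γ₁₂` (`m ≥ 2`, `n ≥ 1`): `αᵐ = να = αμν = α³μ = (μν)ⁿ = 0`. -/
abbrev Gamma12 (K : Type) [Field K] (m n : ℕ) : Type :=
  BoundQuiverAlgebra K (Fin 3) QD.s QD.t
    {(QD.al K ^ m, 0), (QD.nu K * QD.al K, 0), (QD.al K * QD.mu K * QD.nu K, 0),
     (QD.al K ^ 3 * QD.mu K, 0), ((QD.mu K * QD.nu K) ^ n, 0)}

/-- `Γ₁₃` (`m ≥ 2`, `n ≥ 1`): `αᵐ = μνμ = νμν = να² = α²μ = (ναμ)ⁿ = 0`. -/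
abbrev Gamma13 (K : Type) [Field K] (m n : ℕ) : Type :=
  BoundQuiverAlgebra K (Fin 3) QD.s QD.t
    {(QD.al K ^ m, 0), (QD.mu K * QD.nu K * QD.mu K, 0), (QD.nu K * QD.mu K * QD.nu K, 0),
     (QD.nu K * QD.al K ^ 2, 0), (QD.al K ^ 2 * QD.mu K, 0),
     ((QD.nu K * QD.al K * QD.mu K) ^ n, 0)}

/-- `Γ₁₄` (`n ≥ 1`): `α² = μν`, `ναⁿμ = 0`. -/
abbrev Gamma14 (K : Type) [Field K] (n : ℕ) : Type :=
  BoundQuiverAlgebra K (Fin 3) QD.s QD.t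
    {(QD.al K ^ 2, QD.mu K * QD.nu K), (QD.nu K * QD.al K ^ n * QD.mu K, 0)}

/-- `Γ₁₅` (`n ≥ 1`): `α³ = μν`, `ναⁿμ = 0`. -/
abbrev Gamma15 (K : Type) [Field K] (n : ℕ) : Type :=
  BoundQuiverAlgebra K (Fin 3) QD.s QD.t
    {(QD.al K ^ 3, QD.mu K * QD.nu K), (QD.nu K * QD.al K ^ n * QD.mu K, 0)}

/-- `Γ₁₆` (`n ≥ 4`): `αⁿ = μν`, `να³ = α³μ = 0`. -/
abbrev Gamma16 (K : Type) [Field K] (n : ℕ) : Type :=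
  BoundQuiverAlgebra K (Fin 3) QD.s QD.t
    {(QD.al K ^ n, QD.mu K * QD.nu K), (QD.nu K * QD.al K ^ 3, 0), (QD.al K ^ 3 * QD.mu K, 0)}

/-- `Γ₁₇` (`m, n ≥ 2`, `r ≥ 1`): `αᵐ = βⁿ = νμ = βν = μβ = να² = α²μ = (ναμ)ʳ = 0`. -/
abbrev Gamma17 (K : Type) [Field K] (m n r : ℕ) : Type :=
  BoundQuiverAlgebra K (Fin 4) QE.s QE.t
    {(QE.al K ^ m, 0), (QE.be K ^ n, 0), (QE.nu K * QE.mu K, 0), (QE.be K * QE.nu K, 0),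
     (QE.mu K * QE.be K, 0), (QE.nu K * QE.al K ^ 2, 0), (QE.al K ^ 2 * QE.mu K, 0),
     ((QE.nu K * QE.al K * QE.mu K) ^ r, 0)}

/-- `Γ₁₈` (`m, n ≥ 2`): `αᵐ = βⁿ = νμ = βν = να = α²μ = μβ² = αμβ = 0`. -/
abbrev Gamma18 (K : Type) [Field K] (m n : ℕ) : Type :=
  BoundQuiverAlgebra K (Fin 4) QE.s QE.t
    {(QE.al K ^ m, 0), (QE.be K ^ n, 0), (QE.nu K * QE.mu K, 0), (QE.be K * QE.nu K, 0),
     (QE.nu K * QE.al K, 0), (QE.al K ^ 2 * QE.mu K, 0), (QE.mu K * QE.be K ^ 2, 0),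
     (QE.al K * QE.mu K * QE.be K, 0)}

/-- `Γ₁₉`: `α² = μν`, `β² = νμ`, `αμβ = βνα = 0`. -/
abbrev Gamma19 (K : Type) [Field K] : Type :=
  BoundQuiverAlgebra K (Fin 4) QE.s QE.t
    {(QE.al K ^ 2, QE.mu K * QE.nu K), (QE.be K ^ 2, QE.nu K * QE.mu K),
     (QE.al K * QE.mu K * QE.be K, 0), (QE.be K * QE.nu K * QE.al K, 0)}

/-- `Γ₂₀` (`m, n ≥ 2`, `r ≥ 1`): `αμ = μβ`, `βν = να`, `αᵐ = βⁿ = (νμ)ʳ = 0`. -/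
abbrev Gamma20 (K : Type) [Field K] (m n r : ℕ) : Type :=
  BoundQuiverAlgebra K (Fin 4) QE.s QE.t
    {(QE.al K * QE.mu K, QE.mu K * QE.be K), (QE.be K * QE.nu K, QE.nu K * QE.al K),
     (QE.al K ^ m, 0), (QE.be K ^ n, 0), ((QE.nu K * QE.mu K) ^ r, 0)}

end TwoPoint

namespace TwoPoint

section Shift

variable {K : Type} [Field K] {S U Y : Type} [AddCommGroup S] [Module K S]
  [AddCommGroup U] [Module K U] [AddCommGroup Y] [Module K Y]

/-- The shift operator on `Fin n → S`, i.e. multiplication by `X` on `S[X]/(Xⁿ)`. -/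
def shift (K : Type) [Field K] (n : ℕ) (S : Type) [AddCommGroup S] [Module K S] :
    Module.End K (Fin n → S) where
  toFun s k := if h : 0 < (k : ℕ) then s ⟨k - 1, by omega⟩ else 0
  map_add' s s' := by ext k; by_cases h : 0 < (k : ℕ) <;> simp [h]
  map_smul' c s := by ext k; by_cases h : 0 < (k : ℕ) <;> simp [h]

theorem shift_pow_apply (n : ℕ) (j : ℕ) (s : Fin n → S) (k : Fin n) :
    (shift K n S ^ j) s k = if h : j ≤ (k : ℕ) then s ⟨k - j, by omega⟩ else 0 := by
  induction j generalizing k with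
  | zero => simp
  | succ j ih =>
    rw [pow_succ', Module.End.mul_apply]
    by_cases h : 0 < (k : ℕ)
    · have : shift K n S ((shift K n S ^ j) s) k = (shift K n S ^ j) s ⟨k - 1, by omega⟩ := by
        simp [shift, h]
      rw [this, ih]
      by_cases h' : j + 1 ≤ (k : ℕ)
      · rw [dif_pos h', dif_pos (by simp; omega)]
        congr 2
        simp; omega
      · rw [dif_neg h', dif_neg (by simp; omega)]
    · rw [dif_neg (by omega)]
      simp [shift, h]

theorem shift_pow_self (n : ℕ) : shift K n S ^ n = 0 := by
  refine LinearMap.ext fun s => funext fun k => ?_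
  rw [shift_pow_apply, dif_neg (by omega)]
  rfl

/-- The linear map `(s_k)_k ↦ ∑ yᵏ (T s_k)`. -/
def liftSh (n : ℕ) (y : Module.End K Y) (T : S →ₗ[K] Y) : (Fin n → S) →ₗ[K] Y :=
  ∑ k : Fin n, (y ^ (k : ℕ)) ∘ₗ T ∘ₗ LinearMap.proj k

theorem liftSh_apply (n : ℕ) (y : Module.End K Y) (T : S →ₗ[K] Y) (s : Fin n → S) :
    liftSh n y T s = ∑ k : Fin n, (y ^ (k : ℕ)) (T (s k)) := by
  simp [liftSh]

theorem liftSh_shift (n : ℕ) (y : Module.End K Y) (T : S →ₗ[K] Y)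
    (h : ∀ s, (y ^ n) (T s) = 0) (s : Fin n → S) :
    liftSh n y T (shift K n S s) = y (liftSh n y T s) := by
  rcases n with _ | m
  · simp [liftSh_apply]
  · rw [liftSh_apply, liftSh_apply, map_sum, Fin.sum_univ_succ, Fin.sum_univ_castSucc]
    have h0 : shift K (m + 1) S s 0 = 0 := by simp [shift]
    have h1 : ∀ i : Fin m, shift K (m + 1) S s i.succ = s i.castSucc := by
      intro i; simp [shift]; rfl
    rw [h0, ← Module.End.mul_apply, ← pow_succ' y]
    simp only [Fin.val_last, h]
    simp [h1, pow_succ']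

/-- `U` is freely generated over `K[X]/(Xⁿ)` by the image of `T`, where `X` acts as `x`. -/
def IsFreeOn (n : ℕ) (x : Module.End K U) (T : S →ₗ[K] U) : Prop :=
  x ^ n = 0 ∧ Function.Bijective (liftSh n x T)

/-- The inclusion of `S` in `S[X]/(Xⁿ)` as constants. -/
def single0 (K : Type) [Field K] (n : ℕ) [NeZero n] (S : Type) [AddCommGroup S] [Module K S] :
    S →ₗ[K] (Fin n → S) := LinearMap.single K (fun _ => S) 0

theorem shift_pow_single0 (n : ℕ) [NeZero n] (j : Fin n) (s : S) :
    (shift K n S ^ (j : ℕ)) (single0 K n S s) = Pi.single j s := by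
  ext k
  rw [shift_pow_apply]
  by_cases h : k = j
  · subst h
    simp only [le_refl, dite_true, Pi.single_eq_same, single0, LinearMap.coe_single]
    convert Pi.single_eq_same (M := fun _ : Fin n => S) (0 : Fin n) s using 2
    ext; simp
  · rw [Pi.single_eq_of_ne h]
    split_ifs with h'
    · simp only [single0, LinearMap.coe_single]
      apply Pi.single_eq_of_ne
      intro h2
      apply h
      ext
      have := congrArg Fin.val h2
      simp at this
      omega
    · rfl

theorem liftSh_shift_single0 (n : ℕ) [NeZero n] (s : Fin n → S) :
    liftSh n (shift K n S) (single0 K n S) s = s := by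
  rw [liftSh_apply]
  simp only [shift_pow_single0]
  exact (Finset.univ_sum_single s)

theorem isFreeOn_shift (n : ℕ) [NeZero n] : IsFreeOn n (shift K n S) (single0 K n S) := by
  refine ⟨shift_pow_self n, ?_⟩
  have : ⇑(liftSh n (shift K n S) (single0 K n S)) = id := funext (liftSh_shift_single0 n)
  rw [this]
  exact Function.bijective_id

theorem comm_pow {x : Module.End K U} {y : Module.End K Y} {F : U →ₗ[K] Y}
    (h : ∀ u, F (x u) = y (F u)) (j : ℕ) (u : U) : F ((x ^ j) u) = (y ^ j) (F u) := by
  induction j with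
  | zero => simp
  | succ j ih => rw [pow_succ', pow_succ', Module.End.mul_apply, Module.End.mul_apply, h, ih]

theorem liftSh_single0 (n : ℕ) [NeZero n] (y : Module.End K Y) (T : S →ₗ[K] Y) (s : S) :
    liftSh n y T (single0 K n S s) = T s := by
  rw [liftSh_apply, Finset.sum_eq_single 0]
  · simp [single0]
  · intro b _ hb; simp [single0, Pi.single_eq_of_ne hb]
  · simp

theorem IsFreeOn.exists_ext {n : ℕ} [NeZero n] {x : Module.End K U} {T : S →ₗ[K] U}
    (hx : IsFreeOn n x T) (y : Module.End K Y) (T' : S →ₗ[K] Y)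
    (h : ∀ s, (y ^ n) (T' s) = 0) :
    ∃ F : U →ₗ[K] Y, (∀ u, F (x u) = y (F u)) ∧ ∀ s, F (T s) = T' s := by
  let e := LinearEquiv.ofBijective _ hx.2
  have he : ∀ s, e (shift K n S s) = x (e s) := fun s =>
    liftSh_shift n x T (fun s => by simp [hx.1]) s
  refine ⟨liftSh n y T' ∘ₗ e.symm.toLinearMap, fun u => ?_, fun s => ?_⟩
  · obtain ⟨s, rfl⟩ := e.surjective u
    rw [← he]
    simp [liftSh_shift n y T' h]
  · have : T s = e (single0 K n S s) := (liftSh_single0 n x T s).symm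
    rw [this]
    simp [liftSh_single0]

theorem IsFreeOn.hom_ext {n : ℕ} {x : Module.End K U} {T : S →ₗ[K] U}
    (hx : IsFreeOn n x T) {y : Module.End K Y} {F G : U →ₗ[K] Y}
    (hF : ∀ u, F (x u) = y (F u)) (hG : ∀ u, G (x u) = y (G u)) (h : ∀ s, F (T s) = G (T s)) :
    F = G := by
  ext u
  obtain ⟨s, rfl⟩ := hx.2.2 u
  simp only [liftSh_apply, map_sum, comm_pow hF, comm_pow hG, h]

/-- `x` turns `U` into a free module over `K[X]/(Xⁿ)`. -/
def Cyc (n : ℕ) (x : Module.End K U) : Prop :=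
  x ^ n = 0 ∧ ∀ u, x u = 0 → ∃ w, u = (x ^ (n - 1)) w

theorem pow_zero_of_le {n m : ℕ} {x : Module.End K U} (h : x ^ n = 0) (hm : n ≤ m) : x ^ m = 0 := by
  rw [← Nat.sub_add_cancel hm, pow_add, h, mul_zero]

theorem Cyc.ker_pow {n : ℕ} {x : Module.End K U} (hx : Cyc n x) {j : ℕ} (hj : j + 1 ≤ n) (u : U)
    (hu : (x ^ j) u = 0) : u ∈ LinearMap.range (x ^ (n - j)) := by
  induction j generalizing u with
  | zero => simp at hu; simp [hu]
  | succ j ih =>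
    rw [pow_succ, Module.End.mul_apply] at hu
    obtain ⟨w, hw⟩ := ih (by omega) (x u) hu
    obtain ⟨w', hw'⟩ := hx.2 (u - (x ^ (n - (j + 1))) w) (by
      rw [map_sub, sub_eq_zero, ← hw, ← Module.End.mul_apply, ← pow_succ']
      congr 2; omega)
    refine ⟨w + (x ^ j) w', ?_⟩
    rw [map_add, ← Module.End.mul_apply, ← pow_add]
    rw [show n - (j + 1) + j = n - 1 by omega, ← hw']
    abel

theorem IsFreeOn.cyc {n : ℕ} [NeZero n] {x : Module.End K U} {T : S →ₗ[K] U}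
    (hx : IsFreeOn n x T) : Cyc n x := by
  refine ⟨hx.1, fun u hu => ?_⟩
  have hn := Nat.pos_of_ne_zero (NeZero.ne n)
  let e := LinearEquiv.ofBijective _ hx.2
  have he : ∀ s, e (shift K n S s) = x (e s) := fun s =>
    liftSh_shift n x T (fun s => by simp [hx.1]) s
  obtain ⟨s, rfl⟩ := e.surjective u
  rw [← he, LinearEquiv.map_eq_zero_iff] at hu
  refine ⟨e (single0 K n S (s ⟨n - 1, by omega⟩)), ?_⟩
  have hc := comm_pow (F := e.toLinearMap) (x := shift K n S) he (n - 1)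
  simp only [LinearEquiv.coe_coe] at hc
  rw [← hc]
  congr 1
  have := shift_pow_single0 (K := K) n ⟨n - 1, by omega⟩ (s ⟨n - 1, by omega⟩)
  simp only at this
  rw [this]
  ext k
  by_cases hk : k = ⟨n - 1, by omega⟩
  · subst hk; simp
  · rw [Pi.single_eq_of_ne hk]
    have hk' : (k : ℕ) + 1 < n := by
      have := k.2
      have : (k : ℕ) ≠ n - 1 := fun h => hk (Fin.ext h)
      omega
    have h3 : shift K n S s ⟨k + 1, hk'⟩ = s k := by
      change (if h : 0 < (k : ℕ) + 1 then s ⟨(k : ℕ) + 1 - 1, by omega⟩ else 0) = s k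
      simp
    rw [← h3, hu]; rfl

theorem Cyc.isFreeOn {n : ℕ} [NeZero n] {x : Module.End K U} (hx : Cyc n x) {S : Submodule K U}
    (hS : IsCompl S (LinearMap.range x)) : IsFreeOn n x S.subtype := by
  have hn := Nat.pos_of_ne_zero (NeZero.ne n)
  refine ⟨hx.1, ?_, ?_⟩
  · rw [← LinearMap.ker_eq_bot, LinearMap.ker_eq_bot']
    intro s hs
    by_contra hne
    have hex : ∃ k : ℕ, ∃ h : k < n, s ⟨k, h⟩ ≠ 0 := by
      by_contra hcon
      push Not at hcon
      exact hne (funext fun k => hcon k k.2)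
    classical
    obtain ⟨hk, hsk⟩ := Nat.find_spec hex
    set k := Nat.find hex with hkdef
    have hmin : ∀ j : Fin n, (j : ℕ) < k → s j = 0 := fun j hj => by
      by_contra hcon
      exact Nat.find_min hex hj ⟨j.2, hcon⟩
    rw [liftSh_apply] at hs
    have hs' := congrArg (x ^ (n - 1 - k)) hs
    rw [map_sum, map_zero, Finset.sum_eq_single ⟨k, hk⟩] at hs'
    · rw [← Module.End.mul_apply, ← pow_add] at hs'
      simp only [Submodule.subtype_apply] at hs'
      rw [show n - 1 - k + k = n - 1 by omega] at hs'
      have := hx.ker_pow (by omega) _ hs'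
      rw [show n - (n - 1) = 1 by omega, pow_one] at this
      have h2 := hS.disjoint.le_bot ⟨(s ⟨k, hk⟩).2, this⟩
      exact hsk (Subtype.ext h2)
    · intro j _ hj
      rcases lt_trichotomy (j : ℕ) k with h | h | h
      · simp [hmin j h]
      · exact absurd (Fin.ext h) hj
      · rw [← Module.End.mul_apply, ← pow_add, pow_zero_of_le hx.1 (by omega)]; rfl
    · simp
  · have key : ∀ j (u : U), ∃ r : U, u - (x ^ j) r ∈ LinearMap.range (liftSh n x S.subtype) := by
      intro j
      induction j with
      | zero => intro u; exact ⟨u, by simp⟩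
      | succ j ih =>
        intro u
        obtain ⟨r, hr⟩ := ih u
        have : r ∈ S ⊔ LinearMap.range x := by rw [hS.sup_eq_top]; trivial
        obtain ⟨s, hs, _, ⟨r', rfl⟩, rfl⟩ := Submodule.mem_sup.1 this
        refine ⟨r', ?_⟩
        have h1 : u - (x ^ (j + 1)) r' = (u - (x ^ j) (s + x r')) + (x ^ j) s := by
          rw [pow_succ, Module.End.mul_apply, map_add]; abel
        rw [h1]
        refine Submodule.add_mem _ hr ?_
        by_cases hj : j < n
        · refine ⟨Pi.single ⟨j, hj⟩ ⟨s, hs⟩, ?_⟩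
          rw [liftSh_apply, Finset.sum_eq_single ⟨j, hj⟩]
          · simp
          · intro i _ hi; simp [Pi.single_eq_of_ne hi]
          · simp
        · rw [pow_zero_of_le hx.1 (by omega)]; simp
    intro u
    obtain ⟨r, hr⟩ := key n u
    rw [hx.1] at hr
    simpa using hr

theorem IsFreeOn.finrank_eq {n : ℕ} {x : Module.End K U} {T : S →ₗ[K] U} [FiniteDimensional K S]
    (hx : IsFreeOn n x T) : Module.finrank K U = n * Module.finrank K S := by
  rw [← (LinearEquiv.ofBijective _ hx.2).finrank_eq, Module.finrank_pi_fintype]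
  simp

theorem Cyc.finrank_eq {n : ℕ} [NeZero n] {x : Module.End K U} [FiniteDimensional K U]
    (hx : Cyc n x) : Module.finrank K U = n * Module.finrank K (LinearMap.ker x) := by
  obtain ⟨S, hS⟩ := Submodule.exists_isCompl (LinearMap.range x)
  rw [(hx.isFreeOn hS.symm).finrank_eq]
  have h1 := Submodule.finrank_add_eq_of_isCompl hS
  have h2 := LinearMap.finrank_range_add_finrank_ker x
  congr 1
  omega

/-- The map `u ↦ (g (y^(n-1-k) u))_k` into `S[X]/(Xⁿ)` with last component `g`. -/
def coSh (n : ℕ) (y : Module.End K Y) (g : Y →ₗ[K] S) : Y →ₗ[K] (Fin n → S) :=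
  LinearMap.pi fun k => g ∘ₗ (y ^ (n - 1 - (k : ℕ)))

theorem coSh_apply (n : ℕ) (y : Module.End K Y) (g : Y →ₗ[K] S) (u : Y) (k : Fin n) :
    coSh n y g u k = g ((y ^ (n - 1 - (k : ℕ))) u) := rfl

theorem coSh_comm (n : ℕ) {y : Module.End K Y} (hy : y ^ n = 0) (g : Y →ₗ[K] S) (u : Y) :
    coSh n y g (y u) = shift K n S (coSh n y g u) := by
  funext k
  rw [coSh_apply, ← Module.End.mul_apply, ← pow_succ]
  by_cases h : 0 < (k : ℕ)
  · simp only [shift, LinearMap.coe_mk, AddHom.coe_mk, h, dite_true, coSh_apply]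
    congr 3; omega
  · have : n - 1 - (k : ℕ) + 1 = n := by omega
    rw [this, hy]
    simp [shift, h]

theorem eq_coSh (n : ℕ) [NeZero n] {y : Module.End K Y} {F : Y →ₗ[K] (Fin n → S)}
    (hF : ∀ u, F (y u) = shift K n S (F u)) :
    F = coSh n y (LinearMap.proj (⟨n - 1, Nat.sub_lt (Nat.pos_of_ne_zero (NeZero.ne n)) one_pos⟩ :
      Fin n) ∘ₗ F) := by
  ext1 u
  funext k
  rw [coSh_apply, LinearMap.comp_apply, comm_pow hF, LinearMap.proj_apply, shift_pow_apply,
    dif_pos (by simp)]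
  exact congrArg _ (Fin.ext (by simp; omega))

end Shift

section Presentation

open Polynomial

/-- The path algebra relations for two vertices, loops `α`, `β` at them, and an arrow `μ`. -/
structure ArrowData {B : Type} [Ring B] (e f α β μ : B) : Prop where
  ee : e * e = e
  ff : f * f = f
  ef : e * f = 0
  fe : f * e = 0
  one : e + f = 1
  ea : e * α = α
  ae : α * e = α
  fb : f * β = β
  bf : β * f = β
  em : e * μ = μ
  mf : μ * f = μ

/-- The monomial relations: either the loop sits at the target of `μ` (`t = true`), or at its
source. -/
def Rel {B : Type} [Ring B] (t : Bool) (a b : ℕ) (α β μ : B) : Prop :=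
  cond t (α = 0 ∧ β ^ a = 0 ∧ μ * β ^ b = 0) (β = 0 ∧ α ^ a = 0 ∧ α ^ b * μ = 0)

/-- A presentation of `Λ` by two vertices, a loop and an arrow, with monomial relations. -/
structure Presented (K : Type) [Field K] (Λ : Type) [Ring Λ] [Algebra K Λ] (t : Bool)
    (a b : ℕ) where
  (e f α β μ : Λ)
  ad : ArrowData e f α β μ
  rel : Rel t a b α β μ
  gen : ∀ S : Subalgebra K Λ, e ∈ S → f ∈ S → α ∈ S → β ∈ S → μ ∈ S → S = ⊤
  lift : ∀ (B : Type) [Ring B] [Algebra K B] (e' f' α' β' μ' : B), ArrowData e' f' α' β' μ' →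
    Rel t a b α' β' μ' →
    ∃ φ : Λ →ₐ[K] B, φ e = e' ∧ φ f = f' ∧ φ α = α' ∧ φ β = β' ∧ φ μ = μ'

variable {K : Type} [Field K] {Λ : Type} [Ring Λ] [Algebra K Λ]

open MulOpposite in
theorem ArrowData.op {e f α β μ : Λ} (h : ArrowData e f α β μ) :
    ArrowData (op f) (op e) (op β) (op α) (op μ) where
  ee := by rw [← op_mul, h.ff]
  ff := by rw [← op_mul, h.ee]
  ef := by rw [← op_mul, h.ef, op_zero]
  fe := by rw [← op_mul, h.fe, op_zero]
  one := by rw [← op_add, add_comm, h.one, op_one]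
  ea := by rw [← op_mul, h.bf]
  ae := by rw [← op_mul, h.fb]
  fb := by rw [← op_mul, h.ae]
  bf := by rw [← op_mul, h.ea]
  em := by rw [← op_mul, h.mf]
  mf := by rw [← op_mul, h.em]

open MulOpposite in
theorem ArrowData.unop {e f α β μ : Λᵐᵒᵖ} (h : ArrowData e f α β μ) :
    ArrowData (unop f) (unop e) (unop β) (unop α) (unop μ) where
  ee := by rw [← unop_mul, h.ff]
  ff := by rw [← unop_mul, h.ee]
  ef := by rw [← unop_mul, h.ef, unop_zero]
  fe := by rw [← unop_mul, h.fe, unop_zero]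
  one := by rw [← unop_add, add_comm, h.one, unop_one]
  ea := by rw [← unop_mul, h.bf]
  ae := by rw [← unop_mul, h.fb]
  fb := by rw [← unop_mul, h.ae]
  bf := by rw [← unop_mul, h.ea]
  em := by rw [← unop_mul, h.mf]
  mf := by rw [← unop_mul, h.em]

/-- A presentation of the opposite algebra, with the loop at the target, gives a presentation
with the loop at the source. -/
def Presented.unop {a b : ℕ} (p : Presented K Λᵐᵒᵖ true a b) : Presented K Λ false a b where
  e := p.f.unop
  f := p.e.unop
  α := p.β.unop
  β := p.α.unop
  μ := p.μ.unop
  ad := p.ad.unop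
  rel := by
    obtain ⟨h1, h2, h3⟩ := p.rel
    refine ⟨by rw [h1]; rfl, ?_, ?_⟩
    · rw [← MulOpposite.unop_pow, h2]; rfl
    · rw [← MulOpposite.unop_pow, ← MulOpposite.unop_mul, h3]; rfl
  gen S he hf ha hb hm := by
    have := p.gen S.op hf he hb ha hm
    rw [eq_top_iff]
    intro x _
    have hx : MulOpposite.op x ∈ (⊤ : Subalgebra K Λᵐᵒᵖ) := trivial
    rw [← this] at hx
    exact hx
  lift B _ _ e' f' α' β' μ' had hrel := by
    obtain ⟨h1, h2, h3⟩ := hrel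
    obtain ⟨φ, he, hf, ha, hb, hm⟩ := p.lift Bᵐᵒᵖ _ _ _ _ _ had.op
      ⟨by rw [h1]; rfl, by rw [← MulOpposite.op_pow, h2]; rfl,
        by rw [← MulOpposite.op_pow, ← MulOpposite.op_mul, h3]; rfl⟩
    refine ⟨AlgHom.unop φ, ?_, ?_, ?_, ?_, ?_⟩
    · change MulOpposite.unop (φ p.f) = _; rw [hf]; rfl
    · change MulOpposite.unop (φ p.e) = _; rw [he]; rfl
    · change MulOpposite.unop (φ p.β) = _; rw [hb]; rfl
    · change MulOpposite.unop (φ p.α) = _; rw [ha]; rfl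
    · change MulOpposite.unop (φ p.μ) = _; rw [hm]; rfl

/-- The linear combination `c e + f p(β) + μ q(β)`. -/
def normalForm (K : Type) [Field K] [Algebra K Λ] (e f β μ : Λ) : K × K[X] × K[X] →ₗ[K] Λ :=
  LinearMap.coprod (LinearMap.toSpanSingleton K Λ e)
    (LinearMap.coprod (LinearMap.mulLeft K f ∘ₗ (aeval β).toLinearMap)
      (LinearMap.mulLeft K μ ∘ₗ (aeval β).toLinearMap))

theorem normalForm_apply (e f β μ : Λ) (c : K) (p q : K[X]) :
    normalForm K e f β μ (c, p, q) = c • e + (f * aeval β p + μ * aeval β q) := by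
  simp [normalForm]

section

variable {e f β μ : Λ}

theorem ArrowData.commute (h : ArrowData e f 0 β μ) (p : K[X]) : f * aeval β p = aeval β p * f := by
  have : Commute f β := h.fb.trans h.bf.symm
  have h2 : ∀ p : K[X], Commute f (aeval β p) := fun p => by
    induction p using Polynomial.induction_on' with
    | add p q hp hq => rw [map_add]; exact hp.add_right hq
    | monomial n c =>
      rw [aeval_monomial]
      exact Commute.mul_right (Algebra.commutes c f).symm (this.pow_right n)
  exact h2 p

theorem ArrowData.normalForm_mul (h : ArrowData e f 0 β μ) (c c' : K)
    (p q p' q' : K[X]) :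
    normalForm K e f β μ (c, p, q) * normalForm K e f β μ (c', p', q') =
      normalForm K e f β μ (c * c', p * p', c • q' + q * p') := by
  have hfm : f * μ = 0 := by rw [← h.em, ← mul_assoc, h.fe, zero_mul]
  have hme : μ * e = 0 := by rw [← h.mf, mul_assoc, h.fe, mul_zero]
  have h1 : ∀ r : K[X], f * aeval β r * e = 0 := fun r => by
    rw [h.commute, mul_assoc, h.fe, mul_zero]
  have h2 : ∀ r : K[X], μ * aeval β r * e = 0 := fun r => by
    rw [← h.mf, mul_assoc μ, h.commute, mul_assoc, mul_assoc, h.fe, mul_zero, mul_zero]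
  have h3 : ∀ r s : K[X], (f * aeval β r) * (f * aeval β s) = f * aeval β (r * s) := fun r s => by
    rw [h.commute r, mul_assoc, ← mul_assoc f f, h.ff, ← mul_assoc, ← h.commute, map_mul, mul_assoc]
  have h4 : ∀ r s : K[X], (f * aeval β r) * (μ * aeval β s) = 0 := fun r s => by
    rw [h.commute r, mul_assoc, ← mul_assoc f μ, hfm, zero_mul, mul_zero]
  have h5 : ∀ r s : K[X], (μ * aeval β r) * (f * aeval β s) = μ * aeval β (r * s) := fun r s => by
    rw [← h.mf, mul_assoc μ f, mul_assoc μ, h3, mul_assoc]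
  have h6 : ∀ r s : K[X], (μ * aeval β r) * (μ * aeval β s) = 0 := fun r s => by
    have : f * aeval β r * (μ * aeval β s) = 0 := h4 r s
    calc _ = μ * f * aeval β r * (μ * aeval β s) := by rw [h.mf]
      _ = μ * (f * aeval β r * (μ * aeval β s)) := by simp only [mul_assoc]
      _ = 0 := by rw [this, mul_zero]
  have h7 : ∀ r : K[X], e * (f * aeval β r) = 0 := fun r => by rw [← mul_assoc, h.ef, zero_mul]
  have h8 : ∀ r : K[X], e * (μ * aeval β r) = μ * aeval β r := fun r => by rw [← mul_assoc, h.em]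
  simp only [normalForm_apply, mul_add, add_mul, smul_mul_assoc, mul_smul_comm, h1, h2, h3, h4, h5,
    h6, h7, h8, h.ee, smul_zero, map_add, map_smul]
  rw [show (c * c') • e = c' • c • e by rw [smul_smul, mul_comm]]
  simp only [add_zero, zero_add]
  rw [add_comm (c • (μ * aeval β q'))]
  abel

theorem ArrowData.normalForm_one (h : ArrowData e f 0 β μ) :
    normalForm K e f β μ (1, 1, 0) = 1 := by
  simp [normalForm_apply, h.one]

theorem ArrowData.normalForm_surjective (h : ArrowData e f 0 β μ)
    (gen : ∀ S : Subalgebra K Λ, e ∈ S → f ∈ S → β ∈ S → μ ∈ S → S = ⊤) :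
    Function.Surjective (normalForm K e f β μ) := by
  have := gen (Submodule.toSubalgebra (LinearMap.range (normalForm K e f β μ)) ?_ ?_) ?_ ?_ ?_ ?_
  · intro x
    have hx : x ∈ (⊤ : Subalgebra K Λ) := trivial
    rw [← this] at hx
    exact hx
  · exact ⟨_, h.normalForm_one⟩
  · rintro _ _ ⟨⟨c, p, q⟩, rfl⟩ ⟨⟨c', p', q'⟩, rfl⟩
    exact ⟨_, (h.normalForm_mul c c' p q p' q').symm⟩
  · exact ⟨(1, 0, 0), by simp [normalForm_apply]⟩
  · exact ⟨(0, 1, 0), by simp [normalForm_apply]⟩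
  · exact ⟨(0, X, 0), by simp [normalForm_apply, h.fb]⟩
  · exact ⟨(0, 0, 1), by simp [normalForm_apply]⟩

theorem ArrowData.normalForm_eq_zero (h : ArrowData e f 0 β μ) {c : K} {p q : K[X]}
    (h0 : normalForm K e f β μ (c, p, q) = 0) :
    c • e = 0 ∧ f * aeval β p = 0 ∧ μ * aeval β q = 0 := by
  have h1 : normalForm K e f β μ (1, 0, 0) = e := by simp [normalForm_apply]
  have h2 : normalForm K e f β μ (0, 1, 0) = f := by simp [normalForm_apply]
  have hf : f * aeval β p = 0 := by
    have := congrArg (f * ·) h0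
    simp only [mul_zero] at this
    have h3 : f * normalForm K e f β μ (c, p, q) = normalForm K e f β μ (0, p, 0) := by
      nth_rw 1 [← h2]
      rw [h.normalForm_mul]; simp
    rw [h3] at this
    simpa [normalForm_apply] using this
  have he : c • e = 0 := by
    have := congrArg (· * e) h0
    simp only [zero_mul] at this
    have h3 : normalForm K e f β μ (c, p, q) * e = normalForm K e f β μ (c, 0, 0) := by
      nth_rw 2 [← h1]
      rw [h.normalForm_mul]; simp
    rw [h3] at this
    simpa [normalForm_apply] using this
  refine ⟨he, hf, ?_⟩
  rw [normalForm_apply, he, hf] at h0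
  simpa using h0

end

/-- The annihilator of `z` in `K[X]`, where `X` acts by right multiplication by `y`. -/
def annIdeal (K : Type) [Field K] [Algebra K Λ] (z y : Λ) : Ideal K[X] where
  carrier := {p | z * aeval y p = 0}
  add_mem' hp hq := by
    simp only [Set.mem_ofPred_eq] at hp hq
    simp [mul_add, hp, hq]
  zero_mem' := by simp
  smul_mem' r p hp := by
    simp only [Set.mem_ofPred_eq] at hp
    simp only [smul_eq_mul, Set.mem_ofPred_eq]
    rw [mul_comm, map_mul, ← mul_assoc, hp, zero_mul]

theorem X_pow_dvd_of_annIdeal {z y : Λ} {a : ℕ} (h : z * y ^ a = 0)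
    (hmin : ∀ k < a, z * y ^ k ≠ 0) {p : K[X]} (hp : z * aeval y p = 0) : X ^ a ∣ p := by
  obtain ⟨g, hg⟩ := IsPrincipalIdealRing.principal (annIdeal K z y)
  have hX : (X : K[X]) ^ a ∈ annIdeal K z y := by
    change z * aeval y (X ^ a) = 0
    simpa using h
  have hp' : p ∈ annIdeal K z y := hp
  rw [hg, Ideal.submodule_span_eq, Ideal.mem_span_singleton] at hX hp'
  obtain ⟨k, hk, hgk⟩ := (dvd_prime_pow Polynomial.prime_X a).1 hX
  have hXk : (X : K[X]) ^ k ∈ annIdeal K z y := by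
    rw [hg, Ideal.submodule_span_eq, Ideal.mem_span_singleton]
    exact hgk.dvd
  have hka : k = a := by
    by_contra hne
    apply hmin k (by omega)
    have : z * aeval y (X ^ k : K[X]) = 0 := hXk
    simpa using this
  subst hka
  exact hgk.symm.dvd.trans hp'

/-- The presentation with the loop at the target, from generators and minimal exponents. -/
theorem presented_of_gen {e f β μ : Λ} (h : ArrowData e f 0 β μ)
    (gen : ∀ S : Subalgebra K Λ, e ∈ S → f ∈ S → β ∈ S → μ ∈ S → S = ⊤) (hμ : μ ≠ 0)
    {N : ℕ} (hN : β ^ N = 0) :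
    ∃ a b : ℕ, 1 ≤ b ∧ b ≤ a ∧ Nonempty (Presented K Λ true a b) := by
  classical
  have hea : ∃ a, β ^ a = 0 := ⟨N, hN⟩
  have heb : ∃ b, μ * β ^ b = 0 := ⟨N, by rw [hN, mul_zero]⟩
  set a := Nat.find hea with ha_def
  set b := Nat.find heb with hb_def
  have ha : β ^ a = 0 := Nat.find_spec hea
  have hb : μ * β ^ b = 0 := Nat.find_spec heb
  have ha' : ∀ k < a, β ^ k ≠ 0 := fun k hk => Nat.find_min hea hk
  have hb' : ∀ k < b, μ * β ^ k ≠ 0 := fun k hk => Nat.find_min heb hk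
  have he : e ≠ 0 := fun h0 => hμ (by rw [← h.em, h0, zero_mul])
  have hf : f ≠ 0 := fun h0 => hμ (by rw [← h.mf, h0, mul_zero])
  refine ⟨a, b, ?_, ?_, ⟨⟨e, f, 0, β, μ, h, ⟨rfl, ha, hb⟩, fun S h1 h2 _ h3 h4 => gen S h1 h2 h3 h4,
    ?_⟩⟩⟩
  · by_contra hlt
    have : b = 0 := by omega
    rw [this] at hb
    simp at hb
    exact hμ hb
  · exact Nat.find_min' heb (by rw [ha, mul_zero])
  · intro B _ _ e' f' α' β' μ' had hrel
    obtain ⟨rfl, hr1, hr2⟩ := hrel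
    have hsurj := h.normalForm_surjective gen
    have hker : LinearMap.ker (normalForm K e f β μ) ≤ LinearMap.ker (normalForm K e' f' β' μ') := by
      rintro ⟨c, p, q⟩ h0
      obtain ⟨h1, h2, h3⟩ := h.normalForm_eq_zero h0
      have hc : c = 0 := (smul_eq_zero.1 h1).resolve_right he
      obtain ⟨p', rfl⟩ := X_pow_dvd_of_annIdeal (z := f) (y := β) (by rw [ha, mul_zero])
        (fun k hk h0 => by
          rcases Nat.eq_zero_or_pos k with rfl | hk0
          · simp at h0; exact hf h0
          · obtain ⟨l, rfl⟩ : ∃ l, k = l + 1 := ⟨k - 1, by omega⟩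
            rw [pow_succ', ← mul_assoc, h.fb, ← pow_succ'] at h0
            exact ha' _ hk h0) h2
      obtain ⟨q', rfl⟩ := X_pow_dvd_of_annIdeal (z := μ) (y := β) hb hb' h3
      rw [LinearMap.mem_ker, normalForm_apply, hc]
      simp only [zero_smul, map_mul, map_pow, aeval_X, hr1, zero_mul, mul_zero, zero_add]
      rw [← mul_assoc, hr2, zero_mul]
    let φ₀ : Λ →ₗ[K] B := (Submodule.liftQ _ _ hker) ∘ₗ
      ((normalForm K e f β μ).quotKerEquivOfSurjective hsurj).symm.toLinearMap
    have hφ₀ : ∀ x, φ₀ (normalForm K e f β μ x) = normalForm K e' f' β' μ' x := by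
      intro x
      have : ((normalForm K e f β μ).quotKerEquivOfSurjective hsurj).symm
          (normalForm K e f β μ x) = Submodule.Quotient.mk x := by
        rw [LinearEquiv.symm_apply_eq]; rfl
      simp only [φ₀, LinearMap.comp_apply, LinearEquiv.coe_coe, this]
      rfl
    let φ : Λ →ₐ[K] B := AlgHom.ofLinearMap φ₀
      (by rw [← h.normalForm_one (K := K), hφ₀, had.normalForm_one])
      (fun x y => by
        obtain ⟨⟨c, p, q⟩, rfl⟩ := hsurj x
        obtain ⟨⟨c', p', q'⟩, rfl⟩ := hsurj y
        rw [h.normalForm_mul, hφ₀, hφ₀, hφ₀, had.normalForm_mul])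
    refine ⟨φ, ?_, ?_, map_zero _, ?_, ?_⟩
    · have := hφ₀ (1, 0, 0); change φ₀ e = _; simpa [normalForm_apply] using this
    · have := hφ₀ (0, 1, 0); change φ₀ f = _; simpa [normalForm_apply] using this
    · have := hφ₀ (0, X, 0); change φ₀ β = _; simpa [normalForm_apply, h.fb, had.fb] using this
    · have := hφ₀ (0, 0, 1); change φ₀ μ = _; simpa [normalForm_apply] using this

end Presentation

section Admissible

variable {K : Type} [Field K] {i j m n : ℕ}

/-- A representation of the path algebra by `2 × 2` matrices in which the loops act as zero. -/
def pathMatrixFree (K : Type) [Field K] (i j m n : ℕ) :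
    FreeAlgebra K (TPGen (QArrow i j m n)) →ₐ[K] Matrix (Fin 2) (Fin 2) K :=
  FreeAlgebra.lift K fun g => match g with
    | .v k => Matrix.single k k 1
    | .ar x => if QSrc i j m n x = QTgt i j m n x then 0 else
        Matrix.single (QSrc i j m n x) (QTgt i j m n x) 1

theorem pathMatrixFree_vtx (k : Fin 2) :
    pathMatrixFree K i j m n (vtx K k) = Matrix.single k k 1 := by
  simp [pathMatrixFree, vtx]

theorem pathMatrixFree_arr (x : QArrow i j m n) :
    pathMatrixFree K i j m n (arr K x) = if QSrc i j m n x = QTgt i j m n x then 0 else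
        Matrix.single (QSrc i j m n x) (QTgt i j m n x) 1 := by
  simp [pathMatrixFree, arr]

/-- The induced representation of the path algebra. -/
def pathMatrix (K : Type) [Field K] (i j m n : ℕ) :
    PathAlgebra K i j m n →ₐ[K] Matrix (Fin 2) (Fin 2) K :=
  RingQuot.liftAlgHom K ⟨pathMatrixFree K i j m n, by
    intro x y h
    induction h with
    | idem k => rw [map_mul, pathMatrixFree_vtx]; simp
    | orth k l hkl => rw [map_mul, pathMatrixFree_vtx, pathMatrixFree_vtx]; simp [hkl]
    | vsum =>
      rw [map_add, pathMatrixFree_vtx, pathMatrixFree_vtx, map_one]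
      ext a b; fin_cases a <;> fin_cases b <;> simp
    | src x => rw [map_mul, pathMatrixFree_vtx, pathMatrixFree_arr]; split_ifs <;> simp
    | tgt x => rw [map_mul, pathMatrixFree_vtx, pathMatrixFree_arr]; split_ifs <;> simp
    | rel p hp => exact absurd hp (Set.notMem_empty p)⟩

theorem pathMatrix_arrow (x : QArrow i j m n) :
    pathMatrix K i j m n (pathArrow K x) = if QSrc i j m n x = QTgt i j m n x then 0 else
        Matrix.single (QSrc i j m n x) (QTgt i j m n x) 1 := by
  rw [pathMatrix, pathArrow, RingQuot.liftAlgHom_mkAlgHom_apply, pathMatrixFree_arr]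

theorem pathMatrix_arrow_mul (hmn : m + n = 1) (x y : QArrow i j m n) :
    pathMatrix K i j m n (pathArrow K x) * pathMatrix K i j m n (pathArrow K y) = 0 := by
  rw [pathMatrix_arrow, pathMatrix_arrow]
  rcases x with (x | x) | (x | x) <;> rcases y with (y | y) | (y | y) <;>
    simp [QSrc, QTgt]
  · have := x.2; have := y.2; omega
  · have := x.2; have := y.2; omega

theorem arrow_ne_zero (hmn : m + n = 1) {Λ : Type} [Ring Λ] [Algebra K Λ]
    {π : PathAlgebra K i j m n →ₐ[K] Λ} (hπ : IsAdmissiblePresentation K Λ π) (x : Fin m ⊕ Fin n) :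
    π (pathArrow K (Sum.inr x)) ≠ 0 := by
  intro h0
  have hmem := hπ.2.1 _ h0
  have hle : twoSidedSpan K (PathAlgebra K i j m n) (NProd (Set.range (pathArrow K)) 2) ≤
      LinearMap.ker (pathMatrix K i j m n).toLinearMap := by
    refine Submodule.span_le.2 ?_
    rintro _ ⟨p, s, q, ⟨l, hl, hl', rfl⟩, rfl⟩
    obtain ⟨a, b, rfl⟩ := List.length_eq_two.1 hl
    obtain ⟨a, rfl⟩ := hl' a (by simp)
    obtain ⟨b, rfl⟩ := hl' b (by simp)
    simp [pathMatrix_arrow_mul hmn]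
  have := hle hmem
  rw [LinearMap.mem_ker, AlgHom.toLinearMap_apply] at this
  replace this := (pathMatrix_arrow _).symm.trans this
  rcases x with x | x
  · have := congrFun (congrFun this 0) 1
    simp [QSrc, QTgt] at this
  · have := congrFun (congrFun this 1) 0
    simp [QSrc, QTgt] at this

theorem boundQuiver_adjoin {σ : Type} {s t : σ → Fin 2}
    {rels : Set (FreeAlgebra K (TPGen σ) × FreeAlgebra K (TPGen σ))} {Λ : Type} [Ring Λ]
    [Algebra K Λ] {π : BoundQuiverAlgebra K σ s t rels →ₐ[K] Λ} (hπ : Function.Surjective π)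
    (S : Subalgebra K Λ) (hv : ∀ k, π (RingQuot.mkAlgHom K _ (vtx K k)) ∈ S)
    (ha : ∀ x, π (RingQuot.mkAlgHom K _ (arr K x)) ∈ S) : S = ⊤ := by
  rw [eq_top_iff]
  rintro y -
  obtain ⟨y, rfl⟩ := hπ y
  obtain ⟨y, rfl⟩ := RingQuot.mkAlgHom_surjective K (QuivRel K σ s t rels) y
  induction y using FreeAlgebra.induction with
  | grade0 c => rw [AlgHom.commutes, AlgHom.commutes]; exact S.algebraMap_mem c
  | grade1 g =>
    rcases g with k | x
    · exact hv k
    · exact ha x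
  | mul a b ha hb => rw [map_mul, map_mul]; exact S.mul_mem ha hb
  | add a b ha hb => rw [map_add, map_add]; exact S.add_mem ha hb

section BoundQuiver

variable {σ : Type} {s t : σ → Fin 2}
    {rels : Set (FreeAlgebra K (TPGen σ) × FreeAlgebra K (TPGen σ))} {Λ : Type} [Ring Λ]
    [Algebra K Λ] (π : BoundQuiverAlgebra K σ s t rels →ₐ[K] Λ)

theorem quiv_idem (k : Fin 2) : π (RingQuot.mkAlgHom K _ (vtx K k)) *
    π (RingQuot.mkAlgHom K _ (vtx K k)) = π (RingQuot.mkAlgHom K _ (vtx K k)) := by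
  rw [← map_mul, ← map_mul]
  exact congrArg π (RingQuot.mkAlgHom_rel K (QuivRel.idem k))

theorem quiv_orth {k l : Fin 2} (h : k ≠ l) : π (RingQuot.mkAlgHom K _ (vtx K k)) *
    π (RingQuot.mkAlgHom K _ (vtx K l)) = 0 := by
  rw [← map_mul, ← map_mul]
  exact (congrArg π (RingQuot.mkAlgHom_rel K (QuivRel.orth k l h))).trans (by simp)

theorem quiv_vsum : π (RingQuot.mkAlgHom K _ (vtx K 0)) +
    π (RingQuot.mkAlgHom K _ (vtx K 1)) = 1 := by
  rw [← map_add, ← map_add]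
  exact (congrArg π (RingQuot.mkAlgHom_rel K QuivRel.vsum)).trans (by simp)

theorem quiv_src (x : σ) : π (RingQuot.mkAlgHom K _ (vtx K (s x))) *
    π (RingQuot.mkAlgHom K _ (arr K x)) = π (RingQuot.mkAlgHom K _ (arr K x)) := by
  rw [← map_mul, ← map_mul]
  exact congrArg π (RingQuot.mkAlgHom_rel K (QuivRel.src x))

theorem quiv_tgt (x : σ) : π (RingQuot.mkAlgHom K _ (arr K x)) *
    π (RingQuot.mkAlgHom K _ (vtx K (t x))) = π (RingQuot.mkAlgHom K _ (arr K x)) := by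
  rw [← map_mul, ← map_mul]
  exact congrArg π (RingQuot.mkAlgHom_rel K (QuivRel.tgt x))

/-- The path algebra relations for a loop at the target of an arrow. -/
theorem arrowData_target {u w : Fin 2} (huw : u ≠ w) {x y : σ} (hx : s x = u) (hx' : t x = w)
    (hy : s y = w) (hy' : t y = w) :
    ArrowData (π (RingQuot.mkAlgHom K _ (vtx K u))) (π (RingQuot.mkAlgHom K _ (vtx K w))) 0
      (π (RingQuot.mkAlgHom K _ (arr K y))) (π (RingQuot.mkAlgHom K _ (arr K x))) where
  ee := quiv_idem π u
  ff := quiv_idem π w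
  ef := quiv_orth π huw
  fe := quiv_orth π huw.symm
  one := by
    fin_cases u <;> fin_cases w <;> simp at huw
    · exact quiv_vsum π
    · rw [add_comm]; exact quiv_vsum π
  ea := mul_zero _
  ae := zero_mul _
  fb := by have := quiv_src π y; rwa [hy] at this
  bf := by have := quiv_tgt π y; rwa [hy'] at this
  em := by have := quiv_src π x; rwa [hx] at this
  mf := by have := quiv_tgt π x; rwa [hx'] at this

/-- The path algebra relations for a loop at the source of an arrow. -/
theorem arrowData_source {u w : Fin 2} (huw : u ≠ w) {x y : σ} (hx : s x = u) (hx' : t x = w)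
    (hy : s y = u) (hy' : t y = u) :
    ArrowData (π (RingQuot.mkAlgHom K _ (vtx K u))) (π (RingQuot.mkAlgHom K _ (vtx K w)))
      (π (RingQuot.mkAlgHom K _ (arr K y))) 0 (π (RingQuot.mkAlgHom K _ (arr K x))) where
  ee := quiv_idem π u
  ff := quiv_idem π w
  ef := quiv_orth π huw
  fe := quiv_orth π huw.symm
  one := by
    fin_cases u <;> fin_cases w <;> simp at huw
    · exact quiv_vsum π
    · rw [add_comm]; exact quiv_vsum π
  fb := mul_zero _
  bf := zero_mul _
  ea := by have := quiv_src π y; rwa [hy] at this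
  ae := by have := quiv_tgt π y; rwa [hy'] at this
  em := by have := quiv_src π x; rwa [hx] at this
  mf := by have := quiv_tgt π x; rwa [hx'] at this

end BoundQuiver

theorem exists_presented_aux {Λ : Type} [Ring Λ] [Algebra K Λ] (hmn : m + n = 1)
    {π : PathAlgebra K i j m n →ₐ[K] Λ} (hπ : IsAdmissiblePresentation K Λ π)
    {u w : Fin 2} (huw : u ≠ w) (x : Fin m ⊕ Fin n) (y : Fin i ⊕ Fin j)
    (hxy : ∀ z : QArrow i j m n, z = Sum.inr x ∨ z = Sum.inl y)
    (hx : QSrc i j m n (Sum.inr x) = u) (hx' : QTgt i j m n (Sum.inr x) = w) :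
    ∃ (t : Bool) (a b : ℕ), 1 ≤ b ∧ b ≤ a ∧ Nonempty (Presented K Λ t a b) := by
  obtain ⟨hsurj, -, N, -, hN⟩ := id hπ
  have hnil : π (pathArrow K (Sum.inl y)) ^ N = 0 := by
    rw [← map_pow]
    exact hN _ ⟨List.replicate N (pathArrow K (Sum.inl y)), by simp, by
      intro z hz; exact ⟨_, (List.eq_of_mem_replicate hz).symm⟩, by simp⟩
  have hne := arrow_ne_zero hmn hπ x
  have hloop : QSrc i j m n (Sum.inl y) = QTgt i j m n (Sum.inl y) := by
    rcases y with y | y <;> rfl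
  have hvert : ∀ {P : Fin 2 → Prop}, P u → P w → ∀ k, P k := by
    intro P hu hw k
    have : k = u ∨ k = w := by omega
    rcases this with rfl | rfl <;> assumption
  have harr : ∀ {P : QArrow i j m n → Prop}, P (Sum.inr x) → P (Sum.inl y) → ∀ k, P k := by
    intro P h1 h2 k
    rcases hxy k with rfl | rfl <;> assumption
  have hy : QSrc i j m n (Sum.inl y) = w ∨ QSrc i j m n (Sum.inl y) = u := by
    generalize QSrc i j m n (Sum.inl y) = z
    omega
  rcases hy with hy | hy
  · have had := arrowData_target π huw hx hx' hy (hloop ▸ hy)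
    obtain ⟨a, b, h1, h2, h3⟩ := presented_of_gen had (fun S h1 h2 h3 h4 =>
      boundQuiver_adjoin hsurj S (hvert h1 h2) (harr h4 h3)) hne hnil
    exact ⟨true, a, b, h1, h2, h3⟩
  · have had := arrowData_source π huw hx hx' hy (hloop ▸ hy)
    obtain ⟨a, b, h1, h2, ⟨h3⟩⟩ := presented_of_gen (Λ := Λᵐᵒᵖ) had.op (N := N) (fun S h1 h2 h3 h4 => by
      have : S.unop = ⊤ := boundQuiver_adjoin hsurj S.unop (hvert h2 h1) (harr h4 h3)
      rw [eq_top_iff]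
      intro z _
      have hz : z.unop ∈ (⊤ : Subalgebra K Λ) := trivial
      rw [← this] at hz
      exact hz) ((MulOpposite.op_ne_zero_iff _).2 hne) (by
        rw [← MulOpposite.op_pow, ← MulOpposite.op_zero]
        exact congrArg _ hnil)
    exact ⟨false, a, b, h1, h2, ⟨h3.unop⟩⟩

theorem exists_presented {Λ : Type} [Ring Λ] [Algebra K Λ] (hmn : m + n = 1) (hij : i + j = 1)
    {π : PathAlgebra K i j m n →ₐ[K] Λ} (hπ : IsAdmissiblePresentation K Λ π) :
    ∃ (t : Bool) (a b : ℕ), 1 ≤ b ∧ b ≤ a ∧ Nonempty (Presented K Λ t a b) := by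
  obtain ⟨x⟩ : Nonempty (Fin m ⊕ Fin n) := by
    rw [← Fintype.card_pos_iff]; simp; omega
  obtain ⟨y⟩ : Nonempty (Fin i ⊕ Fin j) := by
    rw [← Fintype.card_pos_iff]; simp; omega
  have h1 : Subsingleton (Fin m ⊕ Fin n) := by
    rw [← Fintype.card_le_one_iff_subsingleton]; simp; omega
  have h2 : Subsingleton (Fin i ⊕ Fin j) := by
    rw [← Fintype.card_le_one_iff_subsingleton]; simp; omega
  refine exists_presented_aux hmn hπ (x := x) (y := y) (u := QSrc i j m n (Sum.inr x))
    (w := QTgt i j m n (Sum.inr x)) ?_ ?_ rfl rfl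
  · rcases x with x | x <;> simp [QSrc, QTgt]
  · rintro (z | z)
    · right; rw [Subsingleton.elim z y]
    · left; rw [Subsingleton.elim z x]

end Admissible

section Factor

open Polynomial MulOpposite

variable {K : Type} [Field K] {Λ : Type} [Ring Λ] [Algebra K Λ]

/-- Commutators are annihilated on the right by the cube of a translate of any element. -/
def RightCubic (K : Type) [Field K] (A : Type) [Ring A] [Algebra K A] : Prop :=
  ∀ y : A, ∃ c : K, ∀ p q : A, (p * q - q * p) * (y - algebraMap K A c) ^ 3 = 0

/-- Commutators are annihilated on the left by the cube of a translate of any element. -/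
def LeftCubic (K : Type) [Field K] (A : Type) [Ring A] [Algebra K A] : Prop :=
  ∀ y : A, ∃ c : K, ∀ p q : A, (y - algebraMap K A c) ^ 3 * (p * q - q * p) = 0

theorem leftCubic_of_op (h : RightCubic K Λᵐᵒᵖ) : LeftCubic K Λ := by
  intro y
  obtain ⟨c, hc⟩ := h (op y)
  refine ⟨c, fun p q => ?_⟩
  have := congrArg unop (hc (op q) (op p))
  simpa using this

theorem rightCubic_of_op (h : LeftCubic K Λᵐᵒᵖ) : RightCubic K Λ := by
  intro y
  obtain ⟨c, hc⟩ := h (op y)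
  refine ⟨c, fun p q => ?_⟩
  have := congrArg unop (hc (op q) (op p))
  simpa using this

theorem RightCubic.of_surjective {B : Type} [Ring B] [Algebra K B] (h : RightCubic K Λ)
    {φ : Λ →ₐ[K] B} (hφ : Function.Surjective φ) : RightCubic K B := by
  intro y
  obtain ⟨y, rfl⟩ := hφ y
  obtain ⟨c, hc⟩ := h y
  refine ⟨c, fun p q => ?_⟩
  obtain ⟨p, rfl⟩ := hφ p
  obtain ⟨q, rfl⟩ := hφ q
  simpa using congrArg φ (hc p q)

theorem LeftCubic.of_surjective {B : Type} [Ring B] [Algebra K B] (h : LeftCubic K Λ)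
    {φ : Λ →ₐ[K] B} (hφ : Function.Surjective φ) : LeftCubic K B := by
  intro y
  obtain ⟨y, rfl⟩ := hφ y
  obtain ⟨c, hc⟩ := h y
  refine ⟨c, fun p q => ?_⟩
  obtain ⟨p, rfl⟩ := hφ p
  obtain ⟨q, rfl⟩ := hφ q
  simpa using congrArg φ (hc p q)

theorem cubic_of_gen {e f β μ : Λ} (h : ArrowData e f 0 β μ)
    (gen : ∀ S : Subalgebra K Λ, e ∈ S → f ∈ S → β ∈ S → μ ∈ S → S = ⊤) (h3 : μ * β ^ 3 = 0) :
    RightCubic K Λ ∧ LeftCubic K Λ := by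
  have hs := h.normalForm_surjective gen
  have halg : ∀ d : K, algebraMap K Λ d = normalForm K e f β μ (d, C d, 0) := by
    intro d
    simp only [normalForm_apply, aeval_C, map_zero, mul_zero, add_zero, Algebra.algebraMap_eq_smul_one]
    rw [mul_smul_comm, mul_one, ← smul_add, h.one]
  have hcomm : ∀ x y : Λ, ∃ r, x * y - y * x = normalForm K e f β μ (0, 0, r) := by
    intro x y
    obtain ⟨⟨c, p, q⟩, rfl⟩ := hs x
    obtain ⟨⟨c', p', q'⟩, rfl⟩ := hs y
    rw [h.normalForm_mul, h.normalForm_mul, ← map_sub]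
    refine ⟨(c • q' + q * p') - (c' • q + q' * p), ?_⟩
    congr 1
    simp [mul_comm]
  have hsub : ∀ (c d : K) (p q : K[X]), normalForm K e f β μ (c, p, q) - algebraMap K Λ d =
      normalForm K e f β μ (c - d, p - C d, q) := fun c d p q => by
    rw [halg, ← map_sub]; simp
  constructor
  · intro y
    obtain ⟨⟨c, p, q⟩, rfl⟩ := hs y
    refine ⟨p.coeff 0, fun x z => ?_⟩
    obtain ⟨r, hr⟩ := hcomm x z
    rw [hr, hsub]
    obtain ⟨s, hs⟩ : X ∣ p - C (p.coeff 0) := by rw [X_dvd_iff]; simp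
    rw [hs, pow_succ, pow_two, ← mul_assoc, ← mul_assoc, h.normalForm_mul, h.normalForm_mul,
      h.normalForm_mul, normalForm_apply]
    have : r * (X * s) * (X * s) * (X * s) = X ^ 3 * (r * s ^ 3) := by ring
    simp only [zero_mul, zero_smul, zero_add, map_zero, mul_zero, this]
    rw [map_mul, ← mul_assoc]
    simp [h3]
  · intro y
    obtain ⟨⟨c, p, q⟩, rfl⟩ := hs y
    refine ⟨c, fun x z => ?_⟩
    obtain ⟨r, hr⟩ := hcomm x z
    rw [hr, hsub, pow_succ, mul_assoc, h.normalForm_mul]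
    simp [normalForm_apply]

/-- A representation of the quiver of `Γ₃` by `5 × 5` matrices. -/
def gamma3Free (K : Type) [Field K] : FreeAlgebra K (TPGen (Fin 2)) →ₐ[K] Matrix (Fin 5) (Fin 5) K :=
  FreeAlgebra.lift K fun g => match g with
    | .v 0 => !![1, 0, 0, 0, 0; 0, 0, 0, 0, 0; 0, 0, 0, 0, 0; 0, 0, 0, 0, 0; 0, 0, 0, 0, 0]
    | .v 1 => !![0, 0, 0, 0, 0; 0, 1, 0, 0, 0; 0, 0, 1, 0, 0; 0, 0, 0, 1, 0; 0, 0, 0, 0, 1]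
    | .ar 0 => !![0, 1, 0, 0, 0; 0, 0, 0, 0, 0; 0, 0, 0, 0, 0; 0, 0, 0, 0, 0; 0, 0, 0, 0, 0]
    | .ar 1 => !![0, 0, 0, 0, 0; 0, 0, 1, 0, 0; 0, 0, 0, 1, 0; 0, 0, 0, 0, 1; 0, 0, 0, 0, 0]

theorem gamma3Free_ar1_pow :
    (!![0, 0, 0, 0, 0; 0, 0, 1, 0, 0; 0, 0, 0, 1, 0; 0, 0, 0, 0, 1; 0, 0, 0, 0, 0] :
      Matrix (Fin 5) (Fin 5) K) ^ 4 = 0 := by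
  rw [pow_succ, pow_succ, pow_two]
  ext i j
  fin_cases i <;> fin_cases j <;> simp [Matrix.mul_apply, Fin.sum_univ_succ]

/-- The induced representation of `Γ₃`. -/
def gamma3Matrix (K : Type) [Field K] : Gamma3 K →ₐ[K] Matrix (Fin 5) (Fin 5) K :=
  RingQuot.liftAlgHom K ⟨gamma3Free K, by
    intro x y h
    induction h with
    | idem k =>
      fin_cases k <;> simp only [gamma3Free, vtx, map_mul, FreeAlgebra.lift_ι_apply] <;>
        ext i j <;> fin_cases i <;> fin_cases j <;> simp [Matrix.mul_apply, Fin.sum_univ_succ]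
    | orth k l hkl =>
      fin_cases k <;> fin_cases l <;> first | exact absurd rfl hkl | skip
      all_goals simp only [gamma3Free, vtx, map_mul, map_zero, FreeAlgebra.lift_ι_apply]
      all_goals
        ext i j
        fin_cases i <;> fin_cases j <;> simp [Matrix.mul_apply, Fin.sum_univ_succ]
    | vsum =>
      simp only [gamma3Free, vtx, map_add, map_one, FreeAlgebra.lift_ι_apply]
      ext i j
      fin_cases i <;> fin_cases j <;> simp
    | src k =>
      fin_cases k <;> simp only [gamma3Free, vtx, arr, QA.s, map_mul, FreeAlgebra.lift_ι_apply] <;>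
        ext i j <;> fin_cases i <;> fin_cases j <;> simp [Matrix.mul_apply, Fin.sum_univ_succ]
    | tgt k =>
      fin_cases k <;> simp only [gamma3Free, vtx, arr, QA.t, map_mul, FreeAlgebra.lift_ι_apply] <;>
        ext i j <;> fin_cases i <;> fin_cases j <;> simp [Matrix.mul_apply, Fin.sum_univ_succ]
    | rel p hp =>
      rw [Set.mem_singleton_iff] at hp
      subst hp
      simp only [gamma3Free, QA.be, arr, map_pow, map_zero, FreeAlgebra.lift_ι_apply]
      exact gamma3Free_ar1_pow⟩

theorem arrowData_gamma3 : ArrowData (RingQuot.mkAlgHom K _ (vtx K 0) : Gamma3 K)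
    (RingQuot.mkAlgHom K _ (vtx K 1)) 0 (RingQuot.mkAlgHom K _ (arr K 1))
    (RingQuot.mkAlgHom K _ (arr K 0)) :=
  arrowData_target (AlgHom.id K (Gamma3 K)) (u := 0) (w := 1) (x := 0) (y := 1) (by decide)
    rfl rfl rfl rfl

theorem not_rightCubic_gamma3 : ¬ RightCubic K (Gamma3 K) := by
  intro h
  have had := arrowData_gamma3 (K := K)
  obtain ⟨c, hc⟩ := h (RingQuot.mkAlgHom K _ (arr K 1))
  have h1 := hc (RingQuot.mkAlgHom K _ (vtx K 0)) (RingQuot.mkAlgHom K _ (arr K 0))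
  rw [had.em, show (RingQuot.mkAlgHom K _ (arr K 0) : Gamma3 K) * RingQuot.mkAlgHom K _ (vtx K 0)
    = 0 by rw [← had.mf, mul_assoc, had.fe, mul_zero], sub_zero] at h1
  have h2 := congrArg (gamma3Matrix K) h1
  rw [map_mul, map_pow, map_sub, AlgHom.commutes, map_zero, gamma3Matrix,
    RingQuot.liftAlgHom_mkAlgHom_apply, RingQuot.liftAlgHom_mkAlgHom_apply] at h2
  simp only [gamma3Free, arr, FreeAlgebra.lift_ι_apply] at h2
  rw [Algebra.algebraMap_eq_smul_one, pow_succ, pow_two, ← Matrix.mul_assoc, ← Matrix.mul_assoc] at h2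
  have h3 := congrFun (congrFun h2 0) 4
  have hM : (!![0, 0, 0, 0, 0; 0, 0, 1, 0, 0; 0, 0, 0, 1, 0; 0, 0, 0, 0, 1; 0, 0, 0, 0, 0] - c • 1 :
      Matrix (Fin 5) (Fin 5) K) =
      !![-c, 0, 0, 0, 0; 0, -c, 1, 0, 0; 0, 0, -c, 1, 0; 0, 0, 0, -c, 1; 0, 0, 0, 0, -c] := by
    ext i j
    fin_cases i <;> fin_cases j <;> simp
  rw [hM] at h3
  simp at h3

theorem gamma3_adjoin (S : Subalgebra K (Gamma3 K)) (h0 : RingQuot.mkAlgHom K _ (vtx K 0) ∈ S)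
    (h1 : RingQuot.mkAlgHom K _ (vtx K 1) ∈ S) (h2 : RingQuot.mkAlgHom K _ (arr K 0) ∈ S)
    (h3 : RingQuot.mkAlgHom K _ (arr K 1) ∈ S) : S = ⊤ :=
  boundQuiver_adjoin (π := AlgHom.id K (Gamma3 K)) Function.surjective_id S
    (Fin.forall_fin_two.2 ⟨h0, h1⟩) (Fin.forall_fin_two.2 ⟨h2, h3⟩)

theorem gamma3_beta_pow {a : ℕ} (ha : 4 ≤ a) :
    (RingQuot.mkAlgHom K _ (arr K 1) : Gamma3 K) ^ a = 0 := by
  have h4 : (RingQuot.mkAlgHom K _ (arr K 1) : Gamma3 K) ^ 4 = 0 := by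
    rw [← map_pow, ← map_zero (RingQuot.mkAlgHom K _)]
    exact RingQuot.mkAlgHom_rel K (QuivRel.rel (QA.be K ^ 4, 0) rfl)
  rw [← Nat.sub_add_cancel ha, pow_add, h4, mul_zero]

theorem Presented.isFactor_gamma3 {t : Bool} {a b : ℕ} (p : Presented K Λ t a b) (hb : 4 ≤ b)
    (hab : b ≤ a) :
    IsFactorAlgebra K (Gamma3 K) Λ ∨ IsFactorAlgebra K ((Gamma3 K)ᵐᵒᵖ) Λ := by
  have had := arrowData_gamma3 (K := K)
  cases t with
  | true =>
    left
    obtain ⟨φ, he, hf, -, hβ, hμ⟩ := p.lift _ _ _ _ _ _ had ⟨rfl, gamma3_beta_pow (hb.trans hab), by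
      rw [gamma3_beta_pow hb, mul_zero]⟩
    refine ⟨φ, (AlgHom.range_eq_top φ).1 ?_⟩
    exact gamma3_adjoin _ ⟨_, he⟩ ⟨_, hf⟩ ⟨_, hμ⟩ ⟨_, hβ⟩
  | false =>
    right
    obtain ⟨φ, he, hf, hα, -, hμ⟩ := p.lift _ _ _ _ _ _ had.op ⟨rfl, by
      rw [← op_pow, gamma3_beta_pow (hb.trans hab), op_zero], by
      rw [← op_pow, gamma3_beta_pow hb, op_zero, zero_mul]⟩
    refine ⟨φ, (AlgHom.range_eq_top φ).1 ?_⟩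
    have : φ.range.unop = ⊤ := gamma3_adjoin _ ⟨_, hf⟩ ⟨_, he⟩ ⟨_, hμ⟩ ⟨_, hα⟩
    rw [eq_top_iff]
    intro z _
    have hz : z.unop ∈ (⊤ : Subalgebra K (Gamma3 K)) := trivial
    rw [← this] at hz
    exact hz

theorem Presented.not_isFactor_gamma3 {t : Bool} {a b : ℕ} (p : Presented K Λ t a b) (hb : b ≤ 3) :
    ¬ (IsFactorAlgebra K (Gamma3 K) Λ ∨ IsFactorAlgebra K ((Gamma3 K)ᵐᵒᵖ) Λ) := by
  have key : RightCubic K Λ ∧ LeftCubic K Λ := by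
    cases t with
    | true =>
      have had := p.ad
      obtain ⟨h1, h2, h3⟩ := p.rel
      rw [h1] at had
      refine cubic_of_gen had (fun S ha hb hc hd => p.gen S ha hb ?_ hc hd) ?_
      · rw [h1]; exact S.zero_mem
      · rw [← Nat.add_sub_cancel' hb, pow_add, ← mul_assoc, h3, zero_mul]
    | false =>
      have had := p.ad.op
      obtain ⟨h1, h2, h3⟩ := p.rel
      rw [h1, op_zero] at had
      have := cubic_of_gen (K := K) had (fun S ha hb hc hd => by
        have : S.unop = ⊤ := p.gen S.unop hb ha hc (by rw [h1]; exact S.unop.zero_mem) hd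
        rw [eq_top_iff]
        intro z _
        have hz : z.unop ∈ (⊤ : Subalgebra K Λ) := trivial
        rw [← this] at hz
        exact hz) (by
          rw [← op_pow, ← op_mul, ← Nat.sub_add_cancel hb, pow_add, mul_assoc, h3, mul_zero, op_zero])
      exact ⟨rightCubic_of_op this.2, leftCubic_of_op this.1⟩
  rintro (⟨φ, hφ⟩ | ⟨φ, hφ⟩)
  · exact not_rightCubic_gamma3 (key.1.of_surjective hφ)
  · exact not_rightCubic_gamma3 (rightCubic_of_op (key.2.of_surjective hφ))

end Factor

section Representations

open MulOpposite

/-- Representations of the two-vertex quiver with a loop at each vertex and an arrow, satisfying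
the monomial relations (so that one of the loops acts as zero). -/
structure Rep (K : Type) [Field K] (t : Bool) (a b : ℕ) where
  (V W : Type)
  [instV : AddCommGroup V]
  [instW : AddCommGroup W]
  [modV : Module K V]
  [modW : Module K W]
  (α : Module.End K V)
  (β : Module.End K W)
  (h : V →ₗ[K] W)
  rel : cond t (α = 0 ∧ β ^ a = 0 ∧ ∀ v, (β ^ b) (h v) = 0)
    (β = 0 ∧ α ^ a = 0 ∧ ∀ v, h ((α ^ b) v) = 0)

attribute [instance] Rep.instV Rep.instW Rep.modV Rep.modW

/-- Morphisms of representations. -/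
structure Rep.Hom {K : Type} [Field K] {t : Bool} {a b : ℕ} (r s : Rep K t a b) where
  f : r.V →ₗ[K] s.V
  g : r.W →ₗ[K] s.W
  comm_α : ∀ v, f (r.α v) = s.α (f v)
  comm_β : ∀ w, g (r.β w) = s.β (g w)
  comm_h : ∀ v, g (r.h v) = s.h (f v)

variable {K : Type} [Field K] {Λ : Type} [Ring Λ] [Algebra K Λ] {t : Bool} {a b : ℕ}

theorem Rep.exists_act [NeZero a] (p : Presented K Λ t a b) (r : Rep K t a b) :
    ∃ φ : Λᵐᵒᵖ →ₐ[K] Module.End K (r.V × r.W),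
      (∀ v w, φ (op p.e) (v, w) = (v, 0)) ∧ (∀ v w, φ (op p.f) (v, w) = (0, w)) ∧
      (∀ v w, φ (op p.α) (v, w) = (r.α v, 0)) ∧ (∀ v w, φ (op p.β) (v, w) = (0, r.β w)) ∧
      (∀ v w, φ (op p.μ) (v, w) = (0, r.h v)) := by
  have ha : a ≠ 0 := NeZero.ne a
  let E : Module.End K (r.V × r.W) := LinearMap.prodMap LinearMap.id 0
  let F : Module.End K (r.V × r.W) := LinearMap.prodMap 0 LinearMap.id
  let A : Module.End K (r.V × r.W) := LinearMap.prodMap r.α 0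
  let B : Module.End K (r.V × r.W) := LinearMap.prodMap 0 r.β
  let M : Module.End K (r.V × r.W) := LinearMap.inr K r.V r.W ∘ₗ r.h ∘ₗ LinearMap.fst K r.V r.W
  have hA : ∀ k v w, (A ^ k) (v, w) = ((r.α ^ k) v, if k = 0 then w else 0) := by
    intro k
    induction k with
    | zero => simp
    | succ k ih => intro v w; rw [pow_succ', pow_succ', Module.End.mul_apply, ih]; simp [A]
  have hB : ∀ k v w, (B ^ k) (v, w) = (if k = 0 then v else 0, (r.β ^ k) w) := by
    intro k
    induction k with
    | zero => simp
    | succ k ih => intro v w; rw [pow_succ', pow_succ', Module.End.mul_apply, ih]; simp [B]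
  have had : ArrowData (op E) (op F) (op A) (op B) (op M) := by
    constructor <;> first | rw [← op_mul] | rw [← op_add, ← op_one]
    all_goals try rw [← op_zero]
    all_goals refine congrArg op ?_
    all_goals
      refine LinearMap.ext fun ⟨v, w⟩ => ?_
      simp [E, F, A, B, M]
  have hrel : Rel t a b (op A) (op B) (op M) := by
    have := r.rel
    cases t with
    | true =>
      obtain ⟨h1, h2, h3⟩ := this
      refine ⟨?_, ?_, ?_⟩
      · rw [← op_zero]; refine congrArg op (LinearMap.ext fun ⟨v, w⟩ => ?_); simp [A, h1]
      · rw [← op_pow, ← op_zero]; refine congrArg op ?_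
        refine LinearMap.ext fun ⟨v, w⟩ => ?_
        rw [hB]; simp [ha, h2]
      · rw [← op_pow, ← op_mul, ← op_zero]; refine congrArg op ?_
        refine LinearMap.ext fun ⟨v, w⟩ => ?_
        rw [Module.End.mul_apply]
        simp only [M, LinearMap.comp_apply, LinearMap.fst_apply, LinearMap.inr_apply]
        rw [hB]; simp [h3]
    | false =>
      obtain ⟨h1, h2, h3⟩ := this
      refine ⟨?_, ?_, ?_⟩
      · rw [← op_zero]; refine congrArg op (LinearMap.ext fun ⟨v, w⟩ => ?_); simp [B, h1]
      · rw [← op_pow, ← op_zero]; refine congrArg op ?_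
        refine LinearMap.ext fun ⟨v, w⟩ => ?_
        rw [hA]; simp [ha, h2]
      · rw [← op_pow, ← op_mul, ← op_zero]; refine congrArg op ?_
        refine LinearMap.ext fun ⟨v, w⟩ => ?_
        rw [Module.End.mul_apply, hA]
        simp [M, h3]
  obtain ⟨φ, h1, h2, h3, h4, h5⟩ := p.lift _ _ _ _ _ _ had hrel
  refine ⟨AlgHom.opComm φ, ?_, ?_, ?_, ?_, ?_⟩ <;> intro v w
  · change (φ p.e).unop (v, w) = _; rw [h1]; simp [E]
  · change (φ p.f).unop (v, w) = _; rw [h2]; simp [F]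
  · change (φ p.α).unop (v, w) = _; rw [h3]; simp [A]
  · change (φ p.β).unop (v, w) = _; rw [h4]; simp [B]
  · change (φ p.μ).unop (v, w) = _; rw [h5]; simp [M]

/-- The action of `Λᵐᵒᵖ` on `V × W` attached to a representation. -/
def Presented.act [NeZero a] (p : Presented K Λ t a b) (r : Rep K t a b) :
    Λᵐᵒᵖ →ₐ[K] Module.End K (r.V × r.W) := Classical.choose (Rep.exists_act p r)

/-- The right `Λ`-module attached to a representation. -/
def Presented.Mod [NeZero a] (_ : Presented K Λ t a b) (r : Rep K t a b) : Type := r.V × r.W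

/-- A `K`-linear map commuting with the generators is `Λᵐᵒᵖ`-linear. -/
theorem Presented.smul_comm_of_gen (p : Presented K Λ t a b) {M N : Type} [AddCommGroup M] [AddCommGroup N] [Module K M] [Module K N]
    [Module Λᵐᵒᵖ M] [Module Λᵐᵒᵖ N] [IsScalarTower K Λᵐᵒᵖ M] [IsScalarTower K Λᵐᵒᵖ N]
    (F : M →ₗ[K] N) (he : ∀ m, F (op p.e • m) = op p.e • F m)
    (hf : ∀ m, F (op p.f • m) = op p.f • F m) (hα : ∀ m, F (op p.α • m) = op p.α • F m)
    (hβ : ∀ m, F (op p.β • m) = op p.β • F m) (hμ : ∀ m, F (op p.μ • m) = op p.μ • F m)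
    (x : Λᵐᵒᵖ) (m : M) : F (x • m) = x • F m := by
  let S : Subalgebra K Λ :=
    { carrier := {x | ∀ m, F (op x • m) = op x • F m}
      mul_mem' := fun {x y} hx hy m => by rw [op_mul, mul_smul, mul_smul, hy, hx]
      add_mem' := fun {x y} hx hy m => by rw [op_add, add_smul, add_smul, map_add, hx, hy]
      algebraMap_mem' := fun c m => by
        rw [show op (algebraMap K Λ c) = algebraMap K Λᵐᵒᵖ c from rfl, algebraMap_smul,
          algebraMap_smul, map_smul] }
  have hS : S = ⊤ := p.gen S he hf hα hβ hμ
  have hx : x.unop ∈ S := by rw [hS]; trivial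
  exact hx m

namespace Presented

variable [NeZero a] (p : Presented K Λ t a b)

instance (r : Rep K t a b) : AddCommGroup (p.Mod r) := inferInstanceAs (AddCommGroup (r.V × r.W))

instance (r : Rep K t a b) : Module K (p.Mod r) := inferInstanceAs (Module K (r.V × r.W))

instance (r : Rep K t a b) : Module Λᵐᵒᵖ (p.Mod r) :=
  letI : Module (Module.End K (r.V × r.W)) (p.Mod r) :=
    inferInstanceAs (Module (Module.End K (r.V × r.W)) (r.V × r.W))
  Module.compHom (p.Mod r) (p.act r).toRingHom

theorem smul_def (r : Rep K t a b) (x : Λᵐᵒᵖ) (m : p.Mod r) : x • m = p.act r x m := rfl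

instance (r : Rep K t a b) : IsScalarTower K Λᵐᵒᵖ (p.Mod r) where
  smul_assoc c x m := by
    rw [smul_def, smul_def, map_smul]
    rfl

/-- The element of the module attached to a representation with given components. -/
def elt {r : Rep K t a b} (v : r.V) (w : r.W) : p.Mod r := (v, w)

theorem e_smul {r : Rep K t a b} (v : r.V) (w : r.W) : op p.e • p.elt v w = p.elt v 0 :=
  (Classical.choose_spec (Rep.exists_act p r)).1 v w

theorem f_smul {r : Rep K t a b} (v : r.V) (w : r.W) : op p.f • p.elt v w = p.elt 0 w :=
  (Classical.choose_spec (Rep.exists_act p r)).2.1 v w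

theorem α_smul {r : Rep K t a b} (v : r.V) (w : r.W) : op p.α • p.elt v w = p.elt (r.α v) 0 :=
  (Classical.choose_spec (Rep.exists_act p r)).2.2.1 v w

theorem β_smul {r : Rep K t a b} (v : r.V) (w : r.W) : op p.β • p.elt v w = p.elt 0 (r.β w) :=
  (Classical.choose_spec (Rep.exists_act p r)).2.2.2.1 v w

theorem μ_smul {r : Rep K t a b} (v : r.V) (w : r.W) : op p.μ • p.elt v w = p.elt 0 (r.h v) :=
  (Classical.choose_spec (Rep.exists_act p r)).2.2.2.2 v w

/-- The linear map underlying `toLin`. -/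
def toLinAux {r s : Rep K t a b} (φ : Rep.Hom r s) : p.Mod r →ₗ[K] p.Mod s where
  toFun m := p.elt (φ.f m.1) (φ.g m.2)
  map_add' m n := (LinearMap.prodMap φ.f φ.g).map_add m n
  map_smul' c m := (LinearMap.prodMap φ.f φ.g).map_smul c m

theorem exists_elt {r : Rep K t a b} (m : p.Mod r) : ∃ v w, m = p.elt v w := ⟨m.1, m.2, rfl⟩

theorem toLinAux_elt {r s : Rep K t a b} (φ : Rep.Hom r s) (v : r.V) (w : r.W) :
    p.toLinAux φ (p.elt v w) = p.elt (φ.f v) (φ.g w) := rfl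

/-- The homomorphism of modules attached to a morphism of representations. -/
def toLin {r s : Rep K t a b} (φ : Rep.Hom r s) : p.Mod r →ₗ[Λᵐᵒᵖ] p.Mod s where
  toFun m := p.elt (φ.f m.1) (φ.g m.2)
  map_add' m n := (LinearMap.prodMap φ.f φ.g).map_add m n
  map_smul' := smul_comm_of_gen p (p.toLinAux φ)
    (fun m => by
      obtain ⟨v, w, rfl⟩ := p.exists_elt m
      rw [toLinAux_elt, e_smul, e_smul, toLinAux_elt]; simp)
    (fun m => by
      obtain ⟨v, w, rfl⟩ := p.exists_elt m
      rw [toLinAux_elt, f_smul, f_smul, toLinAux_elt]; simp)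
    (fun m => by
      obtain ⟨v, w, rfl⟩ := p.exists_elt m
      rw [toLinAux_elt, α_smul, α_smul, toLinAux_elt]; simp [φ.comm_α])
    (fun m => by
      obtain ⟨v, w, rfl⟩ := p.exists_elt m
      rw [toLinAux_elt, β_smul, β_smul, toLinAux_elt]; simp [φ.comm_β])
    (fun m => by
      obtain ⟨v, w, rfl⟩ := p.exists_elt m
      rw [toLinAux_elt, μ_smul, μ_smul, toLinAux_elt]; simp [φ.comm_h])

theorem toLin_elt {r s : Rep K t a b} (φ : Rep.Hom r s) (v : r.V) (w : r.W) :
    p.toLin φ (p.elt v w) = p.elt (φ.f v) (φ.g w) := rfl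

theorem elt_add {r : Rep K t a b} (v v' : r.V) (w w' : r.W) :
    p.elt (v + v') (w + w') = p.elt v w + p.elt v' w' := rfl

theorem elt_smul {r : Rep K t a b} (c : K) (v : r.V) (w : r.W) :
    p.elt (c • v) (c • w) = c • p.elt v w := rfl

theorem elt_inj {r : Rep K t a b} {v v' : r.V} {w w' : r.W} :
    p.elt v w = p.elt v' w' ↔ v = v' ∧ w = w' := Prod.mk_inj

theorem elt_zero {r : Rep K t a b} : p.elt (0 : r.V) (0 : r.W) = 0 := rfl

theorem toLin_surjective {r s : Rep K t a b} : Function.Surjective (p.toLin (r := r) (s := s)) := by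
  intro F
  have hK : ∀ (c : K) (m : p.Mod r), F (c • m) = c • F m := fun c m => by
    rw [← algebraMap_smul Λᵐᵒᵖ c m, map_smul, algebraMap_smul]
  have h1 : ∀ v, F (p.elt v 0) = p.elt (F (p.elt v 0)).1 0 := fun v => by
    conv_lhs => rw [← p.e_smul v 0, map_smul]
    exact p.e_smul (F (p.elt v 0)).1 (F (p.elt v 0)).2
  have h2 : ∀ w, F (p.elt 0 w) = p.elt 0 (F (p.elt 0 w)).2 := fun w => by
    conv_lhs => rw [← p.f_smul 0 w, map_smul]
    exact p.f_smul (F (p.elt 0 w)).1 (F (p.elt 0 w)).2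
  let f : r.V →ₗ[K] s.V :=
    { toFun := fun v => (F (p.elt v 0)).1
      map_add' := fun v v' => by
        rw [show p.elt (v + v') (0 : r.W) = p.elt v 0 + p.elt v' 0 by rw [← elt_add, add_zero], map_add]
        rfl
      map_smul' := fun c v => by
        rw [show p.elt (c • v) (0 : r.W) = c • p.elt v 0 by
          rw [← elt_smul, smul_zero], hK]
        rfl }
  let g : r.W →ₗ[K] s.W :=
    { toFun := fun w => (F (p.elt 0 w)).2
      map_add' := fun v v' => by
        rw [show p.elt (0 : r.V) (v + v') = p.elt 0 v + p.elt 0 v' by rw [← elt_add, add_zero], map_add]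
        rfl
      map_smul' := fun c v => by
        rw [show p.elt (0 : r.V) (c • v) = c • p.elt 0 v by
          rw [← elt_smul, smul_zero], hK]
        rfl }
  have hf : ∀ v, F (p.elt v 0) = p.elt (f v) 0 := h1
  have hg : ∀ w, F (p.elt 0 w) = p.elt 0 (g w) := h2
  refine ⟨⟨f, g, fun v => ?_, fun w => ?_, fun v => ?_⟩, ?_⟩
  · have := F.map_smul (op p.α) (p.elt v 0)
    rw [α_smul, hf, hf, α_smul, elt_inj] at this
    exact this.1
  · have := F.map_smul (op p.β) (p.elt 0 w)
    rw [β_smul, hg, hg, β_smul, elt_inj] at this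
    exact this.2
  · have := F.map_smul (op p.μ) (p.elt v 0)
    rw [μ_smul, hf, hg, μ_smul, elt_inj] at this
    exact this.2
  · ext m
    obtain ⟨v, w, rfl⟩ := p.exists_elt m
    rw [show p.elt v w = p.elt v 0 + p.elt 0 w by rw [← elt_add, add_zero, zero_add], map_add, map_add,
      hf, hg]
    simp [toLin_elt]

end Presented

end Representations

section ModuleLemmas

variable {R : Type} [Ring R]

theorem isIndecModule_iff {M : Type} [AddCommGroup M] [Module R M] :
    IsIndecModule R M ↔
      Nontrivial M ∧ ∀ E : Module.End R M, E * E = E → E = 0 ∨ E = 1 := by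
  refine and_congr_right fun _ => ⟨fun h E hE => ?_, fun h N₁ N₂ hN => ?_⟩
  · rcases h _ _ (LinearMap.IsIdempotentElem.isCompl hE) with h | h
    · exact Or.inl (LinearMap.range_eq_bot.1 h)
    · right
      ext m
      have : E m - m ∈ LinearMap.ker E := by
        rw [LinearMap.mem_ker, map_sub, ← Module.End.mul_apply, hE, sub_self]
      rw [h, Submodule.mem_bot, sub_eq_zero] at this
      exact this
  · rcases h (N₁.subtype ∘ₗ N₁.projectionOnto N₂ hN)
      (by ext m; simp) with h | h
    · left
      rw [eq_bot_iff]
      intro m hm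
      have := LinearMap.congr_fun h m
      simpa [Submodule.projectionOnto_apply_left hN ⟨m, hm⟩] using this
    · right
      rw [eq_bot_iff]
      intro m hm
      have := LinearMap.congr_fun h m
      simpa [(Submodule.projection_apply_eq_zero_iff hN).2 hm] using this.symm

theorem IsIndecModule.congr {M N : Type} [AddCommGroup M] [Module R M] [AddCommGroup N]
    [Module R N] (e : M ≃ₗ[R] N) (h : IsIndecModule R M) : IsIndecModule R N := by
  rw [isIndecModule_iff] at h ⊢
  obtain ⟨_, h2⟩ := h
  refine ⟨e.symm.toEquiv.nontrivial, fun E hE => ?_⟩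
  have hE' : ∀ x, E (E x) = E x := fun x => LinearMap.congr_fun hE x
  rcases h2 (e.symm.toLinearMap ∘ₗ E ∘ₗ e.toLinearMap) (by ext m; simp [hE']) with h | h
  · left
    ext n
    have := LinearMap.congr_fun h (e.symm n)
    simpa using this
  · right
    ext n
    have := LinearMap.congr_fun h (e.symm n)
    simpa using this

/-- Every map from a syzygy of `N` to a quotient of `N` extends to the projective cover. -/
def ExtendsFromSyzygy (R : Type) [Ring R] (N : Type) [AddCommGroup N] [Module R N] : Prop :=
  ∀ (Om E Y : Type) [AddCommGroup Om] [AddCommGroup E] [AddCommGroup Y] [Module R Om] [Module R E]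
    [Module R Y] [Module.Projective R E] (ι : Om →ₗ[R] E) (p : E →ₗ[R] N) (q : N →ₗ[R] Y)
    (l : Om →ₗ[R] Y), Function.Injective ι → Function.Surjective p →
    LinearMap.range ι = LinearMap.ker p → Function.Surjective q → ∃ L : E →ₗ[R] Y, L ∘ₗ ι = l

theorem ExtendsFromSyzygy.of_summand {M : ModuleCat.{0} R} (hM : IsTauRigidCat R M) {N : Type}
    [AddCommGroup N] [Module R N] (i : N →ₗ[R] M) (r : M →ₗ[R] N) (hri : ∀ x, r (i x) = x) :
    ExtendsFromSyzygy R N := by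
  obtain ⟨-, P₁, P₀, f, g, -, hP₁, -, hP₀, hg, hfg, hext⟩ := hM
  intro Om E Y _ _ _ _ _ _ _ ι p q l hι hp hιp hq
  obtain ⟨s, hs⟩ := Module.projective_lifting_property g (i ∘ₗ p) hg
  obtain ⟨k, hk⟩ := Module.projective_lifting_property p (r ∘ₗ g) hp
  replace hs : ∀ e, g (s e) = i (p e) := LinearMap.congr_fun hs
  replace hk : ∀ x, p (k x) = r (g x) := LinearMap.congr_fun hk
  have hpι : ∀ o, p (ι o) = 0 := fun o => by
    rw [← LinearMap.mem_ker, ← hιp]; exact ⟨o, rfl⟩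
  have hgf : ∀ z, g (f z) = 0 := fun z => by
    rw [← LinearMap.mem_ker, ← hfg]; exact ⟨z, rfl⟩
  let I := LinearEquiv.ofInjective ι hι
  have hI : ∀ y, ι (I.symm y) = y := fun y => by
    conv_rhs => rw [← I.apply_symm_apply y]
    rfl
  let κ : P₁ →ₗ[R] Om := I.symm.toLinearMap ∘ₗ LinearMap.codRestrict (LinearMap.range ι) (k ∘ₗ f)
    (fun z => by rw [hιp]; simp [hk, hgf])
  have hκ : ∀ z, ι (κ z) = k (f z) := fun z => hI _
  obtain ⟨h, hh⟩ := Module.projective_lifting_property (q ∘ₗ r) (l ∘ₗ κ)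
    (hq.comp fun x => ⟨i x, hri x⟩)
  replace hh : ∀ z, q (r (h z)) = l (κ z) := LinearMap.congr_fun hh
  obtain ⟨h', rfl⟩ := hext h
  let δ : E →ₗ[R] Om := I.symm.toLinearMap ∘ₗ
    LinearMap.codRestrict (LinearMap.range ι) (LinearMap.id - k ∘ₗ s)
    (fun e => by rw [hιp]; simp [hk, hs, hri])
  have hδ : ∀ e, ι (δ e) = e - k (s e) := fun e => hI _
  refine ⟨q ∘ₗ r ∘ₗ h' ∘ₗ s + l ∘ₗ δ, ?_⟩
  ext o
  have h1 : s (ι o) ∈ LinearMap.range f := by rw [hfg]; simp [hs, hpι]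
  obtain ⟨z, hz⟩ := h1
  have h2 : δ (ι o) = o - κ z := hι (by rw [hδ, map_sub, hκ, hz])
  have h3 := hh z
  simp only [LinearMap.comp_apply] at h3
  simp only [LinearMap.comp_apply, LinearMap.add_apply, h2, ← hz, h3, map_sub]
  abel

theorem ExtendsFromSyzygy.congr {M N : Type} [AddCommGroup M] [Module R M] [AddCommGroup N]
    [Module R N] (e : M ≃ₗ[R] N) (h : ExtendsFromSyzygy R M) : ExtendsFromSyzygy R N := by
  intro Om E Y _ _ _ _ _ _ _ ι p q l hι hp hιp hq
  refine h Om E Y ι (e.symm.toLinearMap ∘ₗ p) (q ∘ₗ e.toLinearMap) l hι (e.symm.surjective.comp hp)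
    ?_ (hq.comp e.surjective)
  rw [hιp]
  ext x
  simp

/-- Finiteness of the set of basic τ-rigid modules from a finite classification of the
indecomposable ones. -/
theorem isTauTiltingFinite_of_labels {Λ : Type} [Ring Λ] {L : Type} [Finite L]
    (P : L → (N : Type) → [AddCommGroup N] → [Module Λᵐᵒᵖ N] → Prop)
    (h1 : ∀ (N : Type) [AddCommGroup N] [Module Λᵐᵒᵖ N], IsIndecModule Λᵐᵒᵖ N →
      ExtendsFromSyzygy Λᵐᵒᵖ N → ∃ l, P l N)
    (h2 : ∀ (l : L) (N N' : Type) [AddCommGroup N] [Module Λᵐᵒᵖ N] [AddCommGroup N']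
      [Module Λᵐᵒᵖ N'], P l N → P l N' → Nonempty (N ≃ₗ[Λᵐᵒᵖ] N')) : IsTauTiltingFinite Λ := by
  classical
  let Q : Set L → RMod Λ → Prop := fun T M =>
    ∃ (k : ℕ) (N : Fin k → Submodule Λᵐᵒᵖ M) (c : Fin k → L), DirectSum.IsInternal N ∧
      Function.Injective c ∧ (∀ i, P (c i) (N i)) ∧ Set.range c = T
  have hQ : ∀ T M M', Q T M → Q T M' → Nonempty (M ≃ₗ[Λᵐᵒᵖ] M') := by
    rintro T M M' ⟨k, N, c, hN, hc, hP, hT⟩ ⟨k', N', c', hN', hc', hP', hT'⟩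
    let e : Fin k ≃ Fin k' :=
      (Equiv.ofInjective c hc).trans ((Equiv.setCongr (hT.trans hT'.symm)).trans
        (Equiv.ofInjective c' hc').symm)
    have he : ∀ i, c' (e i) = c i := fun i => by
      have := Equiv.apply_symm_apply (Equiv.ofInjective c' hc')
        ((Equiv.setCongr (hT.trans hT'.symm)) (Equiv.ofInjective c hc i))
      exact congrArg Subtype.val this
    have hi : ∀ i, Nonempty (N i ≃ₗ[Λᵐᵒᵖ] N' (e i)) := fun i =>
      h2 (c i) _ _ (hP i) (by rw [← he]; exact hP' _)
    let φ := fun i => (hi i).some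
    let A : M ≃ₗ[Λᵐᵒᵖ] (DirectSum (Fin k) fun i => N i) :=
      (LinearEquiv.ofBijective (DirectSum.coeLinearMap N) hN).symm
    let A' : M' ≃ₗ[Λᵐᵒᵖ] (DirectSum (Fin k') fun i => N' i) :=
      (LinearEquiv.ofBijective (DirectSum.coeLinearMap N') hN').symm
    let B : (DirectSum (Fin k) fun i => N i) ≃ₗ[Λᵐᵒᵖ] (Π i, N i) :=
      DirectSum.linearEquivFunOnFintype _ _ _
    let B' : (DirectSum (Fin k') fun i => N' i) ≃ₗ[Λᵐᵒᵖ] (Π i, N' i) :=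
      DirectSum.linearEquivFunOnFintype _ _ _
    exact ⟨A.trans (B.trans ((LinearEquiv.piCongrRight φ).trans
      ((LinearEquiv.piCongrLeft Λᵐᵒᵖ (fun i => N' i) e).trans (B'.symm.trans A'.symm))))⟩
  have hL : ∀ M : RMod Λ, IsBasicSupportTauTilting Λ M → ∃ T, Q T M := by
    rintro M ⟨⟨hτ, -⟩, k, N, hN, hi, hne⟩
    let B := LinearEquiv.ofBijective (DirectSum.coeLinearMap N) hN
    have hl : ∀ i, ∃ l, P l (N i) := fun i => by
      refine h1 _ (hi i) (ExtendsFromSyzygy.of_summand hτ (N i).subtype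
        (DirectSum.component Λᵐᵒᵖ (Fin k) (fun i => N i) i ∘ₗ
          B.symm.toLinearMap) fun x => ?_)
      have hx : B.symm (x : M) = DirectSum.lof Λᵐᵒᵖ (Fin k) (fun i => N i) i x := by
        rw [LinearEquiv.symm_apply_eq]
        exact (DirectSum.coeLinearMap_lof N i x).symm
      simp [hx]
    choose c hc using hl
    refine ⟨Set.range c, k, N, c, hN, fun i j hij => ?_, hc, rfl⟩
    by_contra hn
    exact (hne i j hn).false (h2 (c i) _ _ (hc i) (by rw [hij]; exact hc j)).some
  have : Finite (Set L) := inferInstance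
  obtain ⟨n, ⟨f⟩⟩ := Finite.exists_equiv_fin (Set L)
  have : Nonempty (RMod Λ) := ⟨ModuleCat.of _ PUnit⟩
  refine ⟨n, fun i => Classical.epsilon (Q (f.symm i)), fun M hM => ?_⟩
  obtain ⟨T, hT⟩ := hL M hM
  refine ⟨f T, hQ T _ _ hT ?_⟩
  simp only [f.symm_apply_apply]
  exact Classical.epsilon_spec ⟨M, hT⟩

end ModuleLemmas

section RepModules

open MulOpposite

variable {K : Type} [Field K] {t : Bool} {a b : ℕ}

/-- Composition of morphisms of representations. -/
def Rep.Hom.comp {r s u : Rep K t a b} (ψ : Rep.Hom s u) (φ : Rep.Hom r s) : Rep.Hom r u where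
  f := ψ.f ∘ₗ φ.f
  g := ψ.g ∘ₗ φ.g
  comm_α v := by simp [φ.comm_α, ψ.comm_α]
  comm_β v := by simp [φ.comm_β, ψ.comm_β]
  comm_h v := by simp [φ.comm_h, ψ.comm_h]

theorem Rep.Hom.ext' {r s : Rep K t a b} {φ ψ : Rep.Hom r s} (hf : ∀ v, φ.f v = ψ.f v)
    (hg : ∀ w, φ.g w = ψ.g w) : φ = ψ := by
  cases φ
  cases ψ
  congr
  · exact LinearMap.ext hf
  · exact LinearMap.ext hg

/-- Surjectivity of a morphism of representations. -/
def Rep.Hom.Surj {r s : Rep K t a b} (φ : Rep.Hom r s) : Prop :=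
  Function.Surjective φ.f ∧ Function.Surjective φ.g

/-- Injectivity of a morphism of representations. -/
def Rep.Hom.Inj {r s : Rep K t a b} (φ : Rep.Hom r s) : Prop :=
  Function.Injective φ.f ∧ Function.Injective φ.g

/-- Isomorphism of representations. -/
def Rep.Iso (r s : Rep K t a b) : Prop := ∃ φ : Rep.Hom r s, φ.Inj ∧ φ.Surj

/-- The lifting property of projective representations. -/
def Rep.Lifting (E : Rep K t a b) : Prop :=
  ∀ (A B : Rep K t a b) (q : Rep.Hom A B), q.Surj → ∀ φ : Rep.Hom E B,
    ∃ ψ : Rep.Hom E A, (∀ v, q.f (ψ.f v) = φ.f v) ∧ ∀ w, q.g (ψ.g w) = φ.g w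

/-- A nonzero representation whose idempotent endomorphisms are trivial. -/
def Rep.Indec (r : Rep K t a b) : Prop :=
  (Nontrivial r.V ∨ Nontrivial r.W) ∧ ∀ E : Rep.Hom r r, (∀ v, E.f (E.f v) = E.f v) →
    (∀ w, E.g (E.g w) = E.g w) →
      ((∀ v, E.f v = 0) ∧ ∀ w, E.g w = 0) ∨ ((∀ v, E.f v = v) ∧ ∀ w, E.g w = w)

/-- Every morphism from a syzygy of `N` to a quotient of `N` extends to the projective. -/
def Rep.Rigid (N : Rep K t a b) : Prop :=
  ∀ (Om E Y : Rep K t a b), E.Lifting → ∀ (ι : Rep.Hom Om E) (p : Rep.Hom E N) (q : Rep.Hom N Y)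
    (l : Rep.Hom Om Y), ι.Inj → p.Surj → (∀ v, p.f v = 0 ↔ ∃ o, ι.f o = v) →
    (∀ w, p.g w = 0 ↔ ∃ o, ι.g o = w) → q.Surj →
    ∃ L : Rep.Hom E Y, (∀ o, L.f (ι.f o) = l.f o) ∧ ∀ o, L.g (ι.g o) = l.g o

variable {Λ : Type} [Ring Λ] [Algebra K Λ]

namespace Presented

variable [NeZero a] (p : Presented K Λ t a b)

theorem toLin_comp {r s u : Rep K t a b} (ψ : Rep.Hom s u) (φ : Rep.Hom r s) :
    p.toLin (ψ.comp φ) = p.toLin ψ ∘ₗ p.toLin φ := rfl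

theorem toLin_inj {r s : Rep K t a b} {φ ψ : Rep.Hom r s} :
    p.toLin φ = p.toLin ψ ↔ φ = ψ := by
  refine ⟨fun h => Rep.Hom.ext' (fun v => ?_) (fun w => ?_), fun h => h ▸ rfl⟩
  · have := LinearMap.congr_fun h (p.elt v 0)
    rw [toLin_elt, toLin_elt, elt_inj] at this
    exact this.1
  · have := LinearMap.congr_fun h (p.elt 0 w)
    rw [toLin_elt, toLin_elt, elt_inj] at this
    exact this.2

theorem toLin_surj {r s : Rep K t a b} {φ : Rep.Hom r s} :
    Function.Surjective (p.toLin φ) ↔ φ.Surj := by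
  constructor
  · refine fun h => ⟨fun v => ?_, fun w => ?_⟩
    · obtain ⟨m, hm⟩ := h (p.elt v 0)
      obtain ⟨v', w', rfl⟩ := p.exists_elt m
      rw [toLin_elt, elt_inj] at hm
      exact ⟨_, hm.1⟩
    · obtain ⟨m, hm⟩ := h (p.elt 0 w)
      obtain ⟨v', w', rfl⟩ := p.exists_elt m
      rw [toLin_elt, elt_inj] at hm
      exact ⟨_, hm.2⟩
  · rintro ⟨h1, h2⟩ m
    obtain ⟨v, w, rfl⟩ := p.exists_elt m
    obtain ⟨v, rfl⟩ := h1 v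
    obtain ⟨w, rfl⟩ := h2 w
    exact ⟨p.elt v w, rfl⟩

theorem toLin_injective {r s : Rep K t a b} {φ : Rep.Hom r s} (h : φ.Inj) :
    Function.Injective (p.toLin φ) := by
  intro m n hmn
  obtain ⟨v, w, rfl⟩ := p.exists_elt m
  obtain ⟨v', w', rfl⟩ := p.exists_elt n
  rw [toLin_elt, toLin_elt, elt_inj] at hmn
  rw [h.1 hmn.1, h.2 hmn.2]

theorem mod_equiv {r s : Rep K t a b} (h : r.Iso s) :
    Nonempty (p.Mod r ≃ₗ[Λᵐᵒᵖ] p.Mod s) := by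
  obtain ⟨φ, h1, h2⟩ := h
  exact ⟨LinearEquiv.ofBijective (p.toLin φ) ⟨p.toLin_injective h1, p.toLin_surj.2 h2⟩⟩

theorem isIndecModule_mod {r : Rep K t a b} : IsIndecModule Λᵐᵒᵖ (p.Mod r) ↔ r.Indec := by
  rw [isIndecModule_iff]
  refine and_congr ?_ ⟨fun h E h1 h2 => ?_, fun h F hF => ?_⟩
  · constructor
    · intro h
      by_contra hn
      rw [not_or, not_nontrivial_iff_subsingleton, not_nontrivial_iff_subsingleton] at hn
      obtain ⟨h1, h2⟩ := hn
      have h : Nontrivial (r.V × r.W) := h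
      exact not_subsingleton (r.V × r.W) inferInstance
    · rintro (h | h)
      · exact inferInstanceAs (Nontrivial (r.V × r.W))
      · exact inferInstanceAs (Nontrivial (r.V × r.W))
  · rcases h (p.toLin E) (by
      ext m
      obtain ⟨v, w, rfl⟩ := p.exists_elt m
      rw [Module.End.mul_apply, toLin_elt, toLin_elt, h1, h2]) with h | h
    · left
      refine ⟨fun v => ?_, fun w => ?_⟩
      · exact (p.elt_inj.1 ((p.toLin_elt E v 0).symm.trans (LinearMap.congr_fun h _))).1
      · exact (p.elt_inj.1 ((p.toLin_elt E 0 w).symm.trans (LinearMap.congr_fun h _))).2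
    · right
      refine ⟨fun v => ?_, fun w => ?_⟩
      · exact (p.elt_inj.1 ((p.toLin_elt E v 0).symm.trans (LinearMap.congr_fun h _))).1
      · exact (p.elt_inj.1 ((p.toLin_elt E 0 w).symm.trans (LinearMap.congr_fun h _))).2
  · obtain ⟨E, rfl⟩ := p.toLin_surjective F
    have hE : ∀ v w, p.elt (E.f (E.f v)) (E.g (E.g w)) = p.elt (E.f v) (E.g w) := fun v w =>
      LinearMap.congr_fun hF (p.elt v w)
    rcases h E (fun v => (p.elt_inj.1 (hE v 0)).1) (fun w => (p.elt_inj.1 (hE 0 w)).2) with h | h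
    · left
      ext m
      obtain ⟨v, w, rfl⟩ := p.exists_elt m
      rw [toLin_elt, h.1, h.2]
      rfl
    · right
      ext m
      obtain ⟨v, w, rfl⟩ := p.exists_elt m
      rw [toLin_elt, h.1, h.2]
      rfl

/-- Every module comes from a representation. -/
theorem exists_rep (M : Type) [AddCommGroup M] [Module Λᵐᵒᵖ M] :
    ∃ r : Rep K t a b, Nonempty (M ≃ₗ[Λᵐᵒᵖ] p.Mod r) := by
  let _ : Module K M := Module.compHom M (algebraMap K Λᵐᵒᵖ)
  have hst : IsScalarTower K Λᵐᵒᵖ M := ⟨fun c x m => by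
    rw [Algebra.smul_def, mul_smul]; rfl⟩
  let T : Λ → Module.End K M := fun x => Algebra.lsmul K K M (op x)
  have hT : ∀ x m, T x m = op x • m := fun _ _ => rfl
  have hTT : ∀ x y m, T x (T y m) = T (y * x) m := fun x y m => by
    rw [hT, hT, hT, op_mul, mul_smul]
  have hT0 : ∀ m, T 0 m = 0 := fun m => by rw [hT, op_zero, zero_smul]
  have hTp : ∀ x k m, ((T x) ^ k) m = T (x ^ k) m := fun x k m => by
    simp only [T]
    rw [← map_pow, op_pow]
  let V : Submodule K M := LinearMap.eqLocus (T p.e) LinearMap.id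
  let W : Submodule K M := LinearMap.eqLocus (T p.f) LinearMap.id
  have hV : ∀ m, T p.e m ∈ V := fun m => by
    change T p.e (T p.e m) = T p.e m
    rw [hTT, p.ad.ee]
  have hW : ∀ m, T p.f m ∈ W := fun m => by
    change T p.f (T p.f m) = T p.f m
    rw [hTT, p.ad.ff]
  have hVa : ∀ m ∈ V, T p.α m ∈ V := fun m _ => by
    change T p.e (T p.α m) = T p.α m
    rw [hTT, p.ad.ae]
  have hWb : ∀ m ∈ W, T p.β m ∈ W := fun m _ => by
    change T p.f (T p.β m) = T p.β m
    rw [hTT, p.ad.bf]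
  have hμ : ∀ m ∈ V, T p.μ m ∈ W := fun m _ => by
    change T p.f (T p.μ m) = T p.μ m
    rw [hTT, p.ad.mf]
  have hpα : ∀ k (v : V), ((((T p.α).restrict hVa) ^ k) v : M) = T (p.α ^ k) v := fun k v => by
    rw [← hTp, Module.End.pow_restrict k]
    rfl
  have hpβ : ∀ k (v : W), ((((T p.β).restrict hWb) ^ k) v : M) = T (p.β ^ k) v := fun k v => by
    rw [← hTp, Module.End.pow_restrict k]
    rfl
  let r : Rep K t a b :=
    { V := V
      W := W
      α := (T p.α).restrict hVa
      β := (T p.β).restrict hWb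
      h := (T p.μ).restrict hμ
      rel := by
        have := p.rel
        cases t with
        | true =>
          obtain ⟨h1, h2, h3⟩ := this
          refine ⟨?_, ?_, fun v => ?_⟩
          · ext v
            change T p.α v = _
            rw [h1, hT0]; rfl
          · ext v
            rw [hpβ, h2, hT0]; rfl
          · ext
            rw [hpβ]
            change T _ (T _ _) = _
            rw [hTT, h3, hT0]; rfl
        | false =>
          obtain ⟨h1, h2, h3⟩ := this
          refine ⟨?_, ?_, fun v => ?_⟩
          · ext v
            change T p.β v = _
            rw [h1, hT0]; rfl
          · ext v
            rw [hpα, h2, hT0]; rfl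
          · ext
            change T _ ((((T p.α).restrict hVa) ^ b) v : M) = _
            rw [hpα, hTT, h3, hT0]; rfl }
  refine ⟨r, ⟨?_⟩⟩
  let F : M →ₗ[K] p.Mod r :=
    { toFun := fun m => p.elt (r := r) (⟨T p.e m, hV m⟩ : V) (⟨T p.f m, hW m⟩ : W)
      map_add' := fun m n => p.elt_inj.2 ⟨Subtype.ext (map_add _ _ _), Subtype.ext (map_add _ _ _)⟩
      map_smul' := fun m n => p.elt_inj.2
        ⟨Subtype.ext (map_smul _ _ _), Subtype.ext (map_smul _ _ _)⟩ }
  have hF : ∀ m, F m = p.elt (r := r) (⟨T p.e m, hV m⟩ : V) (⟨T p.f m, hW m⟩ : W) := fun _ => rfl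
  have hsum : ∀ m, T p.e m + T p.f m = m := fun m => by
    rw [hT, hT, ← add_smul, ← op_add, p.ad.one, op_one, one_smul]
  let F' : M →ₗ[Λᵐᵒᵖ] p.Mod r :=
    { toFun := F
      map_add' := F.map_add
      map_smul' := by
        have had := p.ad
        refine p.smul_comm_of_gen F (fun m => ?_) (fun m => ?_) (fun m => ?_) (fun m => ?_)
          (fun m => ?_) <;> rw [hF, hF]
        · rw [e_smul, elt_inj]
          refine ⟨Subtype.ext ?_, Subtype.ext ?_⟩
          · change T _ (T _ _) = _; rw [hTT, had.ee]
          · change T _ (T _ _) = _; rw [hTT, had.ef, hT0]; rfl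
        · rw [f_smul, elt_inj]
          refine ⟨Subtype.ext ?_, Subtype.ext ?_⟩
          · change T _ (T _ _) = _; rw [hTT, had.fe, hT0]; rfl
          · change T _ (T _ _) = _; rw [hTT, had.ff]
        · rw [α_smul, elt_inj]
          refine ⟨Subtype.ext ?_, Subtype.ext ?_⟩
          · change T _ (T _ _) = T _ (T _ _); rw [hTT, hTT, had.ae, had.ea]
          · change T _ (T _ _) = _
            rw [hTT, show p.α * p.f = 0 by rw [← had.ae, mul_assoc, had.ef, mul_zero], hT0]; rfl
        · rw [β_smul, elt_inj]
          refine ⟨Subtype.ext ?_, Subtype.ext ?_⟩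
          · change T _ (T _ _) = _
            rw [hTT, show p.β * p.e = 0 by rw [← had.bf, mul_assoc, had.fe, mul_zero], hT0]; rfl
          · change T _ (T _ _) = T _ (T _ _); rw [hTT, hTT, had.bf, had.fb]
        · rw [μ_smul, elt_inj]
          refine ⟨Subtype.ext ?_, Subtype.ext ?_⟩
          · change T _ (T _ _) = _
            rw [hTT, show p.μ * p.e = 0 by rw [← had.mf, mul_assoc, had.fe, mul_zero], hT0]; rfl
          · change T _ (T _ _) = T _ (T _ _); rw [hTT, hTT, had.mf, had.em] }
  refine LinearEquiv.ofBijective F' ⟨fun m n hmn => ?_, fun x => ?_⟩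
  · obtain ⟨h1, h2⟩ := p.elt_inj.1 ((hF m).symm.trans ((show F m = F n from hmn).trans (hF n)))
    rw [← hsum m, ← hsum n, show T p.e m = T p.e n from congrArg Subtype.val h1,
      show T p.f m = T p.f n from congrArg Subtype.val h2]
  · obtain ⟨v, w, rfl⟩ := p.exists_elt x
    have hv : T p.e v.1 = v.1 := v.2
    have hw : T p.f w.1 = w.1 := w.2
    refine ⟨v.1 + w.1, (hF _).trans <| p.elt_inj.2 ⟨Subtype.ext ?_, Subtype.ext ?_⟩⟩
    · change T p.e (v.1 + w.1) = v.1
      rw [map_add, hv, ← hw, hTT, p.ad.fe, hT0, add_zero]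
    · change T p.f (v.1 + w.1) = w.1
      rw [map_add, hw, ← hv, hTT, p.ad.ef, hT0, zero_add]

theorem projective_mod {E : Rep K t a b} (h : E.Lifting) : Module.Projective Λᵐᵒᵖ (p.Mod E) := by
  refine Module.Projective.of_lifting_property'' fun g hg => ?_
  obtain ⟨r, ⟨e⟩⟩ := p.exists_rep (p.Mod E →₀ Λᵐᵒᵖ)
  obtain ⟨q, hq⟩ := p.toLin_surjective (g ∘ₗ e.symm.toLinearMap)
  have hqs : q.Surj := p.toLin_surj.1 (by rw [hq]; exact hg.comp e.symm.surjective)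
  obtain ⟨ψ, h1, h2⟩ := h r E q hqs ⟨LinearMap.id, LinearMap.id, fun _ => rfl, fun _ => rfl,
    fun _ => rfl⟩
  refine ⟨e.symm.toLinearMap ∘ₗ p.toLin ψ, ?_⟩
  ext m
  obtain ⟨v, w, rfl⟩ := p.exists_elt m
  have := LinearMap.congr_fun hq (p.toLin ψ (p.elt v w))
  rw [LinearMap.comp_apply, toLin_elt, toLin_elt, h1, h2] at this
  exact this.symm

theorem rigid_of_extends {N : Rep K t a b} (h : ExtendsFromSyzygy Λᵐᵒᵖ (p.Mod N)) : N.Rigid := by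
  intro Om E Y hE ι π q l hι hπ h1 h2 hq
  have := p.projective_mod hE
  obtain ⟨L, hL⟩ := h (p.Mod Om) (p.Mod E) (p.Mod Y) (p.toLin ι) (p.toLin π) (p.toLin q)
    (p.toLin l) (p.toLin_injective hι) (p.toLin_surj.2 hπ) (by
      ext m
      obtain ⟨v, w, rfl⟩ := p.exists_elt m
      rw [LinearMap.mem_ker, toLin_elt, ← elt_zero, elt_inj, h1, h2]
      constructor
      · rintro ⟨o, ho⟩
        obtain ⟨v', w', rfl⟩ := p.exists_elt o
        rw [toLin_elt, elt_inj] at ho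
        exact ⟨⟨_, ho.1⟩, ⟨_, ho.2⟩⟩
      · rintro ⟨⟨v', rfl⟩, ⟨w', rfl⟩⟩
        exact ⟨p.elt v' w', rfl⟩) (p.toLin_surj.2 hq)
  obtain ⟨L, rfl⟩ := p.toLin_surjective L
  rw [← toLin_comp, toLin_inj] at hL
  subst hL
  exact ⟨L, fun _ => rfl, fun _ => rfl⟩

end Presented

end RepModules

section FreeReps

open MulOpposite

variable {K : Type} [Field K] {t : Bool} {a b : ℕ}

theorem exists_factor {U V Y : Type} [AddCommGroup U] [Module K U] [AddCommGroup V] [Module K V]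
    [AddCommGroup Y] [Module K Y] (π : U →ₗ[K] V) (hπ : Function.Surjective π) (g : U →ₗ[K] Y)
    (h : ∀ u, π u = 0 → g u = 0) : ∃ g' : V →ₗ[K] Y, ∀ u, g' (π u) = g u := by
  obtain ⟨σ, hσ⟩ := π.exists_rightInverse_of_surjective (LinearMap.range_eq_top.2 hπ)
  replace hσ : ∀ v, π (σ v) = v := LinearMap.congr_fun hσ
  refine ⟨g ∘ₗ σ, fun u => ?_⟩
  have := h (σ (π u) - u) (by rw [map_sub, hσ, sub_self])
  rw [map_sub, sub_eq_zero] at this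
  exact this

/-- The universal property of the projective representation with top given by `S` and `C`. -/
def Rep.IsFree (r : Rep K t a b) {S C : Type} [AddCommGroup S] [Module K S] [AddCommGroup C]
    [Module K C] (T : S →ₗ[K] r.V) (T' : C →ₗ[K] r.W) : Prop :=
  (∀ (A : Rep K t a b) (f : S →ₗ[K] A.V) (c : C →ₗ[K] A.W), ∃ ψ : Rep.Hom r A,
    (∀ s, ψ.f (T s) = f s) ∧ ∀ s, ψ.g (T' s) = c s) ∧
  ∀ (A : Rep K t a b) (ψ ψ' : Rep.Hom r A), (∀ s, ψ.f (T s) = ψ'.f (T s)) →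
    (∀ s, ψ.g (T' s) = ψ'.g (T' s)) → ψ = ψ'

theorem Rep.IsFree.lifting {r : Rep K t a b} {S C : Type} [AddCommGroup S] [Module K S]
    [AddCommGroup C] [Module K C] {T : S →ₗ[K] r.V} {T' : C →ₗ[K] r.W} (h : r.IsFree T T') :
    r.Lifting := by
  intro A B q hq φ
  obtain ⟨f, hf⟩ := Module.projective_lifting_property q.f (φ.f ∘ₗ T) hq.1
  obtain ⟨c, hc⟩ := Module.projective_lifting_property q.g (φ.g ∘ₗ T') hq.2
  obtain ⟨ψ, h1, h2⟩ := h.1 A f c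
  have : q.comp ψ = φ := h.2 _ _ _
    (fun s => by
      change q.f (ψ.f _) = _
      rw [h1]
      exact LinearMap.congr_fun hf s)
    (fun s => by
      change q.g (ψ.g _) = _
      rw [h2]
      exact LinearMap.congr_fun hc s)
  subst this
  exact ⟨ψ, fun _ => rfl, fun _ => rfl⟩

theorem Rep.isFree_true [NeZero b] {r : Rep K true a b} (h : IsFreeOn b r.β r.h) :
    r.IsFree LinearMap.id (0 : PUnit →ₗ[K] r.W) := by
  refine ⟨fun A f c => ?_, fun A ψ ψ' h1 h2 => ?_⟩
  · obtain ⟨F, hF, hF'⟩ := h.exists_ext A.β (A.h ∘ₗ f) (fun s => A.rel.2.2 _)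
    refine ⟨⟨f, F, fun v => ?_, hF, hF'⟩, fun _ => rfl, fun s => ?_⟩
    · rw [r.rel.1, A.rel.1]
      simp
    · rw [Subsingleton.elim s 0, map_zero, map_zero, map_zero]
  · refine Rep.Hom.ext' h1 (LinearMap.congr_fun (h.hom_ext ψ.comm_β ψ'.comm_β fun s => ?_))
    rw [ψ.comm_h, ψ'.comm_h]
    exact congrArg A.h (h1 s)

theorem Rep.isFree_true_of_subsingleton [NeZero a] {r : Rep K true a b} [Subsingleton r.V]
    {C : Type} [AddCommGroup C] [Module K C] {T : C →ₗ[K] r.W} (h : IsFreeOn a r.β T) :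
    r.IsFree (0 : PUnit →ₗ[K] r.V) T := by
  refine ⟨fun A f c => ?_, fun A ψ ψ' h1 h2 => ?_⟩
  · obtain ⟨F, hF, hF'⟩ := h.exists_ext A.β c (fun s => by rw [A.rel.2.1]; rfl)
    refine ⟨⟨0, F, fun v => ?_, hF, fun v => ?_⟩, fun s => ?_, hF'⟩
    · simp
    · rw [Subsingleton.elim v 0]; simp
    · rw [Subsingleton.elim s 0, map_zero f]
      exact LinearMap.zero_apply _
  · refine Rep.Hom.ext' (fun v => ?_)
      (LinearMap.congr_fun (h.hom_ext ψ.comm_β ψ'.comm_β h2))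
    rw [Subsingleton.elim v 0, map_zero, map_zero]

theorem Rep.isFree_false [NeZero a] {r : Rep K false a b} {S : Type} [AddCommGroup S]
    [Module K S] {T : S →ₗ[K] r.V} (h : IsFreeOn a r.α T) (hs : Function.Surjective r.h)
    (hk : ∀ v, r.h v = 0 → ∃ u, v = (r.α ^ b) u) :
    r.IsFree T (0 : PUnit →ₗ[K] r.W) := by
  refine ⟨fun A f c => ?_, fun A ψ ψ' h1 h2 => ?_⟩
  · obtain ⟨F, hF, hF'⟩ := h.exists_ext A.α f (fun s => by rw [A.rel.2.1]; rfl)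
    obtain ⟨G, hG⟩ := exists_factor r.h hs (A.h ∘ₗ F) (fun v hv => by
      obtain ⟨u, rfl⟩ := hk v hv
      rw [LinearMap.comp_apply, comm_pow hF, A.rel.2.2])
    refine ⟨⟨F, G, hF, fun v => ?_, hG⟩, hF', fun s => ?_⟩
    · rw [r.rel.1, A.rel.1]
      simp
    · rw [Subsingleton.elim s 0, map_zero, map_zero, map_zero]
  · have := LinearMap.congr_fun (h.hom_ext ψ.comm_α ψ'.comm_α h1)
    refine Rep.Hom.ext' this fun w => ?_
    obtain ⟨v, rfl⟩ := hs w
    rw [ψ.comm_h, ψ'.comm_h, this]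

theorem Rep.isFree_false_of_subsingleton {r : Rep K false a b} [Subsingleton r.V] :
    r.IsFree (0 : PUnit →ₗ[K] r.V) LinearMap.id := by
  refine ⟨fun A f c => ?_, fun A ψ ψ' h1 h2 => ?_⟩
  · refine ⟨⟨0, c, fun v => ?_, fun w => ?_, fun v => ?_⟩, fun s => ?_, fun _ => rfl⟩
    · simp
    · rw [r.rel.1, A.rel.1]
      simp
    · rw [Subsingleton.elim v 0]; simp
    · rw [Subsingleton.elim s 0, map_zero f]
      exact LinearMap.zero_apply _
  · refine Rep.Hom.ext' (fun v => ?_) h2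
    rw [Subsingleton.elim v 0, map_zero, map_zero]

/-- The projective representation with given top, loop at the target of the arrow. -/
def freeTrue [NeZero b] (hba : b ≤ a) (S C : Type) [AddCommGroup S] [Module K S]
    [AddCommGroup C] [Module K C] : Rep K true a b where
  V := S
  W := (Fin b → S) × (Fin a → C)
  α := 0
  β := LinearMap.prodMap (shift K b S) (shift K a C)
  h := LinearMap.inl K _ _ ∘ₗ single0 K b S
  rel := by
    have hpow : ∀ k u v, ((LinearMap.prodMap (shift K b S) (shift K a C)) ^ k) (u, v) =
        ((shift K b S ^ k) u, (shift K a C ^ k) v) := by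
      intro k
      induction k with
      | zero => simp
      | succ k ih =>
        intro u v
        rw [pow_succ', pow_succ', pow_succ', Module.End.mul_apply, ih]
        rfl
    refine ⟨rfl, ?_, fun v => ?_⟩
    · refine LinearMap.ext fun ⟨u, v⟩ => ?_
      rw [hpow, shift_pow_self, pow_zero_of_le (shift_pow_self b) hba]
      rfl
    · rw [LinearMap.comp_apply, LinearMap.inl_apply, hpow, shift_pow_self, map_zero]
      rfl

theorem freeTrue_β_inl [NeZero b] (hba : b ≤ a) {S C : Type} [AddCommGroup S] [Module K S]
    [AddCommGroup C] [Module K C] (u : Fin b → S) :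
    (freeTrue (K := K) hba S C).β ((u, 0) : (Fin b → S) × (Fin a → C)) =
      ((shift K b S u, 0) : (Fin b → S) × (Fin a → C)) :=
  Prod.ext rfl (map_zero (shift K a C))

theorem freeTrue_β_inr [NeZero b] (hba : b ≤ a) {S C : Type} [AddCommGroup S] [Module K S]
    [AddCommGroup C] [Module K C] (u : Fin a → C) :
    (freeTrue (K := K) hba S C).β ((0, u) : (Fin b → S) × (Fin a → C)) =
      ((0, shift K a C u) : (Fin b → S) × (Fin a → C)) :=
  Prod.ext (map_zero (shift K b S)) rfl

theorem isFree_freeTrue [NeZero a] [NeZero b] (hba : b ≤ a) (S C : Type) [AddCommGroup S]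
    [Module K S] [AddCommGroup C] [Module K C] :
    (freeTrue (K := K) hba S C).IsFree LinearMap.id
      (LinearMap.inr K (Fin b → S) (Fin a → C) ∘ₗ single0 K a C) := by
  refine ⟨fun A f c => ?_, fun A ψ ψ' h1 h2 => ?_⟩
  · obtain ⟨F, hF, hF'⟩ := (isFreeOn_shift (K := K) (S := S) b).exists_ext A.β (A.h ∘ₗ f)
      (fun s => A.rel.2.2 _)
    obtain ⟨G, hG, hG'⟩ := (isFreeOn_shift (K := K) (S := C) a).exists_ext A.β c
      (fun s => by rw [A.rel.2.1]; rfl)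
    refine ⟨⟨f, LinearMap.coprod F G, fun v => ?_, fun w => ?_, fun v => ?_⟩, fun _ => rfl,
      fun s => ?_⟩
    · rw [(freeTrue hba S C).rel.1, A.rel.1]
      simp
    · change F (shift K b S w.1) + G (shift K a C w.2) = A.β (F w.1 + G w.2)
      rw [hF, hG, map_add]
    · exact (congrArg₂ (· + ·) (hF' v) (map_zero G)).trans (add_zero _)
    · change F 0 + G (single0 K a C s) = _
      rw [hG', map_zero, zero_add]
  · have e1 := LinearMap.congr_fun ((isFreeOn_shift (K := K) (S := S) b).hom_ext (y := A.β)
      (F := ψ.g ∘ₗ LinearMap.inl K _ _) (G := ψ'.g ∘ₗ LinearMap.inl K _ _)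
      (fun u => (congrArg ψ.g (freeTrue_β_inl hba u).symm).trans (ψ.comm_β _))
      (fun u => (congrArg ψ'.g (freeTrue_β_inl hba u).symm).trans (ψ'.comm_β _))
      (fun s => (ψ.comm_h s).trans ((congrArg A.h (h1 s)).trans (ψ'.comm_h s).symm)))
    have e2 := LinearMap.congr_fun ((isFreeOn_shift (K := K) (S := C) a).hom_ext (y := A.β)
      (F := ψ.g ∘ₗ LinearMap.inr K _ _) (G := ψ'.g ∘ₗ LinearMap.inr K _ _)
      (fun u => (congrArg ψ.g (freeTrue_β_inr hba u).symm).trans (ψ.comm_β _))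
      (fun u => (congrArg ψ'.g (freeTrue_β_inr hba u).symm).trans (ψ'.comm_β _))
      h2)
    refine Rep.Hom.ext' h1 fun w => ?_
    obtain ⟨u, v⟩ := w
    have hs : ((u, v) : (Fin b → S) × (Fin a → C)) = (u, 0) + (0, v) := by simp
    exact (congrArg ψ.g hs).trans ((map_add ψ.g _ _).trans
      ((congrArg₂ (· + ·) (e1 u) (e2 v)).trans
        ((map_add ψ'.g _ _).symm.trans (congrArg ψ'.g hs).symm)))

/-- Truncation `S[X]/(Xᵃ) → S[X]/(Xᵇ)`. -/
def trunc (K : Type) [Field K] {a b : ℕ} (hba : b ≤ a) (S : Type) [AddCommGroup S] [Module K S] :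
    (Fin a → S) →ₗ[K] (Fin b → S) := LinearMap.funLeft K S (Fin.castLE hba)

theorem trunc_surjective (hba : b ≤ a) (S : Type) [AddCommGroup S] [Module K S] :
    Function.Surjective (trunc K hba S) :=
  LinearMap.funLeft_surjective_of_injective K S _ (Fin.castLE_injective hba)

theorem trunc_pow (hba : b ≤ a) (S : Type) [AddCommGroup S] [Module K S] (u : Fin a → S) :
    trunc K hba S ((shift K a S ^ b) u) = 0 := by
  funext k
  change (shift K a S ^ b) u (Fin.castLE hba k) = 0
  rw [shift_pow_apply, dif_neg]
  simp

theorem ker_trunc (hba : b ≤ a) (S : Type) [AddCommGroup S] [Module K S] (u : Fin a → S)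
    (hu : trunc K hba S u = 0) : ∃ v, u = (shift K a S ^ b) v := by
  refine ⟨fun k => if h : (k : ℕ) + b < a then u ⟨k + b, h⟩ else 0, ?_⟩
  funext k
  rw [shift_pow_apply]
  by_cases h : b ≤ (k : ℕ)
  · rw [dif_pos h, dif_pos (by simp only []; omega)]
    congr 1
    ext
    simp only []
    omega
  · rw [dif_neg h]
    exact congrFun hu ⟨k, by omega⟩

/-- The projective representation generated at the source of the arrow, with a loop there. -/
def freeFalse (hba : b ≤ a) (S : Type) [AddCommGroup S] [Module K S] : Rep K false a b where
  V := Fin a → S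
  W := Fin b → S
  α := shift K a S
  β := 0
  h := trunc K hba S
  rel := ⟨rfl, shift_pow_self a, trunc_pow hba S⟩

theorem isFree_freeFalse [NeZero a] (hba : b ≤ a) (S : Type) [AddCommGroup S] [Module K S] :
    (freeFalse (K := K) hba S).IsFree (single0 K a S)
      (0 : PUnit →ₗ[K] (freeFalse (K := K) hba S).W) :=
  Rep.isFree_false (r := freeFalse hba S) (isFreeOn_shift a) (trunc_surjective hba S)
    (ker_trunc hba S)

end FreeReps

section Decompositions

variable {R : Type} [Ring R]

theorem IsIndecModule.summands {M A B : Type} [AddCommGroup M] [Module R M] [AddCommGroup A]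
    [Module R A] [AddCommGroup B] [Module R B] (e : M ≃ₗ[R] A × B) (hA : IsIndecModule R A)
    (hB : IsIndecModule R B) : ∃ N : Fin 2 → Submodule R M, DirectSum.IsInternal N ∧
      (∀ i, IsIndecModule R (N i)) ∧ Nonempty (A ≃ₗ[R] N 0) ∧ Nonempty (B ≃ₗ[R] N 1) := by
  let iA : A →ₗ[R] M := e.symm.toLinearMap ∘ₗ LinearMap.inl R A B
  let iB : B →ₗ[R] M := e.symm.toLinearMap ∘ₗ LinearMap.inr R A B
  have hiA : Function.Injective iA := e.symm.injective.comp LinearMap.inl_injective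
  have hiB : Function.Injective iB := e.symm.injective.comp LinearMap.inr_injective
  have hc : IsCompl (LinearMap.range iA) (LinearMap.range iB) := by
    rw [LinearMap.range_comp, LinearMap.range_comp]
    exact (Submodule.orderIsoMapComap e.symm).isCompl LinearMap.isCompl_range_inl_inr
  let eA := LinearEquiv.ofInjective iA hiA
  let eB := LinearEquiv.ofInjective iB hiB
  refine ⟨![LinearMap.range iA, LinearMap.range iB], ?_, ?_, ⟨eA⟩, ⟨eB⟩⟩
  · rw [DirectSum.isInternal_submodule_iff_isCompl _ (i := 0) (j := 1) (by decide)
      (by ext i; fin_cases i <;> simp)]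
    exact hc
  · intro i
    fin_cases i
    · exact hA.congr eA
    · exact hB.congr eB

theorem isBasicModuleCat_of_prod {M : ModuleCat.{0} R} {A B : Type} [AddCommGroup A]
    [Module R A] [AddCommGroup B] [Module R B] (e : M ≃ₗ[R] A × B) (hA : IsIndecModule R A)
    (hB : IsIndecModule R B) (h : IsEmpty (A ≃ₗ[R] B)) :
    IsBasicModuleCat R M ∧ HasIndecClassCount R M 2 := by
  obtain ⟨N, h1, h2, ⟨eA⟩, ⟨eB⟩⟩ := hA.summands e hB
  have key : ∀ i j, i ≠ j → IsEmpty (N i ≃ₗ[R] N j) := by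
    intro i j hij
    refine ⟨fun g => ?_⟩
    obtain ⟨rfl, rfl⟩ | ⟨rfl, rfl⟩ : (i = 0 ∧ j = 1) ∨ (i = 1 ∧ j = 0) := by omega
    · exact h.false ((eA.trans g).trans eB.symm)
    · exact h.false ((eA.trans g.symm).trans eB.symm)
  refine ⟨⟨2, N, h1, h2, key⟩, 2, N, h1, h2, id, Function.surjective_id, fun i j => ⟨?_, ?_⟩⟩
  · rintro rfl
    exact ⟨LinearEquiv.refl R _⟩
  · rintro ⟨g⟩
    by_contra hij
    exact (key i j hij).false g

theorem hasIndecClassCount_punit : HasIndecClassCount R (ModuleCat.of R PUnit) 0 :=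
  ⟨0, Fin.elim0, (DirectSum.isInternal_submodule_iff_iSupIndep_and_iSup_eq_top _).2
    ⟨fun i => i.elim0, Subsingleton.elim _ _⟩, fun i => i.elim0, id, Function.surjective_id,
    fun i => i.elim0⟩

end Decompositions

section Regular

open MulOpposite

variable {K : Type} [Field K] {t : Bool} {a b : ℕ}

theorem eq_zero_of_comm_nilpotent {U : Type} [AddCommGroup U] [Module K U]
    {x E : Module.End K U} {n : ℕ} (hx : x ^ n = 0) (hE : ∀ u, E (x u) = x (E u))
    (hE2 : ∀ u, E (E u) = E u) (h : ∀ u, ∃ u', E u = x u') (u : U) : E u = 0 := by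
  have : ∀ k u, ∃ u', E u = (x ^ k) u' := by
    intro k
    induction k with
    | zero => exact fun u => ⟨E u, rfl⟩
    | succ k ih =>
      intro u
      obtain ⟨v, hv⟩ := ih u
      obtain ⟨w, hw⟩ := h v
      refine ⟨w, ?_⟩
      rw [← hE2, hv, comm_pow hE, hw, pow_succ, Module.End.mul_apply]
  obtain ⟨u', hu⟩ := this n u
  rw [hu, hx, LinearMap.zero_apply]

/-- Idempotents of a local algebra of endomorphisms of a cyclic module are trivial. -/
theorem idempotent_of_cyclic {U : Type} [AddCommGroup U] [Module K U] {x E : Module.End K U}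
    {n : ℕ} (hx : x ^ n = 0) (hE : ∀ u, E (x u) = x (E u)) (hE2 : ∀ u, E (E u) = E u) (s : U)
    (hs : ∀ u, ∃ (c : K) (u' : U), u = c • s + x u') :
    (∀ u, E u = 0) ∨ ∀ u, E u = u := by
  obtain ⟨c, u₀, hc⟩ := hs (E s)
  by_cases h0 : c = 0
  · refine Or.inl (eq_zero_of_comm_nilpotent hx hE hE2 fun u => ?_)
    obtain ⟨d, u', rfl⟩ := hs u
    refine ⟨d • u₀ + E u', ?_⟩
    rw [map_add, map_smul, hc, h0, zero_smul, zero_add, hE, map_add, map_smul]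
  · right
    have := eq_zero_of_comm_nilpotent (x := x) (E := 1 - E) hx (fun u => by simp [hE])
      (fun u => by simp [hE2]) (fun u => by
        obtain ⟨d, u', rfl⟩ := hs u
        refine ⟨-(d • c⁻¹ • (1 - E) u₀) + (1 - E) u', ?_⟩
        have h1 : s = c⁻¹ • E s - c⁻¹ • x u₀ := by
          rw [hc, smul_add, inv_smul_smul₀ h0, add_sub_cancel_right]
        have h2 : (1 - E) s = -(c⁻¹ • x ((1 - E) u₀)) := by
          conv_lhs => rw [h1]
          simp [hE2, hE, smul_sub]
        rw [map_add, map_smul, h2]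
        simp [hE, smul_sub])
    intro u
    have := this u
    simp only [LinearMap.sub_apply, Module.End.one_apply, sub_eq_zero] at this
    exact this.symm

theorem shift_cyclic [NeZero a] (u : Fin a → K) :
    ∃ (c : K) (u' : Fin a → K), u = c • single0 K a K 1 + shift K a K u' := by
  obtain ⟨n, rfl⟩ : ∃ n, a = n + 1 := Nat.exists_eq_succ_of_ne_zero (NeZero.ne a)
  refine ⟨u 0, fun k => if h : (k : ℕ) + 1 < n + 1 then u ⟨k + 1, h⟩ else 0, ?_⟩
  have := shift_pow_apply (K := K) (S := K) (n + 1) 1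
  simp only [pow_one] at this
  funext k
  rw [Pi.add_apply, this]
  rcases Nat.eq_zero_or_pos (k : ℕ) with hk | hk
  · rw [dif_neg (by omega), show k = 0 from Fin.ext hk]
    simp [single0]
  · rw [dif_pos (show 1 ≤ (k : ℕ) from hk), dif_pos (by simp only []; omega)]
    have : k ≠ 0 := fun h => by simp [h] at hk
    simp only [single0, Pi.smul_apply, LinearMap.single_apply, Pi.single_eq_of_ne this, smul_zero,
      zero_add]
    congr 1
    ext
    simp only []
    omega

/-- The indecomposable projective representations. -/
theorem exists_generators [NeZero a] [NeZero b] (hba : b ≤ a) :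
    ∃ (P Q : Rep K t a b) (T : K →ₗ[K] P.V) (T' : K →ₗ[K] Q.W),
      P.IsFree T (0 : PUnit →ₗ[K] P.W) ∧ Q.IsFree (0 : PUnit →ₗ[K] Q.V) T' ∧ P.Indec ∧ Q.Indec ∧
        Nontrivial P.V ∧ Subsingleton Q.V := by
  cases t with
  | true =>
    let P : Rep K true a b := ⟨K, Fin b → K, 0, shift K b K, single0 K b K, rfl,
      pow_zero_of_le (shift_pow_self b) hba, fun v => by rw [shift_pow_self]; rfl⟩
    let Q : Rep K true a b := ⟨PUnit, Fin a → K, 0, shift K a K, 0, rfl, shift_pow_self a,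
      fun v => by simp⟩
    have hP : P.IsFree LinearMap.id (0 : PUnit →ₗ[K] P.W) :=
      Rep.isFree_true (r := P) (isFreeOn_shift b)
    have _ : Subsingleton Q.V := inferInstanceAs (Subsingleton PUnit)
    refine ⟨P, Q, LinearMap.id, single0 K a K, hP,
      Rep.isFree_true_of_subsingleton (r := Q) (isFreeOn_shift a), ⟨Or.inl ?_, ?_⟩,
      ⟨Or.inr ?_, ?_⟩, ?_, ‹_›⟩
    · exact inferInstanceAs (Nontrivial K)
    · intro E hE hE'
      rcases idempotent_of_cyclic (x := (0 : Module.End K K)) (E := E.f) (n := 1) (by simp)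
        (by simp) hE 1 (fun u => ⟨u, 0, by simp⟩) with h | h
      · left
        have : E = ⟨0, 0, fun _ => by simp, fun _ => by simp, fun _ => by simp⟩ :=
          hP.2 P _ _ h (fun _ => (map_zero E.g).trans rfl)
        subst this
        exact ⟨fun _ => rfl, fun _ => rfl⟩
      · right
        have : E = ⟨LinearMap.id, LinearMap.id, fun _ => rfl, fun _ => rfl, fun _ => rfl⟩ :=
          hP.2 P _ _ h (fun _ => (map_zero E.g).trans rfl)
        subst this
        exact ⟨fun _ => rfl, fun _ => rfl⟩
    · exact inferInstanceAs (Nontrivial (Fin a → K))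
    · intro E hE hE'
      rcases idempotent_of_cyclic (x := shift K a K) (E := E.g) (shift_pow_self a) E.comm_β hE' _
        shift_cyclic with h | h
      · exact Or.inl ⟨fun _ => Subsingleton.elim _ _, h⟩
      · exact Or.inr ⟨fun _ => Subsingleton.elim _ _, h⟩
    · exact inferInstanceAs (Nontrivial K)
  | false =>
    let Q : Rep K false a b := ⟨PUnit, K, 0, 0, 0, rfl, zero_pow (NeZero.ne a), fun v => by simp⟩
    have _ : Subsingleton Q.V := inferInstanceAs (Subsingleton PUnit)
    refine ⟨freeFalse hba K, Q, single0 K a K, (LinearMap.id : K →ₗ[K] K), isFree_freeFalse hba K,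
      Rep.isFree_false_of_subsingleton, ⟨Or.inl ?_, ?_⟩,
      ⟨Or.inr ?_, ?_⟩, ?_, ‹_›⟩
    · exact inferInstanceAs (Nontrivial (Fin a → K))
    · intro E hE hE'
      have key : ∀ w : (freeFalse (K := K) hba K).W, ∃ v, (freeFalse (K := K) hba K).h v = w :=
        trunc_surjective hba K
      rcases idempotent_of_cyclic (x := shift K a K) (E := E.f) (shift_pow_self a) E.comm_α hE _
        shift_cyclic with h | h
      · refine Or.inl ⟨h, fun w => ?_⟩
        obtain ⟨v, rfl⟩ := key w
        exact (E.comm_h v).trans ((congrArg _ (h v)).trans (map_zero _))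
      · refine Or.inr ⟨h, fun w => ?_⟩
        obtain ⟨v, rfl⟩ := key w
        exact (E.comm_h v).trans (congrArg _ (h v))
    · exact inferInstanceAs (Nontrivial K)
    · intro E hE hE'
      rcases idempotent_of_cyclic (x := (0 : Module.End K K)) (E := E.g) (n := 1) (by simp)
        (by simp) hE' 1 (fun u => ⟨u, 0, by simp⟩) with h | h
      · exact Or.inl ⟨fun _ => Subsingleton.elim _ _, h⟩
      · exact Or.inr ⟨fun _ => Subsingleton.elim _ _, h⟩
    · exact inferInstanceAs (Nontrivial (Fin a → K))

variable {Λ : Type} [Ring Λ] [Algebra K Λ]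

namespace Presented

variable [NeZero a] (p : Presented K Λ t a b)

theorem iso_of_mod_equiv {r s : Rep K t a b} (e : p.Mod r ≃ₗ[Λᵐᵒᵖ] p.Mod s) : r.Iso s := by
  obtain ⟨φ, hφ⟩ := p.toLin_surjective e.toLinearMap
  have hφ' : ∀ m, p.toLin φ m = e m := LinearMap.congr_fun hφ
  refine ⟨φ, ⟨fun v v' h => ?_, fun w w' h => ?_⟩, p.toLin_surj.1 (by rw [hφ]; exact e.surjective)⟩
  · have : p.elt v 0 = p.elt v' 0 := e.injective (by
      rw [← hφ', ← hφ', toLin_elt, toLin_elt, h])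
    exact (p.elt_inj.1 this).1
  · have : p.elt 0 w = p.elt 0 w' := e.injective (by
      rw [← hφ', ← hφ', toLin_elt, toLin_elt, h])
    exact (p.elt_inj.1 this).2

theorem regular_equiv {P Q : Rep K t a b} {T : K →ₗ[K] P.V} {T' : K →ₗ[K] Q.W}
    (hP : P.IsFree T (0 : PUnit →ₗ[K] P.W)) (hQ : Q.IsFree (0 : PUnit →ₗ[K] Q.V) T') :
    Nonempty (Λᵐᵒᵖ ≃ₗ[Λᵐᵒᵖ] p.Mod P × p.Mod Q) := by
  obtain ⟨r, ⟨e⟩⟩ := p.exists_rep Λᵐᵒᵖ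
  obtain ⟨v, w, hvw⟩ := p.exists_elt (e 1)
  obtain ⟨φ, hφ, -⟩ := hP.1 r (LinearMap.toSpanSingleton K _ v) 0
  obtain ⟨ψ, -, hψ⟩ := hQ.1 r 0 (LinearMap.toSpanSingleton K _ w)
  let G : p.Mod P × p.Mod Q →ₗ[Λᵐᵒᵖ] Λᵐᵒᵖ :=
    e.symm.toLinearMap ∘ₗ LinearMap.coprod (p.toLin φ) (p.toLin ψ)
  let F : Λᵐᵒᵖ →ₗ[Λᵐᵒᵖ] p.Mod P × p.Mod Q :=
    LinearMap.toSpanSingleton Λᵐᵒᵖ _ (p.elt (T 1) 0, p.elt 0 (T' 1))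
  have hG1 : G (p.elt (T 1) 0, 0) = op p.e := by
    have : p.toLin φ (p.elt (T 1) 0) = e (op p.e) := by
      rw [toLin_elt, hφ, map_zero, ← mul_one (op p.e), ← smul_eq_mul, map_smul, hvw, e_smul]
      simp
    simp only [G, LinearMap.comp_apply, LinearMap.coprod_apply, map_zero, add_zero, this]
    exact e.symm_apply_apply _
  have hG2 : G (0, p.elt 0 (T' 1)) = op p.f := by
    have : p.toLin ψ (p.elt 0 (T' 1)) = e (op p.f) := by
      rw [toLin_elt, hψ, map_zero, ← mul_one (op p.f), ← smul_eq_mul, map_smul, hvw, f_smul]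
      simp
    simp only [G, LinearMap.comp_apply, LinearMap.coprod_apply, map_zero, zero_add, this]
    exact e.symm_apply_apply _
  have hF1 : F (op p.e) = (p.elt (T 1) 0, 0) := by
    change op p.e • (p.elt (T 1) 0, p.elt 0 (T' 1)) = _
    rw [Prod.smul_mk, e_smul, e_smul]
    rfl
  have hF2 : F (op p.f) = (0, p.elt 0 (T' 1)) := by
    change op p.f • (p.elt (T 1) 0, p.elt 0 (T' 1)) = _
    rw [Prod.smul_mk, f_smul, f_smul]
    rfl
  have hPext : ∀ (s : Rep K t a b) (A B : p.Mod P →ₗ[Λᵐᵒᵖ] p.Mod s),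
      A (p.elt (T 1) 0) = B (p.elt (T 1) 0) → A = B := by
    intro s A B h
    obtain ⟨A, rfl⟩ := p.toLin_surjective A
    obtain ⟨B, rfl⟩ := p.toLin_surjective B
    rw [toLin_elt, toLin_elt, elt_inj] at h
    refine congrArg _ (hP.2 s A B (fun c => ?_) fun _ => ?_)
    · have hc : T c = c • T 1 := by rw [← map_smul, smul_eq_mul, mul_one]
      rw [hc, map_smul, map_smul, h.1]
    · simp
  have hQext : ∀ (s : Rep K t a b) (A B : p.Mod Q →ₗ[Λᵐᵒᵖ] p.Mod s),
      A (p.elt 0 (T' 1)) = B (p.elt 0 (T' 1)) → A = B := by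
    intro s A B h
    obtain ⟨A, rfl⟩ := p.toLin_surjective A
    obtain ⟨B, rfl⟩ := p.toLin_surjective B
    rw [toLin_elt, toLin_elt, elt_inj] at h
    refine congrArg _ (hQ.2 s A B (fun _ => ?_) fun c => ?_)
    · simp
    · have hc : T' c = c • T' 1 := by rw [← map_smul, smul_eq_mul, mul_one]
      rw [hc, map_smul, map_smul, h.2]
  refine ⟨LinearEquiv.ofLinearMap F G ?_ ?_⟩
  · have h1 : LinearMap.fst Λᵐᵒᵖ _ _ ∘ₗ (F ∘ₗ G) ∘ₗ LinearMap.inl Λᵐᵒᵖ _ _ =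
        (LinearMap.id : p.Mod P →ₗ[Λᵐᵒᵖ] p.Mod P) := hPext _ _ _ (by
      simp [hG1, hF1])
    have h2 : LinearMap.snd Λᵐᵒᵖ _ _ ∘ₗ (F ∘ₗ G) ∘ₗ LinearMap.inl Λᵐᵒᵖ _ _ =
        (0 : p.Mod P →ₗ[Λᵐᵒᵖ] p.Mod Q) := hPext _ _ _ (by
      simp [hG1, hF1])
    have h3 : LinearMap.fst Λᵐᵒᵖ _ _ ∘ₗ (F ∘ₗ G) ∘ₗ LinearMap.inr Λᵐᵒᵖ _ _ =
        (0 : p.Mod Q →ₗ[Λᵐᵒᵖ] p.Mod P) := hQext _ _ _ (by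
      simp [hG2, hF2])
    have h4 : LinearMap.snd Λᵐᵒᵖ _ _ ∘ₗ (F ∘ₗ G) ∘ₗ LinearMap.inr Λᵐᵒᵖ _ _ =
        (LinearMap.id : p.Mod Q →ₗ[Λᵐᵒᵖ] p.Mod Q) := hQext _ _ _ (by
      simp [hG2, hF2])
    refine LinearMap.prod_ext (LinearMap.ext fun m => ?_) (LinearMap.ext fun m => ?_)
    · exact Prod.ext (LinearMap.congr_fun h1 m) (LinearMap.congr_fun h2 m)
    · exact Prod.ext (LinearMap.congr_fun h3 m) (LinearMap.congr_fun h4 m)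
  · refine LinearMap.ext_ring ?_
    change G (F 1) = 1
    have hs : F 1 = (p.elt (T 1) 0, 0) + (0, p.elt 0 (T' 1)) := by
      simp [F]
    rw [hs, map_add, hG1, hG2, ← op_add, p.ad.one, op_one]

end Presented

theorem Presented.regular_count [NeZero a] [NeZero b] (p : Presented K Λ t a b) (hba : b ≤ a) :
    HasIndecClassCount Λᵐᵒᵖ (ModuleCat.of Λᵐᵒᵖ Λᵐᵒᵖ) 2 := by
  obtain ⟨P, Q, T, T', hP, hQ, hP', hQ', hV, hV'⟩ := exists_generators (K := K) (t := t) hba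
  obtain ⟨e⟩ := p.regular_equiv hP hQ
  refine (isBasicModuleCat_of_prod (M := ModuleCat.of Λᵐᵒᵖ Λᵐᵒᵖ) e
    (p.isIndecModule_mod.2 hP') (p.isIndecModule_mod.2 hQ') ⟨fun g => ?_⟩).2
  obtain ⟨φ, hφ, -⟩ := p.iso_of_mod_equiv g
  obtain ⟨v, v', hv⟩ := hV
  exact hv (hφ.1 (Subsingleton.elim _ _))

end Regular

section Families

open MulOpposite

variable {K : Type} [Field K] {t : Bool} {a b : ℕ}

/-- A finite dimensional projective presentation of a representation. -/
structure Rep.Pres (X : Rep K t a b) where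
  P₁ : Rep K t a b
  P₀ : Rep K t a b
  f : Rep.Hom P₁ P₀
  g : Rep.Hom P₀ X
  lift₁ : P₁.Lifting
  lift₀ : P₀.Lifting
  surj : g.Surj
  exact_f : ∀ v, g.f v = 0 ↔ ∃ u, f.f u = v
  exact_g : ∀ w, g.g w = 0 ↔ ∃ u, f.g u = w
  fin₁V : FiniteDimensional K P₁.V
  fin₁W : FiniteDimensional K P₁.W
  fin₀V : FiniteDimensional K P₀.V
  fin₀W : FiniteDimensional K P₀.W

/-- Every morphism from the first term of a presentation extends to the zeroth term. -/
def Rep.Pres.ExtZero {X : Rep K t a b} (π : X.Pres) (Y : Rep K t a b) : Prop :=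
  ∀ h : Rep.Hom π.P₁ Y, ∃ h' : Rep.Hom π.P₀ Y,
    (∀ v, h'.f (π.f.f v) = h.f v) ∧ ∀ w, h'.g (π.f.g w) = h.g w

/-- The total dimension of a representation. -/
def Rep.dim (r : Rep K t a b) : ℕ := Module.finrank K r.V + Module.finrank K r.W

theorem Rep.Iso.dim_eq {r s : Rep K t a b} (h : r.Iso s) : r.dim = s.dim := by
  obtain ⟨φ, h1, h2⟩ := h
  exact congrArg₂ (· + ·) (LinearEquiv.ofBijective φ.f ⟨h1.1, h2.1⟩).finrank_eq
    (LinearEquiv.ofBijective φ.g ⟨h1.2, h2.2⟩).finrank_eq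

theorem Rep.Pres.finV {X : Rep K t a b} (π : X.Pres) : FiniteDimensional K X.V :=
  have := π.fin₀V
  Module.Finite.of_surjective π.g.f π.surj.1

theorem Rep.Pres.finW {X : Rep K t a b} (π : X.Pres) : FiniteDimensional K X.W :=
  have := π.fin₀W
  Module.Finite.of_surjective π.g.g π.surj.2

variable {Λ : Type} [Ring Λ] [Algebra K Λ]

namespace Presented

variable [NeZero a] (p : Presented K Λ t a b)

theorem finite_mod_field {r : Rep K t a b} (h : FiniteDimensional K r.V)
    (h' : FiniteDimensional K r.W) : Module.Finite K (p.Mod r) :=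
  inferInstanceAs (Module.Finite K (r.V × r.W))

theorem finite_mod {r : Rep K t a b} (h : FiniteDimensional K r.V)
    (h' : FiniteDimensional K r.W) : Module.Finite Λᵐᵒᵖ (p.Mod r) :=
  have := p.finite_mod_field h h'
  Module.Finite.of_restrictScalars_finite K Λᵐᵒᵖ _

theorem finrank_mod {r : Rep K t a b} (h : FiniteDimensional K r.V)
    (h' : FiniteDimensional K r.W) : Module.finrank K (p.Mod r) = r.dim :=
  Module.finrank_prod (R := K) (M := r.V) (M' := r.W)

theorem extends_of_extZero {X Y : Rep K t a b} {π : X.Pres} (h : π.ExtZero Y)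
    (k : p.Mod π.P₁ →ₗ[Λᵐᵒᵖ] p.Mod Y) : ∃ k' : p.Mod π.P₀ →ₗ[Λᵐᵒᵖ] p.Mod Y,
      ∀ m, k' (p.toLin π.f m) = k m := by
  obtain ⟨k, rfl⟩ := p.toLin_surjective k
  obtain ⟨k', h1, h2⟩ := h k
  refine ⟨p.toLin k', fun m => ?_⟩
  obtain ⟨v, w, rfl⟩ := p.exists_elt m
  rw [toLin_elt, toLin_elt, toLin_elt, h1, h2]

theorem exact_mod {X : Rep K t a b} (π : X.Pres) (m : p.Mod π.P₀) :
    p.toLin π.g m = 0 ↔ ∃ u, p.toLin π.f u = m := by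
  obtain ⟨v, w, rfl⟩ := p.exists_elt m
  rw [toLin_elt, ← elt_zero, elt_inj, π.exact_f, π.exact_g]
  constructor
  · rintro ⟨⟨u, rfl⟩, u', rfl⟩
    exact ⟨p.elt u u', rfl⟩
  · rintro ⟨u, hu⟩
    obtain ⟨v', w', rfl⟩ := p.exists_elt u
    rw [toLin_elt, elt_inj] at hu
    exact ⟨⟨v', hu.1⟩, w', hu.2⟩

theorem isTauRigid_prod {X Y : Rep K t a b} (π : X.Pres) (ρ : Y.Pres) (h1 : π.ExtZero X)
    (h2 : π.ExtZero Y) (h3 : ρ.ExtZero X) (h4 : ρ.ExtZero Y) :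
    IsTauRigidCat Λᵐᵒᵖ (ModuleCat.of Λᵐᵒᵖ (p.Mod X × p.Mod Y)) := by
  have a1 := p.finite_mod π.fin₁V π.fin₁W
  have a2 := p.finite_mod π.fin₀V π.fin₀W
  have a3 := p.finite_mod ρ.fin₁V ρ.fin₁W
  have a4 := p.finite_mod ρ.fin₀V ρ.fin₀W
  have a5 := p.finite_mod π.finV π.finW
  have a6 := p.finite_mod ρ.finV ρ.finW
  have b1 := p.projective_mod π.lift₁
  have b2 := p.projective_mod π.lift₀
  have b3 := p.projective_mod ρ.lift₁
  have b4 := p.projective_mod ρ.lift₀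
  refine ⟨inferInstanceAs (Module.Finite Λᵐᵒᵖ (p.Mod X × p.Mod Y)),
    ModuleCat.of Λᵐᵒᵖ (p.Mod π.P₁ × p.Mod ρ.P₁), ModuleCat.of Λᵐᵒᵖ (p.Mod π.P₀ × p.Mod ρ.P₀),
    LinearMap.prodMap (p.toLin π.f) (p.toLin ρ.f), LinearMap.prodMap (p.toLin π.g) (p.toLin ρ.g),
    inferInstanceAs (Module.Finite Λᵐᵒᵖ (p.Mod π.P₁ × p.Mod ρ.P₁)),
    inferInstanceAs (Module.Projective Λᵐᵒᵖ (p.Mod π.P₁ × p.Mod ρ.P₁)),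
    inferInstanceAs (Module.Finite Λᵐᵒᵖ (p.Mod π.P₀ × p.Mod ρ.P₀)),
    inferInstanceAs (Module.Projective Λᵐᵒᵖ (p.Mod π.P₀ × p.Mod ρ.P₀)),
    Prod.map_surjective.2 ⟨p.toLin_surj.2 π.surj, p.toLin_surj.2 ρ.surj⟩, ?_, ?_⟩
  · ext ⟨m, n⟩
    rw [LinearMap.mem_ker]
    constructor
    · rintro ⟨⟨u, v⟩, h⟩
      rw [← h]
      exact Prod.ext ((p.exact_mod π _).2 ⟨u, rfl⟩) ((p.exact_mod ρ _).2 ⟨v, rfl⟩)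
    · intro h
      obtain ⟨u, hu⟩ := (p.exact_mod π m).1 (congrArg Prod.fst h)
      obtain ⟨v, hv⟩ := (p.exact_mod ρ n).1 (congrArg Prod.snd h)
      exact ⟨(u, v), Prod.ext hu hv⟩
  · intro (k : p.Mod π.P₁ × p.Mod ρ.P₁ →ₗ[Λᵐᵒᵖ] p.Mod X × p.Mod Y)
    obtain ⟨k1, hk1⟩ := p.extends_of_extZero h1
      (LinearMap.fst Λᵐᵒᵖ _ _ ∘ₗ k ∘ₗ LinearMap.inl Λᵐᵒᵖ _ _)
    obtain ⟨k2, hk2⟩ := p.extends_of_extZero h2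
      (LinearMap.snd Λᵐᵒᵖ _ _ ∘ₗ k ∘ₗ LinearMap.inl Λᵐᵒᵖ _ _)
    obtain ⟨k3, hk3⟩ := p.extends_of_extZero h3
      (LinearMap.fst Λᵐᵒᵖ _ _ ∘ₗ k ∘ₗ LinearMap.inr Λᵐᵒᵖ _ _)
    obtain ⟨k4, hk4⟩ := p.extends_of_extZero h4
      (LinearMap.snd Λᵐᵒᵖ _ _ ∘ₗ k ∘ₗ LinearMap.inr Λᵐᵒᵖ _ _)
    refine ⟨LinearMap.coprod (k1.prod k2) (k3.prod k4), ?_⟩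
    refine LinearMap.prod_ext (M := p.Mod π.P₁) (M₂ := p.Mod ρ.P₁)
      (M₃ := p.Mod X × p.Mod Y) (f := k) (LinearMap.ext fun m => ?_) (LinearMap.ext fun m => ?_)
    · refine Eq.trans (b := (k1 (p.toLin π.f m), k2 (p.toLin π.f m))) ?_ ?_
      · exact Prod.ext (hk1 m).symm (hk2 m).symm
      · simp
    · refine Eq.trans (b := (k3 (p.toLin ρ.f m), k4 (p.toLin ρ.f m))) ?_ ?_
      · exact Prod.ext (hk3 m).symm (hk4 m).symm
      · simp

theorem isBasicSupportTauTilting_prod [NeZero b] (hba : b ≤ a) {X Y : Rep K t a b} (π : X.Pres)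
    (ρ : Y.Pres) (h1 : π.ExtZero X) (h2 : π.ExtZero Y) (h3 : ρ.ExtZero X) (h4 : ρ.ExtZero Y)
    (hX : X.Indec) (hY : Y.Indec) (hXY : X.dim ≠ Y.dim) :
    IsBasicSupportTauTilting Λ (ModuleCat.of Λᵐᵒᵖ (p.Mod X × p.Mod Y)) := by
  obtain ⟨c1, c2⟩ := isBasicModuleCat_of_prod (M := ModuleCat.of Λᵐᵒᵖ (p.Mod X × p.Mod Y))
    (LinearEquiv.refl Λᵐᵒᵖ (p.Mod X × p.Mod Y))
    (p.isIndecModule_mod.2 hX) (p.isIndecModule_mod.2 hY)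
    ⟨fun e => hXY (p.iso_of_mod_equiv e).dim_eq⟩
  refine ⟨⟨p.isTauRigid_prod π ρ h1 h2 h3 h4, ModuleCat.of Λᵐᵒᵖ PUnit, 2, 0, 2,
    inferInstanceAs (Module.Finite Λᵐᵒᵖ PUnit), inferInstanceAs (Module.Projective Λᵐᵒᵖ PUnit),
    fun f => LinearMap.ext fun x => ?_, c2, hasIndecClassCount_punit, p.regular_count hba, rfl⟩, c1⟩
  rw [show x = 0 from Subsingleton.elim (α := PUnit) _ _, map_zero, map_zero]

end Presented

theorem Presented.not_isTauTiltingFinite_of_family [NeZero a] [NeZero b]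
    (p : Presented K Λ t a b) (hba : b ≤ a) (X Y : ℕ → Rep K t a b)
    (π : ∀ n, (X n).Pres) (ρ : ∀ n, (Y n).Pres) (h1 : ∀ n, (π n).ExtZero (X n))
    (h2 : ∀ n, (π n).ExtZero (Y n)) (h3 : ∀ n, (ρ n).ExtZero (X n))
    (h4 : ∀ n, (ρ n).ExtZero (Y n)) (hX : ∀ n, (X n).Indec) (hY : ∀ n, (Y n).Indec)
    (hXY : ∀ n, (X n).dim ≠ (Y n).dim) (hmono : StrictMono fun n => (X n).dim + (Y n).dim) :
    ¬ IsTauTiltingFinite Λ := by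
  rintro ⟨N, L, hL⟩
  choose i hi using fun n => hL _ (p.isBasicSupportTauTilting_prod hba (π n) (ρ n) (h1 n) (h2 n)
    (h3 n) (h4 n) (hX n) (hY n) (hXY n))
  obtain ⟨m, n, hmn, hi'⟩ := Finite.exists_ne_map_eq_of_infinite i
  obtain ⟨e⟩ := hi m
  obtain ⟨e'⟩ := hi n
  rw [hi'] at e
  let e'' : (p.Mod (X m) × p.Mod (Y m)) ≃ₗ[Λᵐᵒᵖ] (p.Mod (X n) × p.Mod (Y n)) := e.trans e'.symm
  have hfin := fun n => p.finite_mod_field (π n).finV (π n).finW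
  have hfin' := fun n => p.finite_mod_field (ρ n).finV (ρ n).finW
  have hdim := (e''.restrictScalars K).finrank_eq
  rw [Module.finrank_prod, Module.finrank_prod, p.finrank_mod (π m).finV (π m).finW,
    p.finrank_mod (π n).finV (π n).finW, p.finrank_mod (ρ m).finV (ρ m).finW,
    p.finrank_mod (ρ n).finV (ρ n).finW] at hdim
  exact hmn (hmono.injective hdim)

end Families

section Pairs

variable {K : Type} [Field K]

section CompLeft

variable {S S' U : Type} [AddCommGroup S] [Module K S] [AddCommGroup S'] [Module K S']
  [AddCommGroup U] [Module K U]

theorem compLeft_shift (n : ℕ) (κ : S →ₗ[K] S') (u : Fin n → S) :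
    κ.compLeft (Fin n) (shift K n S u) = shift K n S' (κ.compLeft (Fin n) u) := by
  funext k
  change κ (if h : _ then _ else _) = if h : _ then _ else _
  split
  · rfl
  · exact map_zero κ

theorem compLeft_single0 (n : ℕ) [NeZero n] (κ : S →ₗ[K] S') (s : S) :
    κ.compLeft (Fin n) (single0 K n S s) = single0 K n S' (κ s) := by
  funext k
  change κ (Pi.single (M := fun _ => S) 0 s k) = Pi.single (M := fun _ => S') 0 (κ s) k
  by_cases h : k = 0
  · subst h; simp
  · rw [Pi.single_eq_of_ne h, Pi.single_eq_of_ne h, map_zero]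

theorem linearIndependent_pow {x : Module.End K U} {n : ℕ} (hx : x ^ n = 0) {z : U}
    (hz : (x ^ (n - 1)) z ≠ 0) : LinearIndependent K fun k : Fin n => (x ^ (k : ℕ)) z := by
  rw [Fintype.linearIndependent_iff]
  intro c hc
  have hzero : ∀ m, n ≤ m → (x ^ m) z = 0 := fun m hm => by rw [pow_zero_of_le hx hm]; rfl
  suffices ∀ m (i : Fin n), (i : ℕ) < m → c i = 0 from fun i => this n i i.2
  intro m
  induction m with
  | zero => exact fun i hi => absurd hi (Nat.not_lt_zero _)
  | succ m ih =>
    intro i hi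
    rcases Nat.lt_succ_iff_lt_or_eq.1 hi with h | rfl
    · exact ih i h
    have h1 := congrArg (x ^ (n - 1 - (i : ℕ))) hc
    rw [map_zero, map_sum, Finset.sum_eq_single i] at h1
    · rw [map_smul, ← Module.End.mul_apply, ← pow_add,
        show n - 1 - (i : ℕ) + i = n - 1 by omega] at h1
      exact (smul_eq_zero.1 h1).resolve_right hz
    · intro j _ hj
      rcases Nat.lt_or_gt_of_ne (Fin.val_ne_of_ne hj) with h | h
      · rw [ih j h, zero_smul, map_zero]
      · rw [map_smul, ← Module.End.mul_apply, ← pow_add, hzero _ (by omega), smul_zero]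
    · simp

theorem exists_extend_linearIndependent {ι : Type} {w : ι → S} (hw : LinearIndependent K w)
    (c : ι → S') : ∃ θ : S →ₗ[K] S', ∀ i, θ (w i) = c i := by
  obtain ⟨θ, hθ⟩ := LinearMap.exists_extend ((Module.Basis.span hw).constr K c)
  refine ⟨θ, fun i => ?_⟩
  have h1 := LinearMap.congr_fun hθ (Module.Basis.span hw i)
  rw [Module.Basis.constr_basis, LinearMap.comp_apply, Submodule.subtype_apply,
    Module.Basis.span_apply] at h1
  exact h1

theorem exists_extend_eq {s : S} (hs : s ≠ 0) (c : S') : ∃ θ : S →ₗ[K] S', θ s = c := by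
  obtain ⟨θ, hθ⟩ := exists_extend_linearIndependent (K := K) (w := fun _ : Unit => s)
    (LinearIndependent.of_subsingleton () hs) fun _ => c
  exact ⟨θ, hθ ()⟩

end CompLeft

/-- A space with a nilpotent endomorphism and a subspace. -/
structure Pair (K : Type) [Field K] (b : ℕ) where
  U : Type
  [instU : AddCommGroup U]
  [modU : Module K U]
  V : Submodule K U
  x : Module.End K U
  hx : x ^ b = 0

attribute [instance] Pair.instU Pair.modU

namespace Pair

variable {b : ℕ}

/-- Every linear map from the subspace to the quotient is induced by an equivariant map. -/
def Ext0 (X X' : Pair K b) : Prop :=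
  ∀ θ : X.V →ₗ[K] X'.U, ∃ F : X.U →ₗ[K] X'.U, (∀ u, F (X.x u) = X'.x (F u)) ∧
    ∀ v : X.V, F v - θ v ∈ X'.V

/-- Idempotent endomorphisms are trivial. -/
def Idem (X : Pair K b) : Prop :=
  ∀ E : Module.End K X.U, (∀ u, E (X.x u) = X.x (E u)) → (∀ u, E (E u) = E u) →
    (∀ v ∈ X.V, E v ∈ X.V) → (∀ u, E u = 0) ∨ ∀ u, E u = u

/-- The numerical invariants of a pair. -/
structure Dim (X : Pair K b) (v d : ℕ) : Prop where
  fin : FiniteDimensional K X.U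
  cyc : Cyc b X.x
  rank_V : Module.finrank K X.V = v
  rank_U : Module.finrank K X.U = b * d
  lt : v < 2 * d

/-- The embedding of a pair in a free module over the truncated polynomial ring. -/
def φ (X : Pair K b) : X.U →ₗ[K] (Fin b → X.U ⧸ X.V) := coSh b X.x X.V.mkQ

theorem φ_comm (X : Pair K b) (u : X.U) : X.φ (X.x u) = shift K b _ (X.φ u) :=
  coSh_comm b X.hx _ u

/-- The cokernel of the embedding, with the projection. -/
abbrev Q (X : Pair K b) : Type := (Fin b → X.U ⧸ X.V) ⧸ LinearMap.range X.φ

/-- The operator on the cokernel. -/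
def y (X : Pair K b) : Module.End K X.Q :=
  (LinearMap.range X.φ).mapQ _ (shift K b _) (by
    rintro _ ⟨u, rfl⟩
    exact ⟨X.x u, X.φ_comm u⟩)

theorem y_pow (X : Pair K b) : X.y ^ b = 0 := by
  refine LinearMap.ext fun u => ?_
  obtain ⟨u, rfl⟩ := Submodule.Quotient.mk_surjective _ u
  have := comm_pow (x := shift K b _) (y := X.y) (F := (LinearMap.range X.φ).mkQ)
    (fun _ => rfl) b u
  rw [shift_pow_self, LinearMap.zero_apply, map_zero] at this
  exact this.symm

variable [NeZero b]

/-- The constants in the cokernel. -/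
def j (X : Pair K b) : X.U ⧸ X.V →ₗ[K] X.Q := (LinearMap.range X.φ).mkQ ∘ₗ single0 K b _

/-- The next pair in the sequence. -/
def next (X : Pair K b) : Pair K b where
  U := X.Q
  V := LinearMap.range X.j
  x := X.y
  hx := X.y_pow

variable {X X' : Pair K b} {v d : ℕ}

theorem Dim.no_chain (h : X.Dim v d) (hE : X.Ext0 X) (hb : 4 ≤ b) {z : X.U}
    (hz : ∀ k ≤ b - 2, (X.x ^ k) z ∈ X.V) : z = 0 := by
  have := h.fin
  have hd := h.lt
  by_contra hz0
  by_cases hlast : (X.x ^ (b - 1)) z = 0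
  · obtain ⟨k, hk, hk1, hk2⟩ : ∃ k, k ≤ b - 2 ∧ (X.x ^ k) z ≠ 0 ∧ X.x ((X.x ^ k) z) = 0 := by
      classical
      have hex : ∃ k, (X.x ^ k) z = 0 := ⟨_, hlast⟩
      have hpos : Nat.find hex ≠ 0 := fun h0 => hz0 (by
        have := Nat.find_spec hex
        rwa [h0] at this)
      have hle : Nat.find hex ≤ b - 1 := Nat.find_min' hex hlast
      refine ⟨Nat.find hex - 1, by omega, Nat.find_min hex (by omega), ?_⟩
      rw [← Module.End.mul_apply, ← pow_succ', Nat.sub_add_cancel (by omega)]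
      exact Nat.find_spec hex
    have hsup : X.V ⊔ LinearMap.ker X.x = ⊤ := by
      rw [eq_top_iff]
      intro y _
      obtain ⟨θ, hθ⟩ := exists_extend_eq (K := K) (S := X.V) (S' := X.U)
        (s := ⟨(X.x ^ k) z, hz k hk⟩) (fun h0 => hk1 (congrArg Subtype.val h0)) y
      obtain ⟨F, hF, hF'⟩ := hE θ
      have h1 := hF' ⟨(X.x ^ k) z, hz k hk⟩
      rw [hθ] at h1
      have h2 : X.x (F ((X.x ^ k) z)) = 0 := by rw [← hF, hk2, map_zero]
      rw [show y = -(F ((X.x ^ k) z) - y) + F ((X.x ^ k) z) by abel]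
      exact Submodule.add_mem_sup (X.V.neg_mem h1) h2
    have h1 := Submodule.finrank_add_le_finrank_add_finrank X.V (LinearMap.ker X.x)
    rw [hsup, finrank_top, h.rank_U, h.rank_V] at h1
    have h2 := h.cyc.finrank_eq
    rw [h.rank_U] at h2
    have h3 := Nat.eq_of_mul_eq_mul_left (by omega) h2
    rw [← h3] at h1
    nlinarith
  · have hli := linearIndependent_pow X.hx hlast
    let w : Fin (b - 1) → X.V := fun k => ⟨(X.x ^ (k : ℕ)) z, hz k (by omega)⟩
    have hw : LinearIndependent K w := by
      refine LinearIndependent.of_comp X.V.subtype ?_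
      exact hli.comp (Fin.castLE (Nat.sub_le b 1)) (Fin.castLE_injective _)
    let G : X.U →ₗ[K] (Fin (b - 1) → X.U ⧸ X.V) :=
      LinearMap.pi fun k => X.V.mkQ ∘ₗ (X.x ^ (k : ℕ))
    have hG : Function.Surjective G := by
      intro c
      choose c' hc' using fun k => Submodule.mkQ_surjective X.V (c k)
      obtain ⟨θ, hθ⟩ := exists_extend_linearIndependent hw c'
      obtain ⟨F, hF, hF'⟩ := hE θ
      refine ⟨F z, funext fun k => ?_⟩
      change X.V.mkQ ((X.x ^ (k : ℕ)) (F z)) = c k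
      rw [← comm_pow hF, ← hc', ← sub_eq_zero, ← map_sub, ← hθ]
      exact (Submodule.Quotient.mk_eq_zero _).2 (hF' (w k))
    have h1 := LinearMap.finrank_le_finrank_of_surjective hG
    rw [Module.finrank_pi_fintype] at h1
    have h2 := X.V.finrank_quotient_add_finrank
    simp only [Finset.sum_const, Finset.card_univ, Fintype.card_fin, smul_eq_mul] at h1
    rw [h.rank_U, h.rank_V] at h2
    rw [h.rank_U] at h1
    obtain ⟨c, rfl⟩ : ∃ c, b = c + 4 := ⟨b - 4, by omega⟩
    rw [show c + 4 - 1 = c + 3 by omega] at h1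
    nlinarith

end Pair

end Pairs

section PairSequence

variable {K : Type} [Field K]

theorem exists_lift_of_injective {U V Y : Type} [AddCommGroup U] [Module K U] [AddCommGroup V]
    [Module K V] [AddCommGroup Y] [Module K Y] (j : U →ₗ[K] V) (hj : Function.Injective j)
    (g : Y →ₗ[K] V) (h : ∀ u, ∃ w, j w = g u) : ∃ g' : Y →ₗ[K] U, ∀ u, j (g' u) = g u := by
  refine ⟨(LinearEquiv.ofInjective j hj).symm.toLinearMap ∘ₗ
    g.codRestrict (LinearMap.range j) h, fun u => ?_⟩
  exact congrArg Subtype.val ((LinearEquiv.ofInjective j hj).apply_symm_apply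
    (g.codRestrict (LinearMap.range j) h u))

namespace Pair

variable {b : ℕ} {X X' : Pair K b} {v d : ℕ}

theorem mkQ_eq_zero {u : X.U} : X.V.mkQ u = 0 ↔ u ∈ X.V := Submodule.Quotient.mk_eq_zero _

theorem mkQ_φ (u : X.U) : (LinearMap.range X.φ).mkQ (X.φ u) = 0 :=
  (Submodule.Quotient.mk_eq_zero _).2 ⟨u, rfl⟩

/-- The free module of rank one with the zero subspace. -/
def zeroPair (K : Type) [Field K] (b : ℕ) : Pair K b where
  U := Fin b → K
  V := ⊥
  x := shift K b K
  hx := shift_pow_self b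

theorem ext0_zeroPair : (zeroPair K b).Ext0 X' := by
  refine fun θ => ⟨0, fun u => (map_zero _).symm, fun v => ?_⟩
  have : v = 0 := Subsingleton.elim (α := (⊥ : Submodule K (Fin b → K))) v 0
  rw [this, map_zero, sub_zero]
  exact X'.V.zero_mem

variable [NeZero b]

theorem Dim.φ_injective (h : X.Dim v d) (hE : X.Ext0 X) (hb : 4 ≤ b) :
    Function.Injective X.φ := by
  rw [injective_iff_map_eq_zero]
  intro u hu
  refine h.no_chain hE hb fun k hk => ?_
  have h1 := congrFun hu ⟨b - 1 - k, by omega⟩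
  rw [φ, coSh_apply] at h1
  rw [show b - 1 - (b - 1 - k) = k by omega] at h1
  exact mkQ_eq_zero.1 h1

theorem Dim.j_injective (h : X.Dim v d) (hE : X.Ext0 X) (hb : 4 ≤ b) :
    Function.Injective X.j := by
  rw [injective_iff_map_eq_zero]
  intro w hw
  obtain ⟨u, hu⟩ := (Submodule.Quotient.mk_eq_zero _).1 hw
  have hu0 : u = 0 := by
    refine h.no_chain hE hb fun k hk => ?_
    have h1 := congrFun hu ⟨b - 1 - k, by omega⟩
    rw [φ, coSh_apply] at h1
    rw [show b - 1 - (b - 1 - k) = k by omega] at h1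
    refine (Submodule.Quotient.mk_eq_zero _).1 (h1.trans ?_)
    exact Pi.single_eq_of_ne (M := fun _ => X.U ⧸ X.V)
      (fun h0 => absurd (congrArg Fin.val h0) (by simp; omega)) w
  rw [hu0, map_zero] at hu
  have h2 : 0 = Pi.single (M := fun _ => X.U ⧸ X.V) 0 w 0 := congrFun hu 0
  exact (h2.trans (Pi.single_eq_same (M := fun _ => X.U ⧸ X.V) (0 : Fin b) w)).symm

theorem Dim.next (h : X.Dim v d) (hE : X.Ext0 X) (hb : 4 ≤ b) :
    X.next.Dim (b * d - v) (b * d - v - d) := by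
  have := h.fin
  have hlt := h.lt
  have hinj := h.φ_injective hE hb
  have h1 := X.V.finrank_quotient_add_finrank
  rw [h.rank_U, h.rank_V] at h1
  have h1' : Module.finrank K (X.U ⧸ X.V) = b * d - v := by omega
  have h4 : 4 * d ≤ b * d := Nat.mul_le_mul_right d hb
  refine ⟨inferInstanceAs (FiniteDimensional K X.Q), ⟨X.y_pow, fun u hu => ?_⟩, ?_, ?_, by omega⟩
  · obtain ⟨u, rfl⟩ := Submodule.Quotient.mk_surjective _ u
    obtain ⟨u', hu'⟩ := (Submodule.Quotient.mk_eq_zero _).1 hu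
    have h2 : (X.x ^ (b - 1)) u' = 0 := by
      apply hinj
      rw [comm_pow X.φ_comm, hu', ← Module.End.mul_apply, ← pow_succ,
        Nat.sub_add_cancel (by omega), shift_pow_self, map_zero]
      rfl
    obtain ⟨u'', hu''⟩ := h.cyc.ker_pow (by omega) u' h2
    rw [show b - (b - 1) = 1 by omega, pow_one] at hu''
    obtain ⟨w, hw⟩ := (isFreeOn_shift (K := K) (S := X.U ⧸ X.V) b).cyc.2 (u - X.φ u'') (by
      rw [map_sub, ← X.φ_comm, hu'', hu', sub_self])
    refine ⟨Submodule.Quotient.mk w, ?_⟩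
    refine Eq.trans ?_ (comm_pow (x := shift K b _) (y := X.y)
      (F := (LinearMap.range X.φ).mkQ) (fun _ => rfl) (b - 1) w)
    rw [← hw, map_sub, mkQ_φ]
    exact (sub_zero _).symm
  · exact (LinearMap.finrank_range_of_inj (h.j_injective hE hb)).trans h1'
  · have h2 := (LinearMap.range X.φ).finrank_quotient_add_finrank
    rw [LinearMap.finrank_range_of_inj hinj, h.rank_U, Module.finrank_pi_fintype] at h2
    simp only [Finset.sum_const, Finset.card_univ, Fintype.card_fin, smul_eq_mul] at h2
    rw [h1'] at h2
    refine Eq.trans ?_ (Nat.mul_sub b (b * d - v) d).symm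
    exact Nat.eq_sub_of_add_eq h2

theorem Idem.next (h : X.Dim v d) (hE : X.Ext0 X) (hb : 4 ≤ b) (hI : X.Idem) : X.next.Idem := by
  intro (E : Module.End K X.Q) (hEy : ∀ u, E (X.y u) = X.y (E u)) hE2 hEV
  have hinj := h.φ_injective hE hb
  have hjinj := h.j_injective hE hb
  obtain ⟨k, hk⟩ := exists_lift_of_injective X.j hjinj (E ∘ₗ X.j) fun u => hEV _ ⟨u, rfl⟩
  let mk := (LinearMap.range X.φ).mkQ
  have hmk : mk ∘ₗ k.compLeft (Fin b) = E ∘ₗ mk := by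
    refine (isFreeOn_shift b).hom_ext (x := shift K b _) (y := X.y) (fun u => ?_)
      (fun u => hEy (mk u)) fun s => ?_
    · rw [LinearMap.comp_apply, compLeft_shift]; rfl
    · rw [LinearMap.comp_apply, compLeft_single0]
      exact hk s
  replace hmk : ∀ u, mk (k.compLeft (Fin b) u) = E (mk u) := LinearMap.congr_fun hmk
  obtain ⟨E1, hE1⟩ := exists_lift_of_injective X.φ hinj (k.compLeft (Fin b) ∘ₗ X.φ) fun u => by
    refine (Submodule.Quotient.mk_eq_zero _).1 ((hmk (X.φ u)).trans ?_)
    exact (congrArg E (mkQ_φ u)).trans (map_zero E)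
  have hk2 : ∀ w, k (k w) = k w := fun w => hjinj (by
    rw [hk, LinearMap.comp_apply, hk]
    exact hE2 _)
  have hkE : ∀ u, X.V.mkQ (E1 u) = k (X.V.mkQ u) := fun u => by
    have h1 := congrFun (hE1 u) ⟨b - 1, by omega⟩
    rw [φ, coSh_apply] at h1
    refine Eq.trans ?_ (h1.trans (congrArg k ?_))
    · simp
    · rw [coSh_apply]; simp
  rcases hI E1 (fun u => hinj (by
      rw [hE1, LinearMap.comp_apply, X.φ_comm, X.φ_comm, compLeft_shift, hE1]; rfl))
    (fun u => hinj (by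
      rw [hE1, LinearMap.comp_apply, hE1]
      exact funext fun i => hk2 _))
    (fun v hv => by
      refine mkQ_eq_zero.1 ((hkE v).trans ?_)
      rw [mkQ_eq_zero.2 hv, map_zero]) with h0 | h1
  · left
    intro u
    obtain ⟨u, rfl⟩ := Submodule.Quotient.mk_surjective _ u
    refine (hmk u).symm.trans (Eq.trans (congrArg mk ?_) (map_zero mk))
    funext i
    obtain ⟨w, hw⟩ := X.V.mkQ_surjective (u i)
    change k (u i) = 0
    rw [← hw, ← hkE, h0, map_zero]
  · right
    intro u
    obtain ⟨u, rfl⟩ := Submodule.Quotient.mk_surjective _ u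
    refine (hmk u).symm.trans (congrArg mk ?_)
    funext i
    obtain ⟨w, hw⟩ := X.V.mkQ_surjective (u i)
    change k (u i) = u i
    rw [← hw, ← hkE, h1]

theorem Ext0.exists_factor (h : X.Ext0 X') (hX : Cyc b X.x) (l : X.U →ₗ[K] X'.Q)
    (hl : ∀ u, l (X.x u) = X'.y (l u)) : ∃ κ : X.U ⧸ X.V →ₗ[K] X'.U ⧸ X'.V,
      ∀ u, l u = (LinearMap.range X'.φ).mkQ (κ.compLeft (Fin b) (X.φ u)) := by
  obtain ⟨S, hS⟩ := Submodule.exists_isCompl (LinearMap.range X.x)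
  have hfree := hX.isFreeOn hS.symm
  obtain ⟨T, hT⟩ := Module.projective_lifting_property (LinearMap.range X'.φ).mkQ
    (l ∘ₗ S.subtype) (Submodule.mkQ_surjective _)
  obtain ⟨L, hL, hLT⟩ := hfree.exists_ext (shift K b (X'.U ⧸ X'.V)) T fun s => by
    rw [shift_pow_self]; rfl
  have hmk : (LinearMap.range X'.φ).mkQ ∘ₗ L = l := by
    refine hfree.hom_ext (y := X'.y) (fun u => ?_) hl fun s => ?_
    · rw [LinearMap.comp_apply, hL]; rfl
    · rw [LinearMap.comp_apply, hLT]
      exact LinearMap.congr_fun hT s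
  have hco := eq_coSh b hL
  generalize LinearMap.proj _ ∘ₗ L = ψ at hco
  obtain ⟨θ, hθ⟩ := Module.projective_lifting_property X'.V.mkQ (ψ ∘ₗ X.V.subtype)
    (Submodule.mkQ_surjective _)
  obtain ⟨F, hF, hFθ⟩ := h θ
  obtain ⟨κ, hκ⟩ := TwoPoint.exists_factor X.V.mkQ (Submodule.mkQ_surjective _)
    (ψ - X'.V.mkQ ∘ₗ F) fun u hu => by
      have hu := mkQ_eq_zero.1 hu
      have h1 := mkQ_eq_zero.2 (hFθ ⟨u, hu⟩)
      have h2 := LinearMap.congr_fun hθ ⟨u, hu⟩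
      rw [map_sub, sub_eq_zero] at h1
      rw [LinearMap.sub_apply, sub_eq_zero]
      exact h2.symm.trans h1.symm
  refine ⟨κ, fun u => ?_⟩
  have hsum : L u = X'.φ (F u) + κ.compLeft (Fin b) (X.φ u) := by
    rw [hco]
    funext i
    change ψ _ = X'.V.mkQ ((X'.x ^ _) (F u)) + κ (X.V.mkQ _)
    rw [hκ, ← comm_pow hF]
    simp
  rw [← hmk, LinearMap.comp_apply, hsum, map_add, mkQ_φ, zero_add]

theorem Ext0.next (h : X.Ext0 X') (hX : Cyc b X.x) :
    X.next.Ext0 X'.next := by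
  intro (θ : LinearMap.range X.j →ₗ[K] X'.Q)
  let θ' : X.U ⧸ X.V →ₗ[K] X'.Q := θ ∘ₗ X.j.rangeRestrict
  have hpow : ∀ s, (X'.y ^ b) (θ' s) = 0 := fun s => by rw [X'.y_pow]; rfl
  obtain ⟨Θ, hΘ, hΘs⟩ := (isFreeOn_shift b).exists_ext X'.y θ' hpow
  obtain ⟨κ, hκ⟩ := h.exists_factor hX (Θ ∘ₗ X.φ) fun u => by
    rw [LinearMap.comp_apply, X.φ_comm, hΘ]; rfl
  let mk' := (LinearMap.range X'.φ).mkQ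
  let G := Θ - mk' ∘ₗ κ.compLeft (Fin b)
  have hG0 : LinearMap.range X.φ ≤ LinearMap.ker G := by
    rintro _ ⟨u, rfl⟩
    exact sub_eq_zero.2 (hκ u)
  refine ⟨(LinearMap.range X.φ).liftQ G hG0, fun u => ?_, ?_⟩
  · obtain ⟨u, rfl⟩ := Submodule.Quotient.mk_surjective _ u
    change Θ (shift K b _ u) - mk' (κ.compLeft (Fin b) (shift K b _ u)) =
      X'.y (Θ u - mk' (κ.compLeft (Fin b) u))
    rw [hΘ, compLeft_shift, map_sub]
    rfl
  · rintro ⟨_, w, rfl⟩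
    refine ⟨-κ w, ?_⟩
    change _ = Θ (single0 K b _ w) - mk' (κ.compLeft (Fin b) (single0 K b _ w)) - θ' w
    rw [hΘs, compLeft_single0, map_neg]
    simp only [sub_sub_cancel_left]
    rfl

/-- The free module of rank one with the line spanned by a generator. -/
def linePair (K : Type) [Field K] (b : ℕ) [NeZero b] : Pair K b where
  U := Fin b → K
  V := LinearMap.range (single0 K b K)
  x := shift K b K
  hx := shift_pow_self b

theorem single0_injective : Function.Injective (single0 K b K) :=
  Pi.single_injective (M := fun _ => K) 0

theorem ext0_linePair : (linePair K b).Ext0 X' := by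
  intro θ
  obtain ⟨F, hF, hFs⟩ := (isFreeOn_shift b).exists_ext X'.x
    (θ ∘ₗ (single0 K b K).rangeRestrict) fun s => by rw [X'.hx]; rfl
  refine ⟨F, hF, ?_⟩
  rintro ⟨_, s, rfl⟩
  have h0 := sub_eq_zero.2 (hFs s)
  exact Set.mem_of_eq_of_mem h0 X'.V.zero_mem

theorem idem_zeroPair : (zeroPair K b).Idem := fun _ hE hE2 _ =>
  idempotent_of_cyclic (shift_pow_self b) hE hE2 _ shift_cyclic

theorem idem_linePair : (linePair K b).Idem := fun _ hE hE2 _ =>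
  idempotent_of_cyclic (shift_pow_self b) hE hE2 _ shift_cyclic

theorem dim_zeroPair : (zeroPair K b).Dim 0 1 :=
  ⟨inferInstanceAs (FiniteDimensional K (Fin b → K)), (isFreeOn_shift b).cyc,
    finrank_bot K (Fin b → K), (Module.finrank_fin_fun K).trans (mul_one b).symm, by omega⟩

theorem dim_linePair : (linePair K b).Dim 1 1 :=
  ⟨inferInstanceAs (FiniteDimensional K (Fin b → K)), (isFreeOn_shift b).cyc,
    (LinearMap.finrank_range_of_inj single0_injective).trans (Module.finrank_self K),
    (Module.finrank_fin_fun K).trans (mul_one b).symm, by omega⟩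

/-- Two pairs with trivial idempotents and without extensions between them. -/
structure Good (X Y : Pair K b) (p q : ℕ × ℕ) : Prop where
  dim_left : X.Dim p.1 p.2
  dim_right : Y.Dim q.1 q.2
  ext_left : X.Ext0 X
  ext_right : Y.Ext0 Y
  ext_left_right : X.Ext0 Y
  ext_right_left : Y.Ext0 X
  idem_left : X.Idem
  idem_right : Y.Idem

/-- The effect of `Pair.next` on the invariants. -/
def step (b : ℕ) (p : ℕ × ℕ) : ℕ × ℕ := (b * p.2 - p.1, b * p.2 - p.1 - p.2)

theorem Good.next {Y : Pair K b} {p q : ℕ × ℕ} (h : Good X Y p q) (hb : 4 ≤ b) :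
    Good X.next Y.next (step b p) (step b q) where
  dim_left := h.dim_left.next h.ext_left hb
  dim_right := h.dim_right.next h.ext_right hb
  ext_left := h.ext_left.next h.dim_left.cyc
  ext_right := h.ext_right.next h.dim_right.cyc
  ext_left_right := h.ext_left_right.next h.dim_left.cyc
  ext_right_left := h.ext_right_left.next h.dim_right.cyc
  idem_left := h.idem_left.next h.dim_left h.ext_left hb
  idem_right := h.idem_right.next h.dim_right h.ext_right hb

theorem good_zeroPair_linePair : Good (zeroPair K b) (linePair K b) (0, 1) (1, 1) :=
  ⟨dim_zeroPair, dim_linePair, ext0_zeroPair, ext0_linePair, ext0_zeroPair, ext0_linePair,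
    idem_zeroPair, idem_linePair⟩

theorem exists_good (hb : 4 ≤ b) : ∃ (X Y : ℕ → Pair K b) (p q : ℕ → ℕ × ℕ), ∀ n,
    Good (X n) (Y n) (p n) (q n) ∧ p (n + 1) = step b (p n) ∧ q (n + 1) = step b (q n) ∧
      (q n).1 < (p n).1 ∧ (q n).2 < (p n).2 ∧ (p n).1 < (p (n + 1)).1 ∧
        (p n).2 < (p (n + 1)).2 ∧ (q n).1 < (q (n + 1)).1 ∧ (q n).2 < (q (n + 1)).2 := by
  have hgood : ∀ n, Good (next^[n + 1] (zeroPair K b)) (next^[n + 1] (linePair K b))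
      ((step b)^[n + 1] (0, 1)) ((step b)^[n + 1] (1, 1)) := by
    intro n
    induction n with
    | zero => exact good_zeroPair_linePair.next hb
    | succ n ih =>
      rw [Function.iterate_succ_apply' _ (n + 1), Function.iterate_succ_apply' _ (n + 1),
        Function.iterate_succ_apply' _ (n + 1), Function.iterate_succ_apply' _ (n + 1)]
      exact ih.next hb
  refine ⟨fun n => next^[n + 1] (zeroPair K b), fun n => next^[n + 1] (linePair K b),
    fun n => (step b)^[n + 1] (0, 1), fun n => (step b)^[n + 1] (1, 1), fun n => ⟨hgood n,
      Function.iterate_succ_apply' _ _ _, Function.iterate_succ_apply' _ _ _, ?_⟩⟩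
  have hmul : ∀ d : ℕ, 4 * d ≤ b * d := fun d => Nat.mul_le_mul_right d hb
  have key : ((step b)^[n + 1] (1, 1)).1 < ((step b)^[n + 1] (0, 1)).1 ∧
      ((step b)^[n + 1] (1, 1)).2 < ((step b)^[n + 1] (0, 1)).2 ∧
      ((step b)^[n + 1] (0, 1)).1 + 2 * ((step b)^[n + 1] (1, 1)).2 <
        ((step b)^[n + 1] (1, 1)).1 + 2 * ((step b)^[n + 1] (0, 1)).2 := by
    induction n with
    | zero => simp only [zero_add, Function.iterate_one, step]; omega
    | succ n ih =>
      have h1 := (hgood n).dim_left.lt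
      have h2 := (hgood n).dim_right.lt
      rw [Function.iterate_succ_apply' _ (n + 1), Function.iterate_succ_apply' _ (n + 1)]
      generalize (step b)^[n + 1] (0, 1) = p at *
      generalize (step b)^[n + 1] (1, 1) = q at *
      have h3 := hmul p.2
      have h4 := hmul q.2
      have h5 := hmul (p.2 - q.2)
      rw [Nat.mul_sub, Nat.mul_sub] at h5
      simp only [step]
      omega
  have h1 := (hgood n).dim_left.lt
  have h2 := (hgood n).dim_right.lt
  have h3 := hmul ((step b)^[n + 1] (0, 1)).2
  have h4 := hmul ((step b)^[n + 1] (1, 1)).2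
  simp only [Function.iterate_succ_apply' _ (n + 1)] 
  refine ⟨key.1, key.2.1, ?_⟩
  generalize (step b)^[n + 1] (0, 1) = p at *
  generalize (step b)^[n + 1] (1, 1) = q at *
  simp only [step]
  omega

end Pair

end PairSequence

section PairReps

set_option linter.unusedSectionVars false

variable {K : Type} [Field K] {a b : ℕ} [NeZero a] [NeZero b]

theorem liftSh_eq_trunc (hba : b ≤ a) {S U : Type} [AddCommGroup S] [Module K S]
    [AddCommGroup U] [Module K U] {x : Module.End K U} (hx : x ^ b = 0) (T : S →ₗ[K] U)
    (s : Fin a → S) : liftSh a x T s = liftSh b x T (trunc K hba S s) := by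
  refine LinearMap.congr_fun (g := liftSh b x T ∘ₗ trunc K hba S)
    ((isFreeOn_shift a).hom_ext (y := x) (fun u => ?_) (fun u => ?_) fun s => ?_) s
  · exact liftSh_shift a x T (fun s => by rw [pow_zero_of_le hx hba]; rfl) u
  · rw [LinearMap.comp_apply, LinearMap.comp_apply,
      ← liftSh_shift b x T (fun s => by rw [hx]; rfl)]
    rfl
  · rw [liftSh_single0, LinearMap.comp_apply]
    refine (liftSh_single0 b x T s).symm.trans (congrArg (liftSh b x T) ?_)
    funext k
    change Pi.single (M := fun _ => S) 0 s k = Pi.single (M := fun _ => S) 0 s (Fin.castLE hba k)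
    by_cases hk : k = 0
    · subst hk
      rw [show Fin.castLE hba 0 = 0 from rfl, Pi.single_eq_same, Pi.single_eq_same]
    · rw [Pi.single_eq_of_ne hk, Pi.single_eq_of_ne]
      exact fun h0 => hk (Fin.ext (congrArg (fun i : Fin a => (i : ℕ)) h0))

namespace Pair

variable {X X' : Pair K b} {v d : ℕ}

theorem exists_gens (X : Pair K b) : ∃ S : Submodule K X.U, IsCompl S (LinearMap.range X.x) :=
  (Submodule.exists_isCompl _).imp fun _ h => h.symm

/-- A space of generators. -/
def gens (X : Pair K b) : Submodule K X.U := X.exists_gens.choose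

theorem isFreeOn_gens (h : Cyc b X.x) : IsFreeOn b X.x X.gens.subtype :=
  h.isFreeOn X.exists_gens.choose_spec

/-- The map from the free module over `K[X]/(Xᵃ)` on the generators. -/
def cover (X : Pair K b) (a : ℕ) : (Fin a → X.gens) →ₗ[K] X.U := liftSh a X.x X.gens.subtype

theorem cover_shift (hba : b ≤ a) (u : Fin a → X.gens) :
    X.cover a (shift K a _ u) = X.x (X.cover a u) :=
  liftSh_shift a X.x _ (fun s => by rw [pow_zero_of_le X.hx hba]; rfl) u

theorem cover_shift_pow (hba : b ≤ a) (u : Fin a → X.gens) :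
    X.cover a ((shift K a _ ^ b) u) = 0 := by
  rw [comm_pow (cover_shift hba), X.hx]; rfl

theorem cover_surjective (h : Cyc b X.x) (hba : b ≤ a) : Function.Surjective (X.cover a) := by
  intro u
  obtain ⟨s, hs⟩ := (isFreeOn_gens h).2.2 u
  obtain ⟨s', rfl⟩ := trunc_surjective (K := K) hba X.gens s
  exact ⟨s', (liftSh_eq_trunc hba X.hx _ s').trans hs⟩

theorem ker_cover (h : Cyc b X.x) (hba : b ≤ a) (u : Fin a → X.gens) (hu : X.cover a u = 0) :
    ∃ u', u = (shift K a _ ^ b) u' := by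
  refine ker_trunc hba X.gens u ((isFreeOn_gens h).2.1 ?_)
  rw [map_zero, ← liftSh_eq_trunc hba X.hx]
  exact hu

/-- The representation given by the embedding of a pair, loop at the target of the arrow. -/
def repTrue (hba : b ≤ a) (X : Pair K b) : Rep K true a b where
  V := X.U ⧸ X.V
  W := X.Q
  α := 0
  β := X.y
  h := X.j
  rel := ⟨rfl, pow_zero_of_le X.y_pow hba, fun v => by rw [X.y_pow]; rfl⟩

/-- The representation given by a pair, loop at the source of the arrow. -/
def repFalse (hba : b ≤ a) (X : Pair K b) : Rep K false a b where
  V := Fin a → X.gens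
  W := X.U ⧸ X.V
  α := shift K a _
  β := 0
  h := X.V.mkQ ∘ₗ X.cover a
  rel := ⟨rfl, shift_pow_self a, fun v => by
    rw [LinearMap.comp_apply, cover_shift_pow hba, map_zero]⟩

theorem exists_pres_repTrue (hba : b ≤ a) (h : X.Dim v d) :
    ∃ π : (repTrue hba X).Pres, ∀ X', X.Ext0 X' → π.ExtZero (repTrue hba X') := by
  have := h.fin
  let P₀ : Rep K true a b := ⟨X.U ⧸ X.V, Fin b → X.U ⧸ X.V, 0, shift K b _, single0 K b _,
    rfl, pow_zero_of_le (shift_pow_self b) hba, fun v => by rw [shift_pow_self]; rfl⟩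
  let P₁ : Rep K true a b := ⟨PUnit, Fin a → X.gens, 0, shift K a _, 0,
    rfl, shift_pow_self a, fun v => map_zero _⟩
  let f : Rep.Hom P₁ P₀ := ⟨0, X.φ ∘ₗ X.cover a, fun _ => rfl, fun w => by
    rw [LinearMap.comp_apply, cover_shift hba, X.φ_comm]; rfl, fun _ =>
      (map_zero _).trans (map_zero _).symm⟩
  let g : Rep.Hom P₀ (repTrue hba X) := ⟨LinearMap.id, (LinearMap.range X.φ).mkQ, fun _ => rfl,
    fun _ => rfl, fun _ => rfl⟩
  let π : (repTrue hba X).Pres := ⟨P₁, P₀, f, g,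
    (Rep.isFree_true_of_subsingleton (r := P₁) (isFreeOn_shift a)).lifting,
    (Rep.isFree_true (r := P₀) (isFreeOn_shift b)).lifting,
    ⟨Function.surjective_id, Submodule.mkQ_surjective _⟩, fun v => ?_, fun w => ?_,
    inferInstanceAs (FiniteDimensional K PUnit),
    inferInstanceAs (FiniteDimensional K (Fin a → X.gens)),
    inferInstanceAs (FiniteDimensional K (X.U ⧸ X.V)),
    inferInstanceAs (FiniteDimensional K (Fin b → X.U ⧸ X.V))⟩
  · refine ⟨π, fun X' hE hh => ?_⟩
    let hg : (Fin a → X.gens) →ₗ[K] X'.Q := hh.g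
    obtain ⟨l, hl, hls⟩ := (isFreeOn_gens h.cyc).exists_ext X'.y
      (hg ∘ₗ single0 K a X.gens) fun s => by rw [X'.y_pow]; rfl
    have hlc : l ∘ₗ X.cover a = hg := by
      refine (isFreeOn_shift a).hom_ext (y := X'.y) (fun u => ?_) hh.comm_β fun s => ?_
      · rw [LinearMap.comp_apply, cover_shift hba, hl]; rfl
      · exact (congrArg l (liftSh_single0 a X.x _ s)).trans (hls s)
    obtain ⟨κ, hκ⟩ := hE.exists_factor h.cyc l hl
    refine ⟨⟨κ, (LinearMap.range X'.φ).mkQ ∘ₗ κ.compLeft (Fin b), fun v => map_zero κ,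
      fun w => ?_, fun w => ?_⟩, fun v => ?_, fun w => ?_⟩
    · exact congrArg (LinearMap.range X'.φ).mkQ (compLeft_shift b κ w)
    · exact congrArg (LinearMap.range X'.φ).mkQ (compLeft_single0 b κ w)
    · exact (map_zero κ).trans (map_zero hh.f).symm
    · exact (hκ (X.cover a w)).symm.trans (LinearMap.congr_fun hlc w)
  · refine ⟨fun h0 => ⟨0, ?_⟩, fun ⟨u, hu⟩ => ?_⟩
    · exact h0.symm
    · exact hu.symm
  · refine Iff.trans (Submodule.Quotient.mk_eq_zero _) ⟨?_, ?_⟩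
    · rintro ⟨u, rfl⟩
      obtain ⟨s, rfl⟩ := cover_surjective h.cyc hba u
      exact ⟨s, rfl⟩
    · rintro ⟨s, rfl⟩
      exact ⟨X.cover a s, rfl⟩

theorem exists_pres_repFalse (hba : b ≤ a) (h : X.Dim v d) : ∃ π : (repFalse hba X).Pres,
    ∀ X' : Pair K b, Cyc b X'.x → X.Ext0 X' → π.ExtZero (repFalse hba X') := by
  have := h.fin
  let P₀ : Rep K false a b := ⟨Fin a → X.gens, X.U, shift K a _, 0, X.cover a,
    rfl, shift_pow_self a, cover_shift_pow hba⟩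
  let P₁ : Rep K false a b := ⟨PUnit, X.V, 0, 0, 0,
    rfl, zero_pow (NeZero.ne a), fun v => map_zero _⟩
  let f : Rep.Hom P₁ P₀ := ⟨0, X.V.subtype, fun _ => (map_zero (shift K a X.gens)).symm,
    fun w => rfl, fun _ => (map_zero (X.cover a)).symm⟩
  let g : Rep.Hom P₀ (repFalse hba X) := ⟨LinearMap.id, X.V.mkQ, fun _ => rfl,
    fun _ => map_zero X.V.mkQ, fun _ => rfl⟩
  let π : (repFalse hba X).Pres := ⟨P₁, P₀, f, g,
    (Rep.isFree_false_of_subsingleton (r := P₁)).lifting,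
    (Rep.isFree_false (r := P₀) (isFreeOn_shift a) (cover_surjective h.cyc hba)
      (ker_cover h.cyc hba)).lifting,
    ⟨Function.surjective_id, Submodule.mkQ_surjective _⟩, fun v => ?_, fun w => ?_,
    inferInstanceAs (FiniteDimensional K PUnit),
    inferInstanceAs (FiniteDimensional K X.V),
    inferInstanceAs (FiniteDimensional K (Fin a → X.gens)),
    inferInstanceAs (FiniteDimensional K X.U)⟩
  · refine ⟨π, fun X' hX' hE hh => ?_⟩
    let hg : X.V →ₗ[K] X'.U ⧸ X'.V := hh.g
    obtain ⟨θ, hθ⟩ := Module.projective_lifting_property X'.V.mkQ hg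
      (Submodule.mkQ_surjective _)
    obtain ⟨F, hF, hFθ⟩ := hE θ
    obtain ⟨T, hT⟩ := Module.projective_lifting_property (X'.cover a)
      (F ∘ₗ X.cover a ∘ₗ single0 K a X.gens) (cover_surjective hX' hba)
    obtain ⟨G, hG, hGs⟩ := (isFreeOn_shift a).exists_ext (shift K a X'.gens) T fun s => by
      rw [shift_pow_self]; rfl
    have hGF : X'.cover a ∘ₗ G = F ∘ₗ X.cover a := by
      refine (isFreeOn_shift a).hom_ext (y := X'.x) (fun u => ?_) (fun u => ?_) fun s => ?_
      · rw [LinearMap.comp_apply, hG, cover_shift hba]; rfl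
      · rw [LinearMap.comp_apply, cover_shift hba, hF]; rfl
      · rw [LinearMap.comp_apply, hGs]
        exact LinearMap.congr_fun hT s
    refine ⟨⟨G, X'.V.mkQ ∘ₗ F, hG, fun w => ?_, fun w => ?_⟩, fun v => ?_, fun w => ?_⟩
    · exact map_zero (X'.V.mkQ ∘ₗ F)
    · exact congrArg X'.V.mkQ (LinearMap.congr_fun hGF w).symm
    · exact (map_zero G).trans (map_zero hh.f).symm
    · refine Eq.trans ?_ (LinearMap.congr_fun hθ w)
      refine sub_eq_zero.1 ((map_sub X'.V.mkQ _ _).symm.trans ?_)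
      exact mkQ_eq_zero.2 (hFθ w)
  · refine ⟨fun h0 => ⟨0, ?_⟩, fun ⟨u, hu⟩ => ?_⟩
    · exact h0.symm
    · exact hu.symm
  · exact mkQ_eq_zero.trans ⟨fun hw => ⟨⟨w, hw⟩, rfl⟩, fun ⟨u, hu⟩ => hu ▸ u.2⟩

theorem Dim.finrank_quotient (h : X.Dim v d) : Module.finrank K (X.U ⧸ X.V) = b * d - v := by
  have := h.fin
  have h1 := X.V.finrank_quotient_add_finrank
  rw [h.rank_U, h.rank_V] at h1
  omega

theorem Dim.nontrivial_quotient (h : X.Dim v d) (hb : 4 ≤ b) : Nontrivial (X.U ⧸ X.V) := by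
  have := h.fin
  refine Module.nontrivial_of_finrank_pos (R := K) ?_
  rw [h.finrank_quotient]
  have h1 := h.lt
  have h2 : 4 * d ≤ b * d := Nat.mul_le_mul_right d hb
  omega

theorem dim_repTrue (hba : b ≤ a) (h : X.Dim v d) (hE : X.Ext0 X) (hb : 4 ≤ b) :
    (repTrue hba X).dim = (step b (v, d)).1 + b * (step b (v, d)).2 :=
  congrArg₂ (· + ·) h.finrank_quotient (h.next hE hb).rank_U

theorem dim_repFalse (hba : b ≤ a) (h : X.Dim v d) :
    (repFalse hba X).dim = a * d + (step b (v, d)).1 := by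
  have := h.fin
  refine congrArg₂ (· + ·) ?_ h.finrank_quotient
  have h1 := (isFreeOn_gens h.cyc).finrank_eq
  rw [h.rank_U] at h1
  have h2 := Nat.eq_of_mul_eq_mul_left (Nat.pos_of_ne_zero (NeZero.ne b)) h1
  refine (Module.finrank_pi_fintype K).trans ?_
  simp [← h2]

theorem indec_repTrue (hba : b ≤ a) (h : X.Dim v d) (hE : X.Ext0 X) (hb : 4 ≤ b)
    (hI : X.Idem) : (repTrue hba X).Indec := by
  refine ⟨Or.inl (h.nontrivial_quotient hb), fun E h1 h2 => ?_⟩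
  have hj := h.j_injective hE hb
  have hEj : ∀ w, X.j (E.f w) = E.g (X.j w) := fun w => (E.comm_h w).symm
  rcases hI.next h hE hb E.g E.comm_β h2 (by
    rintro _ ⟨w, rfl⟩
    exact ⟨E.f w, hEj w⟩) with h0 | h0
  · exact Or.inl ⟨fun w => hj ((hEj w).trans ((h0 _).trans (map_zero X.j).symm)), h0⟩
  · exact Or.inr ⟨fun w => hj ((hEj w).trans (h0 _)), h0⟩

theorem indec_repFalse (hba : b ≤ a) (h : X.Dim v d) (hb : 4 ≤ b)
    (hI : X.Idem) : (repFalse hba X).Indec := by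
  refine ⟨Or.inr (h.nontrivial_quotient hb), fun E h1 h2 => ?_⟩
  let e : Module.End K (Fin a → X.gens) := E.f
  let k : Module.End K (X.U ⧸ X.V) := E.g
  have he : ∀ u, e (shift K a _ u) = shift K a _ (e u) := E.comm_α
  have he2 : ∀ u, e (e u) = e u := h1
  have hk : ∀ u, k (X.V.mkQ (X.cover a u)) = X.V.mkQ (X.cover a (e u)) := E.comm_h
  have hsurj := cover_surjective h.cyc hba
  obtain ⟨F, hF⟩ := TwoPoint.exists_factor (X.cover a) hsurj (X.cover a ∘ₗ e) fun u hu => by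
    obtain ⟨u', rfl⟩ := ker_cover h.cyc hba u hu
    rw [LinearMap.comp_apply, comm_pow he, cover_shift_pow hba]
  have hmk : ∀ u, X.V.mkQ (F u) = k (X.V.mkQ u) := fun u => by
    obtain ⟨u, rfl⟩ := hsurj u
    rw [hF, hk]; rfl
  have hker : ∀ u, X.cover a u = 0 → ∃ u', u = shift K a _ u' := fun u hu => by
    obtain ⟨u', rfl⟩ := ker_cover h.cyc hba u hu
    refine ⟨(shift K a _ ^ (b - 1)) u', ?_⟩
    rw [← Module.End.mul_apply, ← pow_succ', Nat.sub_add_cancel (by omega)]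
  rcases hI F (fun u => by
      obtain ⟨u, rfl⟩ := hsurj u
      rw [← cover_shift hba, hF, hF, LinearMap.comp_apply, he, cover_shift hba]; rfl)
    (fun u => by
      obtain ⟨u, rfl⟩ := hsurj u
      rw [hF, LinearMap.comp_apply, hF, LinearMap.comp_apply, he2])
    (fun u hu => mkQ_eq_zero.1 (by rw [hmk, mkQ_eq_zero.2 hu, map_zero])) with h0 | h0
  · refine Or.inl ⟨?_, fun w => ?_⟩
    · refine eq_zero_of_comm_nilpotent (shift_pow_self a) he he2 fun u => hker _ ?_
      exact (hF u).symm.trans (h0 _)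
    · obtain ⟨u, rfl⟩ := X.V.mkQ_surjective w
      exact (hmk u).symm.trans ((congrArg X.V.mkQ (h0 u)).trans (map_zero _))
  · refine Or.inr ⟨fun u => ?_, fun w => ?_⟩
    · refine (sub_eq_zero.1 (eq_zero_of_comm_nilpotent (E := 1 - e) (shift_pow_self a)
        (fun u => ?_) (fun u => ?_) (fun u => hker _ ?_) u)).symm
      · rw [LinearMap.sub_apply, LinearMap.sub_apply, he, map_sub]; rfl
      · simp only [LinearMap.sub_apply, Module.End.one_apply, map_sub, he2]
        abel
      · rw [LinearMap.sub_apply, map_sub, sub_eq_zero]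
        exact (h0 _).symm.trans (hF u)
    · obtain ⟨u, rfl⟩ := X.V.mkQ_surjective w
      refine (hmk u).symm.trans ?_
      rw [h0]

end Pair

theorem Presented.not_isTauTiltingFinite {Λ : Type} [Ring Λ] [Algebra K Λ] {t : Bool}
    (p : Presented K Λ t a b) (hba : b ≤ a) (hb : 4 ≤ b) : ¬ IsTauTiltingFinite Λ := by
  obtain ⟨X, Y, P, Q, h⟩ := Pair.exists_good (K := K) hb
  have hg := fun n => (h n).1
  have hb0 : 0 < b := by omega
  have ha0 : 0 < a := by omega
  cases t with
  | true =>
    choose π hπ using fun n => Pair.exists_pres_repTrue hba (hg n).dim_left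
    choose ρ hρ using fun n => Pair.exists_pres_repTrue hba (hg n).dim_right
    have hX : ∀ n, (Pair.repTrue hba (X n)).dim = (P (n + 1)).1 + b * (P (n + 1)).2 := fun n => by
      rw [Pair.dim_repTrue hba (hg n).dim_left (hg n).ext_left hb, (h n).2.1]
    have hY : ∀ n, (Pair.repTrue hba (Y n)).dim = (Q (n + 1)).1 + b * (Q (n + 1)).2 := fun n => by
      rw [Pair.dim_repTrue hba (hg n).dim_right (hg n).ext_right hb, (h n).2.2.1]
    refine p.not_isTauTiltingFinite_of_family hba (fun n => (X n).repTrue hba)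
      (fun n => (Y n).repTrue hba) π ρ (fun n => hπ n _ (hg n).ext_left)
      (fun n => hπ n _ (hg n).ext_left_right) (fun n => hρ n _ (hg n).ext_right_left)
      (fun n => hρ n _ (hg n).ext_right)
      (fun n => Pair.indec_repTrue hba (hg n).dim_left (hg n).ext_left hb (hg n).idem_left)
      (fun n => Pair.indec_repTrue hba (hg n).dim_right (hg n).ext_right hb (hg n).idem_right)
      (fun n => ?_) (strictMono_nat_of_lt_succ fun n => ?_)
    · rw [hX, hY]
      obtain ⟨-, -, -, h1, h2, -⟩ := h (n + 1)
      have := Nat.mul_lt_mul_of_pos_left h2 hb0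
      omega
    · simp only [hX, hY]
      obtain ⟨-, -, -, -, -, h1, h2, h3, h4⟩ := h (n + 1)
      have := Nat.mul_lt_mul_of_pos_left h2 hb0
      have := Nat.mul_lt_mul_of_pos_left h4 hb0
      omega
  | false =>
    choose π hπ using fun n => Pair.exists_pres_repFalse hba (hg n).dim_left
    choose ρ hρ using fun n => Pair.exists_pres_repFalse hba (hg n).dim_right
    have hX : ∀ n, (Pair.repFalse hba (X n)).dim = a * (P n).2 + (P (n + 1)).1 := fun n => by
      rw [Pair.dim_repFalse hba (hg n).dim_left, (h n).2.1]
    have hY : ∀ n, (Pair.repFalse hba (Y n)).dim = a * (Q n).2 + (Q (n + 1)).1 := fun n => by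
      rw [Pair.dim_repFalse hba (hg n).dim_right, (h n).2.2.1]
    refine p.not_isTauTiltingFinite_of_family hba (fun n => (X n).repFalse hba)
      (fun n => (Y n).repFalse hba) π ρ (fun n => hπ n _ (hg n).dim_left.cyc (hg n).ext_left)
      (fun n => hπ n _ (hg n).dim_right.cyc (hg n).ext_left_right)
      (fun n => hρ n _ (hg n).dim_left.cyc (hg n).ext_right_left)
      (fun n => hρ n _ (hg n).dim_right.cyc (hg n).ext_right)
      (fun n => Pair.indec_repFalse hba (hg n).dim_left hb (hg n).idem_left)
      (fun n => Pair.indec_repFalse hba (hg n).dim_right hb (hg n).idem_right)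
      (fun n => ?_) (strictMono_nat_of_lt_succ fun n => ?_)
    · rw [hX, hY]
      obtain ⟨-, -, -, -, h2, -⟩ := h n
      obtain ⟨-, -, -, h1, -⟩ := h (n + 1)
      have := Nat.mul_lt_mul_of_pos_left h2 ha0
      omega
    · simp only [hX, hY]
      obtain ⟨-, -, -, -, -, -, h2, -, h4⟩ := h n
      obtain ⟨-, -, -, -, -, h1, -, h3, -⟩ := h (n + 1)
      have := Nat.mul_lt_mul_of_pos_left h2 ha0
      have := Nat.mul_lt_mul_of_pos_left h4 ha0
      omega

end PairReps

section NormalForms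

variable {K : Type} [Field K] {U : Type} [AddCommGroup U] [Module K U]

theorem Cyc.isFreeOn_of_linearMap {n : ℕ} [NeZero n] {x : Module.End K U} (hx : Cyc n x) {S : Type}
    [AddCommGroup S] [Module K S] {T : S →ₗ[K] U} (hinj : ∀ s w, T s = x w → s = 0)
    (hsurj : ∀ u, ∃ s w, u = T s + x w) : IsFreeOn n x T := by
  have hS : IsCompl (LinearMap.range T) (LinearMap.range x) := by
    refine ⟨Submodule.disjoint_def.2 ?_, codisjoint_iff.2 (eq_top_iff.2 fun u _ => ?_)⟩
    · rintro _ ⟨s, rfl⟩ ⟨w, hw⟩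
      rw [hinj s w hw.symm, map_zero]
    · obtain ⟨s, w, rfl⟩ := hsurj u
      exact Submodule.add_mem_sup ⟨s, rfl⟩ ⟨w, rfl⟩
  have hT : Function.Injective T := (injective_iff_map_eq_zero T).2 fun s hs =>
    hinj s 0 (by rw [hs, map_zero])
  have h := (hx.isFreeOn hS).2.comp
    (LinearEquiv.piCongrRight (R := K) fun _ : Fin n => LinearEquiv.ofInjective T hT).bijective
  have h2 : ⇑(liftSh n x T) = ⇑(liftSh n x (LinearMap.range T).subtype) ∘
      (LinearEquiv.piCongrRight (R := K) fun _ : Fin n => LinearEquiv.ofInjective T hT) :=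
    funext fun s => by
      rw [Function.comp_apply, liftSh_apply, liftSh_apply]
      rfl
  exact ⟨hx.1, h2 ▸ h⟩

variable {S' S'' : Type} [AddCommGroup S'] [Module K S'] [AddCommGroup S''] [Module K S'']

/-- A description of a subspace of a free module over `K[X]/(Xᵃ)` in terms of generators. -/
structure NF (a b k : ℕ) (x : Module.End K U) (D : Submodule K U) (T : S' × S'' →ₗ[K] U)
    (M : S' →ₗ[K] S'') : Prop where
  free : IsFreeOn a x T
  mem : ∀ d, d ∈ D ↔ ∃ (p : ℕ → S' × S'') (q : S') (u : U),
    d = ∑ i ∈ Finset.range k, (x ^ i) (T (p i)) +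
      ((x ^ k) (T (q, 0)) + (x ^ (k + 1)) (T (0, M q))) + (x ^ b) u

/-- A map from a subspace of `U` induces an equivariant endomorphism up to the subspace. -/
def RigidPair (b : ℕ) (x : Module.End K U) (D : Submodule K U) : Prop :=
  ∀ θ : D →ₗ[K] U ⧸ D, (∀ d : D, (d : U) ∈ LinearMap.range (x ^ b) → θ d = 0) →
    ∃ F : Module.End K U, (∀ u, F (x u) = x (F u)) ∧ ∀ d : D, D.mkQ (F d) = θ d

/-- Idempotent equivariant endomorphisms preserving the subspace are trivial. -/
def IdemPair (x : Module.End K U) (D : Submodule K U) : Prop :=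
  ∀ E : Module.End K U, (∀ u, E (x u) = x (E u)) → (∀ u, E (E u) = E u) →
    (∀ d ∈ D, E d ∈ D) → (∀ u, E u = 0) ∨ ∀ u, E u = u

theorem RigidPair.dichotomy {b : ℕ} {x : Module.End K U} {D : Submodule K U}
    (h : RigidPair b x D) {k : ℕ} {w : U} (hw : (x ^ k) w ∈ D)
    (hw' : (x ^ k) w ∉ LinearMap.range (x ^ b)) (u : U) : ∃ d ∈ D, ∃ w, u = d + (x ^ k) w := by
  let R := (LinearMap.range (x ^ b)).comap D.subtype
  let d : D := ⟨_, hw⟩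
  have hd : R.mkQ d ≠ 0 := fun h0 => hw' ((Submodule.Quotient.mk_eq_zero R).1 h0)
  obtain ⟨θ, hθ⟩ := exists_extend_eq (K := K) hd (D.mkQ u)
  obtain ⟨F, hF, hFθ⟩ := h (θ ∘ₗ R.mkQ) fun d hd => by
    have h0 : R.mkQ d = 0 := (Submodule.Quotient.mk_eq_zero R).2 hd
    rw [LinearMap.comp_apply, h0, map_zero]
  have h1 := (hFθ d).trans hθ
  rw [← sub_eq_zero, ← map_sub] at h1
  have h2 := (Submodule.Quotient.mk_eq_zero D).1 h1
  refine ⟨_, D.neg_mem h2, F w, ?_⟩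
  rw [← comm_pow hF]
  change u = -(F ((x ^ k) w) - u) + F ((x ^ k) w)
  abel

theorem RigidPair.exists_index {b : ℕ} {x : Module.End K U} {D : Submodule K U}
    (h : RigidPair b x D) (hb : 1 ≤ b) : ∃ k ≤ b - 1, (∀ u, ∃ d ∈ D, ∃ w, u = d + (x ^ k) w) ∧
      ∀ w, (x ^ (k + 1)) w ∈ D → (x ^ (k + 1)) w ∈ LinearMap.range (x ^ b) := by
  classical
  let P : ℕ → Prop := fun k => ∀ u, ∃ d ∈ D, ∃ w, u = d + (x ^ k) w
  have h0 : P 0 := fun u => ⟨0, D.zero_mem, u, by simp⟩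
  refine ⟨Nat.findGreatest P (b - 1), Nat.findGreatest_le _,
    Nat.findGreatest_spec (Nat.zero_le _) h0, fun w hw => ?_⟩
  rcases (Nat.findGreatest_le (P := P) (b - 1)).lt_or_eq with hlt | heq
  · by_contra hcon
    exact Nat.findGreatest_is_greatest (Nat.lt_succ_self _) hlt (h.dichotomy hw hcon)
  · rw [heq, Nat.sub_add_cancel hb]
    exact ⟨w, rfl⟩

theorem exists_section {V W : Type} [AddCommGroup V] [Module K V] [AddCommGroup W] [Module K W]
    (ρ : V →ₗ[K] W) : ∃ σ : LinearMap.range ρ →ₗ[K] V, ∀ w, ρ (σ w) = w := by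
  obtain ⟨σ, hσ⟩ := ρ.rangeRestrict.exists_rightInverse_of_surjective
    (LinearMap.range_eq_top.2 ρ.surjective_rangeRestrict)
  exact ⟨σ, fun w => congrArg Subtype.val (LinearMap.congr_fun hσ w)⟩

theorem exists_expansion {S : Type} {x : Module.End K U} {T : S → U}
    (hT : ∀ u, ∃ s w, u = T s + x w) (k : ℕ) (u : U) :
    ∃ (p : ℕ → S) (w : U), u = ∑ i ∈ Finset.range k, (x ^ i) (T (p i)) + (x ^ k) w := by
  induction k with
  | zero => exact ⟨fun _ => (hT u).choose, u, by simp⟩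
  | succ k ih =>
    obtain ⟨p, w, hw⟩ := ih
    obtain ⟨s, w', rfl⟩ := hT w
    refine ⟨Function.update p k s, w', ?_⟩
    rw [Finset.sum_range_succ, Function.update_self, pow_succ, Module.End.mul_apply, add_assoc,
      ← map_add, hw]
    congr 1
    refine Finset.sum_congr rfl fun i hi => ?_
    rw [Function.update_of_ne (Finset.mem_range.1 hi).ne]

theorem exists_nf_of_index {a b k : ℕ} [NeZero a] {x : Module.End K U} {D C : Submodule K U}
    (hx : Cyc a x) (hxD : ∀ u, (x ^ b) u ∈ D) (hC : ∀ c ∈ C, ∀ i < k, (x ^ i) c ∈ D)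
    (hCx : ∀ u, ∃ c ∈ C, ∃ w, u = c + x w)
    (h3 : ∀ w, (x ^ (k + 1)) w ∈ D → (x ^ (k + 1)) w ∈ LinearMap.range (x ^ b))
    (h2 : ∀ S : Submodule K U, S ≤ C →
      (∀ u, ∃ s ∈ S, ∃ w, (x ^ k) (u - s) + (x ^ (k + 1)) w ∈ D) →
      ∀ u, (∃ w, (x ^ k) u + (x ^ (k + 1)) w ∈ D) →
        ∃ c ∈ C, (∃ w, c = u + x w) ∧ ∃ s ∈ S, (x ^ k) c + (x ^ (k + 1)) s ∈ D) :
    ∃ (S' S'' : Type) (_ : AddCommGroup S') (_ : Module K S') (_ : AddCommGroup S'')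
      (_ : Module K S'') (T : S' × S'' →ₗ[K] U) (M : S' →ₗ[K] S''), NF a b k x D T M := by
  let D' : Submodule K U := (D ⊔ LinearMap.range (x ^ (k + 1))).comap (x ^ k)
  have memD' : ∀ u, u ∈ D' ↔ ∃ w, (x ^ k) u + (x ^ (k + 1)) w ∈ D := fun u => by
    rw [Submodule.mem_comap, Submodule.mem_sup]
    constructor
    · rintro ⟨d, hd, _, ⟨w, rfl⟩, h⟩
      refine ⟨-w, ?_⟩
      rwa [← h, map_neg, add_neg_cancel_right]
    · rintro ⟨w, hw⟩
      exact ⟨_, hw, _, ⟨-w, rfl⟩, by rw [map_neg, add_neg_cancel_right]⟩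
  have hxD' : ∀ w, x w ∈ D' := fun w => (memD' _).2 ⟨-w, by
    rw [map_neg, pow_succ, Module.End.mul_apply, add_neg_cancel]
    exact D.zero_mem⟩
  obtain ⟨S₀, hS₀⟩ := Submodule.exists_isCompl (D'.comap C.subtype)
  let S := S₀.map C.subtype
  have hSC : S ≤ C := by
    rintro _ ⟨s, -, rfl⟩
    exact s.2
  have hSD : ∀ s ∈ S, s ∈ D' → s = 0 := by
    rintro _ ⟨s, hs, rfl⟩ h
    exact congrArg Subtype.val (Submodule.disjoint_def.1 hS₀.disjoint s h hs)
  have hSU : ∀ u, ∃ s ∈ S, u - s ∈ D' := fun u => by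
    obtain ⟨c, hc, w, rfl⟩ := hCx u
    have hc' : (⟨c, hc⟩ : C) ∈ D'.comap C.subtype ⊔ S₀ := by rw [hS₀.sup_eq_top]; trivial
    obtain ⟨e, he, s, hs, hes⟩ := Submodule.mem_sup.1 hc'
    refine ⟨s, ⟨s, hs, rfl⟩, ?_⟩
    have h1 : c = e + s := (congrArg Subtype.val hes).symm
    rw [h1, show (e : U) + s + x w - s = e + x w by abel]
    exact D'.add_mem he (hxD' w)
  let P : Submodule K (U × S) := (C.comap (LinearMap.fst K U S)) ⊓
    D.comap ((x ^ k).coprod ((x ^ (k + 1)) ∘ₗ S.subtype))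
  let X := LinearMap.range x
  let ρ : P →ₗ[K] U ⧸ X := X.mkQ ∘ₗ LinearMap.fst K U S ∘ₗ P.subtype
  obtain ⟨σ, hσ⟩ := exists_section ρ
  let T' : LinearMap.range ρ →ₗ[K] U := LinearMap.fst K U S ∘ₗ P.subtype ∘ₗ σ
  let M : LinearMap.range ρ →ₗ[K] S := LinearMap.snd K U S ∘ₗ P.subtype ∘ₗ σ
  let T : LinearMap.range ρ × S →ₗ[K] U := T'.coprod S.subtype
  have hT : ∀ s t, T (s, t) = T' s + t := fun s t => rfl
  have hT'C : ∀ s, T' s ∈ C := fun s => (σ s).2.1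
  have hT'D : ∀ s, (x ^ k) (T' s) + (x ^ (k + 1)) (M s) ∈ D := fun s => (σ s).2.2
  have hTD₂ : ∀ s, T' s ∈ D' := fun s => (memD' _).2 ⟨_, hT'D s⟩
  have hT'ρ : ∀ s, X.mkQ (T' s) = s := hσ
  have hρ : ∀ u ∈ D', ∃ s w, u = T' s + x w := fun u hu => by
    obtain ⟨c, hc, ⟨w, rfl⟩, s, hs, hcs⟩ := h2 S hSC
      (fun u => (hSU u).imp fun s h => ⟨h.1, (memD' _).1 h.2⟩) u ((memD' u).1 hu)
    let e : LinearMap.range ρ := ⟨_, ⟨⟨(u + x w, ⟨s, hs⟩), hc, hcs⟩, rfl⟩⟩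
    have he : X.mkQ (T' e) = X.mkQ (u + x w) := hT'ρ e
    rw [eq_comm, ← sub_eq_zero, ← map_sub] at he
    obtain ⟨w', hw'⟩ := (Submodule.Quotient.mk_eq_zero X).1 he
    refine ⟨e, w' - w, ?_⟩
    rw [map_sub, hw']
    abel
  have hTsurj : ∀ u, ∃ s w, u = T s + x w := fun u => by
    obtain ⟨t, ht, hut⟩ := hSU u
    obtain ⟨s, w, h⟩ := hρ _ hut
    refine ⟨(s, ⟨t, ht⟩), w, ?_⟩
    rw [hT, add_right_comm, ← h]
    exact (sub_add_cancel _ _).symm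
  have hTC : ∀ s, T s ∈ C := fun ⟨s, t⟩ => C.add_mem (hT'C s) (hSC t.2)
  have hTD' : ∀ s t, T (s, t) ∈ D' → t = 0 := fun s t h => Subtype.ext (hSD t t.2 (by
    have h1 := D'.sub_mem h (hTD₂ s)
    rwa [hT, add_sub_cancel_left] at h1))
  refine ⟨LinearMap.range ρ, S, inferInstance, inferInstance, inferInstance, inferInstance, T, M,
    hx.isFreeOn_of_linearMap ?_ hTsurj, fun d => ⟨fun hd => ?_, ?_⟩⟩
  · rintro ⟨s, t⟩ w h
    obtain rfl := hTD' s t (h ▸ hxD' w)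
    refine Prod.ext (Subtype.ext ?_) rfl
    rw [← hT'ρ s]
    refine (Submodule.Quotient.mk_eq_zero X).2 ⟨w, ?_⟩
    rw [← h, hT]
    exact add_zero _
  · obtain ⟨p, w, rfl⟩ := exists_expansion hTsurj k d
    have hsum : ∑ i ∈ Finset.range k, (x ^ i) (T (p i)) ∈ D :=
      D.sum_mem fun i hi => hC _ (hTC _) i (Finset.mem_range.1 hi)
    have hw := (D.add_mem_iff_right hsum).1 hd
    have hwD' : w ∈ D' := (memD' w).2 ⟨0, by rwa [map_zero, add_zero]⟩
    obtain ⟨s, w', rfl⟩ := hρ w hwD'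
    obtain ⟨u, hu⟩ := h3 (w' - M s) (by
      have h1 := D.sub_mem hw (hT'D s)
      rw [map_add, ← Module.End.mul_apply, ← pow_succ] at h1
      rwa [map_sub, show (x ^ (k + 1)) w' - (x ^ (k + 1)) (M s) = (x ^ k) (T' s) +
        (x ^ (k + 1)) w' - ((x ^ k) (T' s) + (x ^ (k + 1)) (M s)) by abel])
    refine ⟨p, s, u, ?_⟩
    rw [hu, map_sub, hT, hT, map_zero, zero_add, add_assoc, map_add (x ^ k) (T' s) (x w'),
      ← Module.End.mul_apply, ← pow_succ]
    congr 1
    rw [show T' s + ((0 : S) : U) = T' s from add_zero _]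
    abel
  · rintro ⟨p, q, u, rfl⟩
    refine D.add_mem (D.add_mem (D.sum_mem fun i hi => hC _ (hTC _) i (Finset.mem_range.1 hi)) ?_)
      (hxD u)
    rw [hT, hT, map_zero, zero_add, show T' q + ((0 : S) : U) = T' q from add_zero _]
    exact hT'D q

theorem RigidPair.exists_nf {a b : ℕ} [NeZero a] {x : Module.End K U} {D : Submodule K U}
    (h : RigidPair b x D) (hb : 1 ≤ b) (hb3 : b ≤ 3) (hx : Cyc a x) (hxD : ∀ u, (x ^ b) u ∈ D) :
    ∃ k < 3, ∃ (S' S'' : Type) (_ : AddCommGroup S') (_ : Module K S') (_ : AddCommGroup S'')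
      (_ : Module K S'') (T : S' × S'' →ₗ[K] U) (M : S' →ₗ[K] S''), NF a b k x D T M := by
  obtain ⟨k, hk, h1, h3⟩ := h.exists_index hb
  refine ⟨k, by omega, ?_⟩
  have hx3 : ∀ u, (x ^ 3) u ∈ D := fun u => by
    rw [show 3 = b + (3 - b) by omega, pow_add, Module.End.mul_apply]
    exact hxD _
  replace hx3 : ∀ u, x (x (x u)) ∈ D := hx3
  have hk3 : k < 3 := by omega
  interval_cases k
  · refine exists_nf_of_index (C := ⊤) hx hxD (fun _ _ i hi => absurd hi (Nat.not_lt_zero i))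
      (fun u => ⟨u, trivial, 0, by simp⟩) h3 fun S _ _ u ⟨w, hw⟩ =>
        ⟨u + x w, trivial, ⟨w, rfl⟩, 0, S.zero_mem, ?_⟩
    simpa using hw
  · refine exists_nf_of_index (C := D) hx hxD (fun c hc i hi => ?_)
      (fun u => by simpa using h1 u) h3 fun S hS hSU u ⟨w, hw⟩ => ?_
    · rw [Nat.lt_one_iff.1 hi]; exact hc
    · obtain ⟨c, hc, w₀, rfl⟩ := h1 u
      obtain ⟨s, hs, m, hm⟩ := hSU (w + w₀)
      simp only [pow_succ, pow_zero, one_mul, Module.End.mul_apply] at *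
      refine ⟨_, D.add_mem hc hm, ⟨w + x m - s, ?_⟩, s, hs, ?_⟩
      · simp only [map_add, map_sub]
        abel
      · have h4 := D.add_mem hw (hx3 m)
        simp only [map_add, map_sub] at h4 ⊢
        convert h4 using 1
        abel
  · have hmem : ∀ c, c ∈ D ⊓ D.comap x → ∀ i < 2, (x ^ i) c ∈ D := fun c hc i hi => by
      interval_cases i
      · exact hc.1
      · simpa using hc.2
    have hCx : ∀ u, ∃ c ∈ D ⊓ D.comap x, ∃ w, u = c + x w := fun u => by
      obtain ⟨d, hd, w, rfl⟩ := h1 u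
      obtain ⟨d', hd', w', hxd⟩ := h1 (x d)
      obtain ⟨d₃, hd₃, w₃, hw₃⟩ := h1 (x w')
      simp only [pow_succ, pow_zero, one_mul, Module.End.mul_apply] at hxd hw₃ ⊢
      refine ⟨d - d₃, ⟨D.sub_mem hd hd₃, ?_⟩, x w + w' - x w₃, ?_⟩
      · change x (d - d₃) ∈ D
        rw [show d₃ = x w' - x (x w₃) by rw [hw₃]; abel, map_sub, hxd, map_sub,
          show d' + x (x w') - (x (x w') - x (x (x w₃))) = d' + x (x (x w₃)) by abel]
        exact D.add_mem hd' (hx3 _)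
      · simp only [map_add, map_sub]
        rw [hw₃]
        abel
    refine exists_nf_of_index (C := D ⊓ D.comap x) hx hxD hmem hCx h3
      fun S hS hSU u ⟨w, hw⟩ => ?_
    obtain ⟨c, hc, w₀, rfl⟩ := hCx u
    refine ⟨c, hc, ⟨-w₀, by rw [map_neg]; abel⟩, 0, S.zero_mem, ?_⟩
    simp only [pow_succ, pow_zero, one_mul, Module.End.mul_apply, map_add,
      map_zero, add_zero] at hw ⊢
    have h4 := D.sub_mem (D.sub_mem hw (hx3 w)) (hx3 w₀)
    convert h4 using 1
    abel

end NormalForms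

section NormalFormClassification

variable {K : Type} [Field K] {U U₂ : Type} [AddCommGroup U] [Module K U] [AddCommGroup U₂]
  [Module K U₂] {S' S'' S₂' S₂'' : Type} [AddCommGroup S'] [Module K S'] [AddCommGroup S'']
  [Module K S''] [AddCommGroup S₂'] [Module K S₂'] [AddCommGroup S₂''] [Module K S₂'']
  {a b k : ℕ} [NeZero a] {x : Module.End K U} {x₂ : Module.End K U₂} {D : Submodule K U}
  {D₂ : Submodule K U₂} {T : S' × S'' →ₗ[K] U} {T₂ : S₂' × S₂'' →ₗ[K] U₂} {M : S' →ₗ[K] S''}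
  {M₂ : S₂' →ₗ[K] S₂''}

theorem IsFreeOn.injective {S : Type} [AddCommGroup S] [Module K S] {T : S →ₗ[K] U}
    (h : IsFreeOn a x T) : Function.Injective T := fun s s' hs => by
  rw [← liftSh_single0 a x T s, ← liftSh_single0 a x T s'] at hs
  have h1 := congrArg (fun f => f 0) (h.2.1 hs)
  simpa [single0] using h1

theorem NF.exists_hom (h : NF a b k x D T M) (h₂ : NF a b k x₂ D₂ T₂ M₂) (e' : S' →ₗ[K] S₂')
    (e'' : S'' →ₗ[K] S₂'') (he : ∀ s, M₂ (e' s) = e'' (M s)) :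
    ∃ F : U →ₗ[K] U₂, (∀ u, F (x u) = x₂ (F u)) ∧ (∀ s, F (T s) = T₂ (e' s.1, e'' s.2)) ∧
      ∀ d ∈ D, F d ∈ D₂ := by
  obtain ⟨F, hF, hFT⟩ := h.free.exists_ext x₂ (T₂ ∘ₗ e'.prodMap e'') fun s => by
    rw [h₂.free.1, LinearMap.zero_apply]
  refine ⟨F, hF, hFT, fun d hd => ?_⟩
  obtain ⟨p, q, u, rfl⟩ := (h.mem d).1 hd
  refine (h₂.mem _).2 ⟨fun i => (e' (p i).1, e'' (p i).2), e' q, F u, ?_⟩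
  simp only [map_add, map_sum, comm_pow hF, hFT, he, LinearMap.comp_apply, LinearMap.prodMap_apply,
    map_zero]

theorem NF.exists_equiv (h : NF a b k x D T M) (h₂ : NF a b k x₂ D₂ T₂ M₂) (e' : S' ≃ₗ[K] S₂')
    (e'' : S'' ≃ₗ[K] S₂'') (he : ∀ s, M₂ (e' s) = e'' (M s)) :
    ∃ F : U ≃ₗ[K] U₂, (∀ u, F (x u) = x₂ (F u)) ∧ ∀ d, F d ∈ D₂ ↔ d ∈ D := by
  obtain ⟨F, hF, hFT, hFD⟩ := h.exists_hom h₂ e' e'' he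
  obtain ⟨G, hG, hGT, hGD⟩ := h₂.exists_hom h e'.symm.toLinearMap e''.symm.toLinearMap fun s => by
    apply e''.injective
    simp [← he]
  have h1 : G ∘ₗ F = LinearMap.id := h.free.hom_ext (y := x) (fun u => by simp [hF, hG])
    (fun u => rfl) fun s => by simp [hFT, hGT]
  have h2 : F ∘ₗ G = LinearMap.id := h₂.free.hom_ext (y := x₂) (fun u => by simp [hF, hG])
    (fun u => rfl) fun s => by simp [hFT, hGT]
  refine ⟨LinearEquiv.ofLinearMap F G h2 h1, hF, fun d => ⟨fun hd => ?_, hFD d⟩⟩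
  have h3 := hGD _ hd
  rwa [show G (LinearEquiv.ofLinearMap F G h2 h1 d) = d from LinearMap.congr_fun h1 d] at h3

theorem NF.idem (h : NF a b k x D T M) (hD : IdemPair x D) (e' : Module.End K S')
    (e'' : Module.End K S'') (he : ∀ s, M (e' s) = e'' (M s)) (h' : ∀ s, e' (e' s) = e' s)
    (h'' : ∀ s, e'' (e'' s) = e'' s) :
    ((∀ s, e' s = 0) ∧ ∀ s, e'' s = 0) ∨ ((∀ s, e' s = s) ∧ ∀ s, e'' s = s) := by
  obtain ⟨F, hF, hFT, hFD⟩ := h.exists_hom h e' e'' he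
  have h1 : F ∘ₗ F = F := h.free.hom_ext (y := x) (fun u => by simp [hF]) hF
    fun s => by simp [hFT, h', h'']
  have hT := h.free.injective
  rcases hD F hF (LinearMap.congr_fun h1) hFD with h0 | h0
  · have key : ∀ s : S' × S'', (e' s.1, e'' s.2) = (0 : S' × S'') := fun s => hT (by
      rw [← hFT, h0, map_zero])
    exact .inl ⟨fun s => congrArg Prod.fst (key (s, 0)), fun s => congrArg Prod.snd (key (0, s))⟩
  · have key : ∀ s : S' × S'', (e' s.1, e'' s.2) = s := fun s => hT (by rw [← hFT, h0])
    exact .inr ⟨fun s => congrArg Prod.fst (key (s, 0)), fun s => congrArg Prod.snd (key (0, s))⟩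

/-- The isomorphism types of indecomposable linear maps. -/
def MapKind : Fin 3 → (S' →ₗ[K] S'') → Prop
  | 0, _ => Subsingleton S'' ∧ Module.finrank K S' = 1
  | 1, _ => Subsingleton S' ∧ Module.finrank K S'' = 1
  | 2, M => Function.Bijective M ∧ Module.finrank K S' = 1

theorem finrank_eq_one_of_idem {S : Type} [AddCommGroup S] [Module K S] (hS : Nontrivial S)
    (h : ∀ e : Module.End K S, (∀ s, e (e s) = e s) → (∀ s, e s = 0) ∨ ∀ s, e s = s) :
    Module.finrank K S = 1 := by
  obtain ⟨s, hs⟩ := exists_ne (0 : S)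
  obtain ⟨f, hf⟩ := exists_extend_eq (K := K) hs (1 : K)
  rcases h (f.smulRight s) fun s' => by simp [hf] with h0 | h0
  · exact absurd (h0 s) (by simp [hf, hs])
  · exact (finrank_eq_one_iff_of_nonzero' s hs).2 fun w => ⟨f w, h0 w⟩

theorem exists_mapKind (M : S' →ₗ[K] S'') (hne : Nontrivial (S' × S''))
    (h : ∀ (e' : Module.End K S') (e'' : Module.End K S''), (∀ s, M (e' s) = e'' (M s)) →
      (∀ s, e' (e' s) = e' s) → (∀ s, e'' (e'' s) = e'' s) →
      ((∀ s, e' s = 0) ∧ ∀ s, e'' s = 0) ∨ ((∀ s, e' s = s) ∧ ∀ s, e'' s = s)) :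
    ∃ i, MapKind i M := by
  by_cases hinj : Function.Injective M
  · by_cases hsurj : Function.Surjective M
    · refine ⟨2, ⟨hinj, hsurj⟩, ?_⟩
      let φ := LinearEquiv.ofBijective M ⟨hinj, hsurj⟩
      have hS' : Nontrivial S' := by
        by_contra hc
        have := not_nontrivial_iff_subsingleton.1 hc
        have : Subsingleton S'' := φ.symm.toEquiv.subsingleton
        exact not_subsingleton (S' × S'') inferInstance
      refine finrank_eq_one_of_idem hS' fun e he => ?_
      refine (h e (φ.toLinearMap ∘ₗ e ∘ₗ φ.symm.toLinearMap) (fun s => ?_) he fun s => ?_).imp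
        And.left And.left
      · change M (e s) = φ (e (φ.symm (φ s)))
        rw [LinearEquiv.symm_apply_apply]
        rfl
      · simp [he]
    · have hlt : LinearMap.range M < ⊤ := lt_top_iff_ne_top.2 fun h0 =>
        hsurj (LinearMap.range_eq_top.1 h0)
      obtain ⟨f, hf0, hf⟩ := Submodule.exists_le_ker_of_lt_top _ hlt
      have hfM : ∀ s, f (M s) = 0 := fun s => hf ⟨s, rfl⟩
      obtain ⟨r, hr⟩ : ∃ r, f r ≠ 0 := by
        by_contra! hc
        exact hf0 (LinearMap.ext hc)
      have hr' : f ((f r)⁻¹ • r) = 1 := by simp [hr]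
      set r' := (f r)⁻¹ • r
      have hr0 : r' ≠ 0 := fun h0 => by simp [h0] at hr'
      rcases h 0 (f.smulRight r') (by simp [hfM]) (by simp) (by simp [hr']) with h0 | h0
      · exact absurd (h0.2 r') (by simp [hr', hr0])
      · exact ⟨1, ⟨fun s s' => by rw [← h0.1 s, ← h0.1 s']; rfl⟩,
          (finrank_eq_one_iff_of_nonzero' r' hr0).2 fun w => ⟨f w, h0.2 w⟩⟩
  · obtain ⟨s, hs, hs0⟩ : ∃ s, M s = 0 ∧ s ≠ 0 := by
      by_contra! hc
      exact hinj ((injective_iff_map_eq_zero M).2 hc)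
    obtain ⟨f, hf⟩ := exists_extend_eq (K := K) hs0 (1 : K)
    rcases h (f.smulRight s) 0 (by simp [hs]) (by simp [hf]) (by simp) with h0 | h0
    · exact absurd (h0.1 s) (by simp [hf, hs0])
    · exact ⟨0, ⟨fun s s' => by rw [← h0.2 s, ← h0.2 s']; rfl⟩,
        (finrank_eq_one_iff_of_nonzero' s hs0).2 fun w => ⟨f w, h0.1 w⟩⟩

theorem nonempty_equiv_of_finrank {S S₂ : Type} [AddCommGroup S] [Module K S] [AddCommGroup S₂]
    [Module K S₂] (h : Module.finrank K S = 1) (h₂ : Module.finrank K S₂ = 1) :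
    Nonempty (S ≃ₗ[K] S₂) := by
  have := Module.finite_of_finrank_eq_succ h
  have := Module.finite_of_finrank_eq_succ h₂
  exact FiniteDimensional.nonempty_linearEquiv_of_finrank_eq (h.trans h₂.symm)

theorem MapKind.exists_equiv : ∀ {i : Fin 3}, MapKind i M → MapKind i M₂ →
    ∃ (e' : S' ≃ₗ[K] S₂') (e'' : S'' ≃ₗ[K] S₂''), ∀ s, M₂ (e' s) = e'' (M s)
  | 0, ⟨h, h1⟩, ⟨h₂, h1₂⟩ => by
    obtain ⟨e⟩ := nonempty_equiv_of_finrank h1 h1₂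
    exact ⟨e, LinearEquiv.ofSubsingleton S'' S₂'', fun s => Subsingleton.elim _ _⟩
  | 1, ⟨h, h1⟩, ⟨h₂, h1₂⟩ => by
    obtain ⟨e⟩ := nonempty_equiv_of_finrank h1 h1₂
    exact ⟨LinearEquiv.ofSubsingleton S' S₂', e, fun s => by
      rw [Subsingleton.elim s 0, map_zero, map_zero, map_zero, map_zero]⟩
  | 2, ⟨h, h1⟩, ⟨h₂, h1₂⟩ => by
    obtain ⟨e⟩ := nonempty_equiv_of_finrank h1 h1₂
    refine ⟨e, (LinearEquiv.ofBijective M h).symm ≪≫ₗ e ≪≫ₗ LinearEquiv.ofBijective M₂ h₂,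
      fun s => ?_⟩
    have h0 : (LinearEquiv.ofBijective M h).symm (M s) = s :=
      (LinearEquiv.ofBijective M h).symm_apply_apply s
    rw [LinearEquiv.trans_apply, LinearEquiv.trans_apply, h0]
    rfl

end NormalFormClassification

section PairLabels

variable {K : Type} [Field K] {U : Type} [AddCommGroup U] [Module K U]

/-- The pair of a nilpotent endomorphism and a subspace has the normal form with index `l.1` and
kind `l.2`. -/
def HasNF (a b : ℕ) (l : Fin 3 × Fin 3) (x : Module.End K U) (D : Submodule K U) : Prop :=
  ∃ (S' S'' : Type) (_ : AddCommGroup S') (_ : Module K S') (_ : AddCommGroup S'')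
    (_ : Module K S'') (T : S' × S'' →ₗ[K] U) (M : S' →ₗ[K] S''),
    NF a b l.1 x D T M ∧ MapKind l.2 M

theorem exists_hasNF {a b : ℕ} [NeZero a] {x : Module.End K U} {D : Submodule K U}
    (h : RigidPair b x D) (hi : IdemPair x D) (hU : Nontrivial U) (hb : 1 ≤ b) (hb3 : b ≤ 3)
    (hx : Cyc a x) (hxD : ∀ u, (x ^ b) u ∈ D) : ∃ l, HasNF a b l x D := by
  obtain ⟨k, hk, S', S'', _, _, _, _, T, M, hT⟩ := h.exists_nf hb hb3 hx hxD
  have hne : Nontrivial (S' × S'') := by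
    by_contra hc
    have := not_nontrivial_iff_subsingleton.1 hc
    have : Subsingleton U := (Equiv.ofBijective _ hT.free.2).symm.subsingleton
    exact not_subsingleton U inferInstance
  obtain ⟨i, hi⟩ := exists_mapKind M hne (hT.idem hi)
  exact ⟨(⟨k, hk⟩, i), S', S'', _, _, _, _, T, M, hT, hi⟩

theorem HasNF.exists_equiv {a b : ℕ} [NeZero a] {l : Fin 3 × Fin 3} {x : Module.End K U}
    {D : Submodule K U} (h : HasNF a b l x D) {U₂ : Type} [AddCommGroup U₂] [Module K U₂]
    {x₂ : Module.End K U₂} {D₂ : Submodule K U₂} (h₂ : HasNF a b l x₂ D₂) :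
    ∃ F : U ≃ₗ[K] U₂, (∀ u, F (x u) = x₂ (F u)) ∧ ∀ d, F d ∈ D₂ ↔ d ∈ D := by
  obtain ⟨_, _, _, _, _, _, T, M, hT, hM⟩ := h
  obtain ⟨_, _, _, _, _, _, T₂, M₂, hT₂, hM₂⟩ := h₂
  obtain ⟨e', e'', he⟩ := hM.exists_equiv hM₂
  exact hT.exists_equiv hT₂ e' e'' he

end PairLabels

section RigidReps

variable {K : Type} [Field K]

theorem IsFreeOn.exists_split {n : ℕ} [NeZero n] {U S : Type} [AddCommGroup U] [Module K U]
    [AddCommGroup S] [Module K S] {x : Module.End K U} {T : S →ₗ[K] U} (h : IsFreeOn n x T) (u : U) :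
    ∃ s w, u = T s + x w := by
  suffices hu : u ∈ LinearMap.range T ⊔ LinearMap.range x by
    obtain ⟨_, ⟨s, rfl⟩, _, ⟨w, rfl⟩, hsw⟩ := Submodule.mem_sup.1 hu
    exact ⟨s, w, hsw.symm⟩
  obtain ⟨s, rfl⟩ := h.2.2 u
  rw [liftSh_apply]
  refine Submodule.sum_mem _ fun k _ => ?_
  rcases hk : (k : ℕ) with _ | j
  · exact Submodule.mem_sup_left ⟨_, rfl⟩
  · rw [pow_succ']
    exact Submodule.mem_sup_right ⟨_, rfl⟩

theorem exists_functional {U Z : Type} [AddCommGroup U] [Module K U] [AddCommGroup Z] [Module K Z]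
    {x : Module.End K U} {N : Submodule K U} (hN : ∀ u ∈ N, x u ∈ N) {u : U} (hu : u ∈ N)
    (hux : ∀ v ∈ N, u ≠ x v) (z : Z) :
    ∃ m : N →ₗ[K] Z, (∀ v (hv : v ∈ N), m ⟨x v, hN v hv⟩ = 0) ∧ m ⟨u, hu⟩ = z := by
  let R := LinearMap.range (x.restrict hN)
  have hd : R.mkQ ⟨u, hu⟩ ≠ 0 := fun h0 => by
    obtain ⟨v, hv⟩ := (Submodule.Quotient.mk_eq_zero R).1 h0
    exact hux v v.2 (congrArg Subtype.val hv).symm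
  obtain ⟨θ, hθ⟩ := exists_extend_eq (K := K) hd z
  refine ⟨θ ∘ₗ R.mkQ, fun v hv => ?_, hθ⟩
  have h0 : R.mkQ ⟨x v, hN v hv⟩ = 0 :=
    (Submodule.Quotient.mk_eq_zero R).2 ⟨⟨v, hv⟩, rfl⟩
  rw [LinearMap.comp_apply, h0, map_zero]

theorem eq_bot_of_nilpotent {U : Type} [AddCommGroup U] [Module K U] {x : Module.End K U} {n : ℕ}
    (hx : x ^ n = 0) {N : Submodule K U} (h : ∀ u ∈ N, ∃ v ∈ N, u = x v) : N = ⊥ := by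
  refine (Submodule.eq_bot_iff N).2 fun u hu => ?_
  have key : ∀ k, ∀ u ∈ N, ∃ v ∈ N, u = (x ^ k) v := by
    intro k
    induction k with
    | zero => exact fun u hu => ⟨u, hu, rfl⟩
    | succ k ih =>
      intro u hu
      obtain ⟨v, hv, rfl⟩ := ih u hu
      obtain ⟨w, hw, rfl⟩ := h v hv
      exact ⟨w, hw, by rw [pow_succ, Module.End.mul_apply]⟩
  obtain ⟨v, -, rfl⟩ := key n u hu
  rw [hx, LinearMap.zero_apply]

variable {t : Bool} {a b : ℕ}

theorem Rep.Hom.α_mem {r s : Rep K t a b} (p : Rep.Hom r s) :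
    ∀ v ∈ LinearMap.ker p.f, r.α v ∈ LinearMap.ker p.f := fun v hv => by
  rw [LinearMap.mem_ker] at hv ⊢
  rw [p.comm_α, hv, map_zero]

theorem Rep.Hom.β_mem {r s : Rep K t a b} (p : Rep.Hom r s) :
    ∀ v ∈ LinearMap.ker p.g, r.β v ∈ LinearMap.ker p.g := fun v hv => by
  rw [LinearMap.mem_ker] at hv ⊢
  rw [p.comm_β, hv, map_zero]

theorem Rep.Hom.h_mem {r s : Rep K t a b} (p : Rep.Hom r s) :
    ∀ v ∈ LinearMap.ker p.f, r.h v ∈ LinearMap.ker p.g := fun v hv => by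
  rw [LinearMap.mem_ker] at hv ⊢
  rw [p.comm_h, hv, map_zero]

/-- The kernel of a morphism of representations. -/
def Rep.Hom.ker {r s : Rep K t a b} (p : Rep.Hom r s) : Rep K t a b where
  V := LinearMap.ker p.f
  W := LinearMap.ker p.g
  α := r.α.restrict p.α_mem
  β := r.β.restrict p.β_mem
  h := r.h.restrict p.h_mem
  rel := by
    have hα := r.rel
    cases t with
    | true =>
      obtain ⟨h1, h2, h3⟩ := hα
      refine ⟨LinearMap.ext fun v => Subtype.ext (LinearMap.congr_fun h1 v), ?_, fun v => ?_⟩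
      · rw [Module.End.pow_restrict]
        exact LinearMap.ext fun w => Subtype.ext (LinearMap.congr_fun h2 w)
      · rw [Module.End.pow_restrict]
        exact Subtype.ext (h3 v)
    | false =>
      obtain ⟨h1, h2, h3⟩ := hα
      refine ⟨LinearMap.ext fun v => Subtype.ext (LinearMap.congr_fun h1 v), ?_, fun v => ?_⟩
      · rw [Module.End.pow_restrict]
        exact LinearMap.ext fun w => Subtype.ext (LinearMap.congr_fun h2 w)
      · rw [Module.End.pow_restrict]
        exact Subtype.ext (h3 v)

theorem Rep.Rigid.extend {N E Y : Rep K t a b} (h : N.Rigid) (hE : E.Lifting) (p : Rep.Hom E N)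
    (hp : p.Surj) (q : Rep.Hom N Y) (hq : q.Surj) (l : Rep.Hom p.ker Y) :
    ∃ L : Rep.Hom E Y, (∀ v (hv : p.f v = 0), L.f v = l.f ⟨v, hv⟩) ∧
      ∀ w (hw : p.g w = 0), L.g w = l.g ⟨w, hw⟩ := by
  let ι : Rep.Hom p.ker E := ⟨(LinearMap.ker p.f).subtype, (LinearMap.ker p.g).subtype,
    fun _ => rfl, fun _ => rfl, fun _ => rfl⟩
  obtain ⟨L, h1, h2⟩ := h p.ker E Y hE ι p q l
    ⟨Subtype.val_injective, Subtype.val_injective⟩ hp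
    (fun v => ⟨fun hv => ⟨⟨v, hv⟩, rfl⟩, fun ⟨o, ho⟩ => ho ▸ o.2⟩)
    (fun v => ⟨fun hv => ⟨⟨v, hv⟩, rfl⟩, fun ⟨o, ho⟩ => ho ▸ o.2⟩) hq
  exact ⟨L, fun v hv => h1 ⟨v, hv⟩, fun w hw => h2 ⟨w, hw⟩⟩

theorem Rep.Rigid.extend_right {N E Y : Rep K t a b} (h : N.Rigid) (hE : E.Lifting)
    (p : Rep.Hom E N) (hp : p.Surj) (hi : Function.Injective p.f) (q : Rep.Hom N Y) (hq : q.Surj)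
    (m : LinearMap.ker p.g →ₗ[K] Y.W)
    (hm : ∀ w (hw : p.g w = 0) (hw' : p.g (E.β w) = 0), m ⟨E.β w, hw'⟩ = Y.β (m ⟨w, hw⟩)) :
    ∃ L : Rep.Hom E Y, ∀ w (hw : p.g w = 0), L.g w = m ⟨w, hw⟩ := by
  obtain ⟨L, -, hL⟩ := h.extend hE p hp q hq ⟨0, m, fun v => (map_zero _).symm,
    fun w => hm w.1 w.2 _, fun v => by
      have h0 : v = 0 := Subtype.ext (hi (v.2.trans (map_zero p.f).symm))
      rw [h0, map_zero, map_zero, map_zero]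
      exact map_zero m⟩
  exact ⟨L, hL⟩

theorem Rep.Rigid.extend_left {N E Y : Rep K t a b} (h : N.Rigid) (hE : E.Lifting)
    (p : Rep.Hom E N) (hp : p.Surj) [Subsingleton Y.W] (q : Rep.Hom N Y) (hq : q.Surj)
    (m : LinearMap.ker p.f →ₗ[K] Y.V)
    (hm : ∀ w (hw : p.f w = 0) (hw' : p.f (E.α w) = 0), m ⟨E.α w, hw'⟩ = Y.α (m ⟨w, hw⟩)) :
    ∃ L : Rep.Hom E Y, ∀ w (hw : p.f w = 0), L.f w = m ⟨w, hw⟩ := by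
  obtain ⟨L, hL, -⟩ := h.extend hE p hp q hq ⟨m, 0, fun w => hm w.1 w.2 _,
    fun _ => Subsingleton.elim _ _, fun _ => Subsingleton.elim _ _⟩
  exact ⟨L, hL⟩

theorem Rep.IsFree.of_bijective {r s : Rep K t a b} {S C : Type} [AddCommGroup S] [Module K S]
    [AddCommGroup C] [Module K C] {T : S →ₗ[K] r.V} {T' : C →ₗ[K] r.W} (h : r.IsFree T T')
    (p : Rep.Hom r s) (hi : p.Inj) (hs : p.Surj) : s.IsFree (p.f ∘ₗ T) (p.g ∘ₗ T') := by
  obtain ⟨h1, h2⟩ := h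
  let ef := LinearEquiv.ofBijective p.f ⟨hi.1, hs.1⟩
  let eg := LinearEquiv.ofBijective p.g ⟨hi.2, hs.2⟩
  have hf : ∀ v, ef.symm (p.f v) = v := ef.symm_apply_apply
  have hg : ∀ v, eg.symm (p.g v) = v := eg.symm_apply_apply
  let p' : Rep.Hom s r := ⟨ef.symm.toLinearMap, eg.symm.toLinearMap, fun v => by
      obtain ⟨v, rfl⟩ := hs.1 v
      change ef.symm _ = r.α (ef.symm _)
      rw [← p.comm_α, hf, hf], fun v => by
      obtain ⟨v, rfl⟩ := hs.2 v
      change eg.symm _ = r.β (eg.symm _)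
      rw [← p.comm_β, hg, hg], fun v => by
      obtain ⟨v, rfl⟩ := hs.1 v
      change eg.symm _ = r.h (ef.symm _)
      rw [← p.comm_h, hf, hg]⟩
  refine ⟨fun A f c => ?_, fun A ψ ψ' hψ hψ' => ?_⟩
  · obtain ⟨ψ, hψ, hψ'⟩ := h1 A f c
    exact ⟨ψ.comp p', fun v => (congrArg ψ.f (hf _)).trans (hψ v),
      fun v => (congrArg ψ.g (hg _)).trans (hψ' v)⟩
  · have h3 := h2 A (ψ.comp p) (ψ'.comp p) hψ hψ'
    refine Rep.Hom.ext' (fun v => ?_) fun w => ?_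
    · obtain ⟨v, rfl⟩ := hs.1 v
      exact congrArg (fun φ => φ.f v) h3
    · obtain ⟨v, rfl⟩ := hs.2 w
      exact congrArg (fun φ => φ.g v) h3

theorem Rep.IsFree.iso {r s : Rep K t a b} {C C₂ : Type} [AddCommGroup C] [Module K C]
    [AddCommGroup C₂] [Module K C₂] {T : C →ₗ[K] r.W} {T₂ : C₂ →ₗ[K] s.W}
    (h : r.IsFree (0 : PUnit →ₗ[K] r.V) T) (h₂ : s.IsFree (0 : PUnit →ₗ[K] s.V) T₂)
    (e : C ≃ₗ[K] C₂) : r.Iso s := by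
  obtain ⟨φ, -, hφ⟩ := h.1 s 0 (T₂ ∘ₗ e.toLinearMap)
  obtain ⟨ψ, -, hψ⟩ := h₂.1 r 0 (T ∘ₗ e.symm.toLinearMap)
  have h3 := h.2 r (ψ.comp φ) ⟨LinearMap.id, LinearMap.id, fun _ => rfl, fun _ => rfl, fun _ => rfl⟩
    (fun _ => by simp) fun c => by
      change ψ.g (φ.g (T c)) = T c
      rw [hφ]
      exact (hψ _).trans (congrArg T (e.symm_apply_apply c))
  have h4 := h₂.2 s (φ.comp ψ) ⟨LinearMap.id, LinearMap.id, fun _ => rfl, fun _ => rfl, fun _ => rfl⟩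
    (fun _ => by simp) fun c => by
      change φ.g (ψ.g (T₂ c)) = T₂ c
      rw [hψ]
      exact (hφ _).trans (congrArg T₂ (e.apply_symm_apply c))
  exact ⟨φ, ⟨Function.LeftInverse.injective (g := ψ.f) fun v => congrArg (fun φ => φ.f v) h3,
      Function.LeftInverse.injective (g := ψ.g) fun v => congrArg (fun φ => φ.g v) h3⟩,
    ⟨Function.RightInverse.surjective (g := ψ.f) fun v => congrArg (fun φ => φ.f v) h4,
      Function.RightInverse.surjective (g := ψ.g) fun v => congrArg (fun φ => φ.g v) h4⟩⟩

end RigidReps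

section Labels

variable {K : Type} [Field K] {t : Bool} {a b : ℕ}

/-- Labels of the isomorphism classes of indecomposable rigid representations. -/
def Rep.HasLabel (r : Rep K t a b) : Option (Option (Fin 3 × Fin 3)) → Prop
  | none => ∃ (C : Type) (_ : AddCommGroup C) (_ : Module K C) (T : C →ₗ[K] r.W),
      Module.finrank K C = 1 ∧ r.IsFree (0 : PUnit →ₗ[K] r.V) T
  | some none => Subsingleton r.W ∧ Module.finrank K r.V = 1 ∧ r.α = 0
  | some (some l) => cond t (Function.Injective r.h ∧ HasNF b b l r.β (LinearMap.range r.h))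
      (Function.Surjective r.h ∧ HasNF a b l r.α (LinearMap.ker r.h))

theorem Rep.HasLabel.iso [NeZero a] [NeZero b] {r s : Rep K t a b} :
    ∀ {l : Option (Option (Fin 3 × Fin 3))}, r.HasLabel l → s.HasLabel l → r.Iso s
  | none, ⟨C, _, _, T, hC, hT⟩, ⟨C₂, _, _, T₂, hC₂, hT₂⟩ => by
    obtain ⟨e⟩ := nonempty_equiv_of_finrank hC hC₂
    exact hT.iso hT₂ e
  | some none, ⟨h1, h2, h3⟩, ⟨h1', h2', h3'⟩ => by
    obtain ⟨e⟩ := nonempty_equiv_of_finrank h2 h2'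
    exact ⟨⟨e.toLinearMap, 0, fun v => by simp [h3, h3'], fun _ => Subsingleton.elim _ _,
      fun _ => Subsingleton.elim _ _⟩, ⟨e.injective, fun _ _ _ => Subsingleton.elim _ _⟩,
      ⟨e.surjective, fun _ => ⟨0, Subsingleton.elim _ _⟩⟩⟩
  | some (some l), hr, hs => by
    cases t with
    | true =>
      obtain ⟨hr, hr'⟩ := hr
      obtain ⟨hs, hs'⟩ := hs
      obtain ⟨F, hF, hFD⟩ := hr'.exists_equiv hs'
      obtain ⟨f, hf⟩ := exists_lift_of_injective s.h hs (F.toLinearMap ∘ₗ r.h) fun v =>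
        (hFD _).2 ⟨v, rfl⟩
      have hf' : ∀ v, s.h (f v) = F (r.h v) := hf
      refine ⟨⟨f, F.toLinearMap, fun v => ?_, hF, fun v => (hf v).symm⟩,
        ⟨fun v v' hv => ?_, F.injective⟩, ⟨fun v => ?_, F.surjective⟩⟩
      · rw [r.rel.1, s.rel.1]
        exact map_zero f
      · have h1 := congrArg s.h (show f v = f v' from hv)
        rw [hf', hf'] at h1
        exact hr (F.injective h1)
      · obtain ⟨w, hw⟩ := F.surjective (s.h v)
        obtain ⟨v', rfl⟩ := (hFD w).1 (hw ▸ ⟨v, rfl⟩)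
        exact ⟨v', hs ((hf' v').trans hw)⟩
    | false =>
      obtain ⟨hr, hr'⟩ := hr
      obtain ⟨hs, hs'⟩ := hs
      obtain ⟨F, hF, hFD⟩ := hr'.exists_equiv hs'
      obtain ⟨g, hg⟩ := exists_factor r.h hr (s.h ∘ₗ F.toLinearMap) fun v hv => (hFD v).2 hv
      have hg' : ∀ v, g (r.h v) = s.h (F v) := hg
      refine ⟨⟨F.toLinearMap, g, hF, fun v => ?_, hg'⟩, ⟨F.injective, ?_⟩, ⟨F.surjective, ?_⟩⟩
      · rw [r.rel.1, s.rel.1]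
        exact map_zero g
      · refine (injective_iff_map_eq_zero g).2 fun w hw => ?_
        obtain ⟨v, rfl⟩ := hr w
        exact (hFD v).1 ((hg' v).symm.trans hw)
      · intro w
        obtain ⟨v, rfl⟩ := hs w
        obtain ⟨u, rfl⟩ := F.surjective v
        exact ⟨_, hg' u⟩

end Labels

section RigidTrue

variable {K : Type} [Field K] {a b : ℕ}

theorem Rep.Indec.label_of_not_injective {r : Rep K true a b} (hi : r.Indec)
    (h : ¬ Function.Injective r.h) : r.HasLabel (some none) := by
  obtain ⟨v, hv, hv0⟩ : ∃ v, r.h v = 0 ∧ v ≠ 0 := by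
    by_contra! hc
    exact h ((injective_iff_map_eq_zero r.h).2 hc)
  obtain ⟨f, hf⟩ := exists_extend_eq (K := K) hv0 (1 : K)
  have hα : r.α = 0 := r.rel.1
  rcases hi.2 ⟨f.smulRight v, 0, fun v => by simp [hα], fun w => by simp,
    fun w => by simp [hv]⟩ (fun w => by simp [hf]) (fun w => by simp) with h0 | h0
  · exact absurd (h0.1 v) (by simp [hf, hv0])
  · exact ⟨⟨fun w w' => by rw [← h0.2 w, ← h0.2 w']; rfl⟩,
      (finrank_eq_one_iff_of_nonzero' v hv0).2 fun w => ⟨f w, h0.1 w⟩, hα⟩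

theorem exists_freeTrue [NeZero a] [NeZero b] (hba : b ≤ a) (V S : Type) [AddCommGroup V]
    [Module K V] [AddCommGroup S] [Module K S] :
    ∃ (E : Rep K true a b) (T : V →ₗ[K] E.V) (T' : S →ₗ[K] E.W), E.IsFree T T' ∧
      Function.Bijective T ∧ ∀ m, ∃ v s m', m = E.h (T v) + T' s + E.β m' := by
  refine ⟨freeTrue hba V S, LinearMap.id, _, isFree_freeTrue hba V S, Function.bijective_id, ?_⟩
  rintro ⟨m₁, m₂⟩
  obtain ⟨v, w, rfl⟩ := (isFreeOn_shift (K := K) (S := V) b).exists_split m₁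
  obtain ⟨s, w', rfl⟩ := (isFreeOn_shift (K := K) (S := S) a).exists_split m₂
  refine ⟨v, s, (w, w'), Prod.ext ?_ ?_⟩
  · change _ = single0 K b V v + 0 + shift K b V w
    rw [add_zero]
  · change _ = 0 + single0 K a S s + shift K a S w'
    rw [zero_add]

theorem Rep.Rigid.isFree_of_isCompl [NeZero a] [NeZero b] (hba : b ≤ a) {r : Rep K true a b} (h : r.Rigid)
    {S : Submodule K r.W} (hS : IsCompl S (LinearMap.range r.h ⊔ LinearMap.range r.β))
    (hne : S ≠ ⊥) : r.IsFree (LinearMap.id : r.V →ₗ[K] r.V) S.subtype := by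
  obtain ⟨E, T, T', hE, hTb, hsplit⟩ := exists_freeTrue (K := K) hba r.V S
  obtain ⟨p, hp, hp'⟩ := hE.1 r LinearMap.id S.subtype
  have hpi : Function.Injective p.f := fun v v' hv => by
    obtain ⟨v, rfl⟩ := hTb.2 v
    obtain ⟨v', rfl⟩ := hTb.2 v'
    rw [hp, hp] at hv
    exact congrArg T hv
  have hβ : r.β ^ a = 0 := r.rel.2.1
  have hps : p.Surj := by
    refine ⟨fun v => ⟨T v, hp v⟩, fun w => ?_⟩
    have hT : ∀ u, ∃ (s : r.V × S) (w : r.W), u = (r.h s.1 + (s.2 : r.W)) + r.β w := fun u => by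
      have hu : u ∈ S ⊔ (LinearMap.range r.h ⊔ LinearMap.range r.β) := by
        rw [hS.sup_eq_top]
        trivial
      obtain ⟨s, hs, y, hy, rfl⟩ := Submodule.mem_sup.1 hu
      obtain ⟨_, ⟨v, rfl⟩, _, ⟨w, rfl⟩, rfl⟩ := Submodule.mem_sup.1 hy
      exact ⟨(v, ⟨s, hs⟩), w, by simp only; abel⟩
    obtain ⟨q, w', rfl⟩ := exists_expansion hT a w
    rw [hβ, LinearMap.zero_apply, add_zero]
    refine Submodule.sum_mem (LinearMap.range p.g) fun i _ => ⟨(E.β ^ i) (E.h (T (q i).1) +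
      T' (q i).2), ?_⟩
    rw [comm_pow p.comm_β, map_add, p.comm_h, hp, hp']
    rfl
  obtain ⟨s₀, hs₀, hs₀'⟩ := (Submodule.ne_bot_iff S).1 hne
  have hker : LinearMap.ker p.g = ⊥ := by
    refine eq_bot_of_nilpotent (x := E.β) (n := a) E.rel.2.1 fun u hu => ?_
    by_contra hc
    push Not at hc
    obtain ⟨m, hm, hmu⟩ := exists_functional p.β_mem hu (fun v hv => hc v hv) (1 : K)
    let B := LinearMap.range r.h ⊔ LinearMap.range r.β
    have hd : B.mkQ s₀ ≠ 0 := fun h0 =>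
      hs₀' (Submodule.disjoint_def.1 hS.disjoint s₀ hs₀ ((Submodule.Quotient.mk_eq_zero B).1 h0))
    obtain ⟨θ, hθ⟩ := exists_extend_eq (K := K) hd (1 : K)
    have hB : ∀ w ∈ B, θ (B.mkQ w) = 0 := fun w hw => by
      have h0 : B.mkQ w = 0 := (Submodule.Quotient.mk_eq_zero B).2 hw
      rw [h0, map_zero]
    let Y : Rep K true a b := ⟨PUnit, K, 0, 0, 0, rfl, zero_pow (NeZero.ne a), fun _ => map_zero _⟩
    let q : Rep.Hom r Y := ⟨0, θ ∘ₗ B.mkQ, fun _ => rfl,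
      fun w => hB _ (Submodule.mem_sup_right ⟨w, rfl⟩),
      fun w => hB _ (Submodule.mem_sup_left ⟨w, rfl⟩)⟩
    have hq : q.Surj := ⟨fun v => ⟨0, rfl⟩, fun c => ⟨c • s₀, by
      change θ (B.mkQ (c • s₀)) = c
      rw [map_smul, map_smul, hθ, smul_eq_mul, mul_one]⟩⟩
    obtain ⟨L, hL⟩ := h.extend_right hE.lifting p hps
      hpi q hq m fun w hw hw' => hm w hw
    have h1 : L.g u = 1 := (hL u hu).trans hmu
    obtain ⟨v, s, m', rfl⟩ := hsplit u
    have h2 : r.h v + s + r.β (p.g m') = 0 := by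
      have h3 : p.g _ = 0 := hu
      rw [map_add, map_add, p.comm_h, p.comm_β, hp, hp'] at h3
      exact h3
    have hs : s = 0 := Subtype.ext (Submodule.disjoint_def.1 hS.disjoint s s.2 (by
      rw [show (s : r.W) = -(r.h v) + -(r.β (p.g m')) from by
        rw [← neg_add, eq_neg_iff_add_eq_zero, ← h2]
        abel]
      exact Submodule.add_mem_sup ((LinearMap.range r.h).neg_mem ⟨_, rfl⟩)
        ((LinearMap.range r.β).neg_mem ⟨_, rfl⟩)))
    rw [hs, map_zero, add_zero, map_add, L.comm_h, L.comm_β] at h1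
    have h4 : (0 : K) + 0 = 1 := h1
    simp at h4
  have hi : p.Inj := ⟨hpi, LinearMap.ker_eq_bot.1 hker⟩
  have h5 := hE.of_bijective p hi hps
  rwa [show p.f ∘ₗ T = (LinearMap.id : r.V →ₗ[K] r.V) from LinearMap.ext hp,
    show p.g ∘ₗ T' = S.subtype from LinearMap.ext hp'] at h5

end RigidTrue

section RigidTrueLabels

variable {K : Type} [Field K] {a b : ℕ} [NeZero a] [NeZero b]

theorem Rep.Rigid.label_of_not_generated (hba : b ≤ a) {r : Rep K true a b} (h : r.Rigid)
    (hi : r.Indec) (hgen : LinearMap.range r.h ⊔ LinearMap.range r.β ≠ ⊤) : r.HasLabel none := by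
  obtain ⟨S, hS⟩ := Submodule.exists_isCompl (LinearMap.range r.h ⊔ LinearMap.range r.β)
  have hne : S ≠ ⊥ := fun h0 => hgen (by
    have := hS.sup_eq_top
    rwa [h0, sup_bot_eq] at this)
  have hF := h.isFree_of_isCompl hba hS.symm hne
  have key : ∀ e : Module.End K S, (∀ s, e (e s) = e s) →
      (∀ s, e s = 0) ∨ ((∀ v : r.V, v = 0) ∧ ∀ s, e s = s) := fun e he => by
    obtain ⟨ψ, h1, h2⟩ := hF.1 r 0 (S.subtype ∘ₗ e)
    have h2' : ∀ s : S, ψ.g s = e s := h2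
    have h1' : ∀ v, ψ.f v = 0 := h1
    have h3 : ψ.comp ψ = ψ := hF.2 r _ _ (fun v => (h1' _).trans (h1' _).symm) fun s => by
      change ψ.g (ψ.g s) = ψ.g s
      rw [h2', h2', he]
    refine (hi.2 ψ (fun v => congrArg (fun φ => φ.f v) h3)
      (fun v => congrArg (fun φ => φ.g v) h3)).imp (fun h0 s => ?_) fun h0 => ⟨fun v => ?_, fun s => ?_⟩
    · exact Subtype.ext ((h2' s).symm.trans (h0.2 _))
    · exact (h0.1 v).symm.trans (h1' v)
    · exact Subtype.ext ((h2' s).symm.trans (h0.2 _))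
  obtain ⟨s, hs, hs0⟩ := (Submodule.ne_bot_iff S).1 hne
  have hV : ∀ v : r.V, v = 0 := by
    rcases key LinearMap.id fun _ => rfl with h0 | h0
    · exact absurd (congrArg Subtype.val (h0 ⟨s, hs⟩)) hs0
    · exact h0.1
  refine ⟨S, _, _, S.subtype, finrank_eq_one_of_idem
    ⟨⟨⟨s, hs⟩, 0, fun h0 => hs0 (congrArg Subtype.val h0)⟩⟩
    fun e he => (key e he).imp id And.right, fun A f c => ?_, fun A ψ ψ' _ h2 => ?_⟩
  · obtain ⟨ψ, -, h2⟩ := hF.1 A 0 c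
    exact ⟨ψ, fun x => by rw [Subsingleton.elim x 0, map_zero, map_zero, map_zero], h2⟩
  · exact hF.2 A ψ ψ' (fun v => by rw [hV v, map_zero, map_zero, map_zero]) h2

theorem exists_freeTrue_left {a b : ℕ} [NeZero b] (V : Type) [AddCommGroup V] [Module K V]
    (hba : b ≤ a) :
    ∃ (E : Rep K true a b) (T : V →ₗ[K] E.V), E.IsFree T (0 : PUnit →ₗ[K] E.W) ∧
      Function.Bijective T ∧ IsFreeOn b E.β (E.h ∘ₗ T) := by
  have hs := isFreeOn_shift (K := K) (S := V) b
  let E : Rep K true a b := ⟨V, Fin b → V, 0, shift K b V, single0 K b V, rfl,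
    pow_zero_of_le hs.1 hba, fun v => by rw [hs.1]; rfl⟩
  exact ⟨E, LinearMap.id, Rep.isFree_true (r := E) hs, Function.bijective_id, hs⟩

theorem Rep.Rigid.pair_true (hba : b ≤ a) {r : Rep K true a b} (h : r.Rigid)
    (hW : Nontrivial r.W) (hgen : LinearMap.range r.h ⊔ LinearMap.range r.β = ⊤) :
    Cyc b r.β ∧ RigidPair b r.β (LinearMap.range r.h) := by
  obtain ⟨E, T, hE, hTb, hEf⟩ := exists_freeTrue_left (K := K) r.V hba
  obtain ⟨p, hp, -⟩ := hE.1 r LinearMap.id 0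
  replace hp : ∀ v, p.f (T v) = v := hp
  have hpi : Function.Injective p.f := fun v v' hv => by
    obtain ⟨v, rfl⟩ := hTb.2 v
    obtain ⟨v', rfl⟩ := hTb.2 v'
    rw [hp, hp] at hv
    exact congrArg T hv
  have hβa : r.β ^ a = 0 := r.rel.2.1
  have hβ : ∀ v, (r.β ^ b) (r.h v) = 0 := r.rel.2.2
  have hT : ∀ u, ∃ (v : r.V) (w : r.W), u = r.h v + r.β w := fun u => by
    have hu : u ∈ LinearMap.range r.h ⊔ LinearMap.range r.β := by rw [hgen]; trivial
    obtain ⟨_, ⟨v, rfl⟩, _, ⟨w, rfl⟩, rfl⟩ := Submodule.mem_sup.1 hu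
    exact ⟨v, w, rfl⟩
  have hW' : ∀ w, ∃ q : ℕ → r.V, w = ∑ i ∈ Finset.range a, (r.β ^ i) (r.h (q i)) := fun w => by
    obtain ⟨q, w', hq⟩ := exists_expansion hT a w
    rw [hβa, LinearMap.zero_apply, add_zero] at hq
    exact ⟨q, hq⟩
  have hβb : r.β ^ b = 0 := LinearMap.ext fun w => by
    obtain ⟨q, rfl⟩ := hW' w
    rw [map_sum]
    refine Finset.sum_eq_zero fun i _ => ?_
    rw [← Module.End.mul_apply, ← pow_add, add_comm, pow_add, Module.End.mul_apply, hβ, map_zero]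
  have hps : p.Surj := by
    refine ⟨fun v => ⟨T v, hp v⟩, fun w => ?_⟩
    obtain ⟨q, rfl⟩ := hW' w
    refine Submodule.sum_mem (LinearMap.range p.g) fun i _ => ⟨(E.β ^ i) (E.h (T (q i))), ?_⟩
    rw [comm_pow p.comm_β, p.comm_h, hp]
  refine ⟨⟨hβb, fun u hu => ?_⟩, fun θ _ => ?_⟩
  · obtain ⟨m, rfl⟩ := hps.2 u
    have hm : E.β m ∈ LinearMap.ker p.g := (p.comm_β m).trans hu
    obtain ⟨k, hk, hmk⟩ : ∃ k ∈ LinearMap.ker p.g, E.β m = E.β k := by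
      by_contra hc
      push Not at hc
      let B := LinearMap.range r.β
      have hB : ∃ w, B.mkQ w ≠ 0 := by
        by_contra! hcon
        have h0 := eq_bot_of_nilpotent hβb (N := ⊤) fun u _ => by
          obtain ⟨v, hv⟩ := (Submodule.Quotient.mk_eq_zero B).1 (hcon u)
          exact ⟨v, trivial, hv.symm⟩
        exact bot_ne_top h0.symm
      obtain ⟨w, hw⟩ := hB
      obtain ⟨l, hl, hlm⟩ := exists_functional p.β_mem hm (fun v hv => hc v hv) (B.mkQ w)
      let Y : Rep K true a b := ⟨r.V, r.W ⧸ B, 0, 0, B.mkQ ∘ₗ r.h, rfl, zero_pow (NeZero.ne a),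
        fun _ => by rw [zero_pow (NeZero.ne b), LinearMap.zero_apply]⟩
      let q : Rep.Hom r Y := ⟨LinearMap.id, B.mkQ, fun v => LinearMap.congr_fun r.rel.1 v,
        fun w => (Submodule.Quotient.mk_eq_zero B).2 ⟨w, rfl⟩, fun v => rfl⟩
      obtain ⟨L, hL⟩ := h.extend_right hE.lifting p hps hpi q
        ⟨Function.surjective_id, B.mkQ_surjective⟩ l fun w hw hw' => hl w hw
      have h1 : L.g (E.β m) = B.mkQ w := (hL _ hm).trans hlm
      rw [L.comm_β] at h1
      exact hw h1.symm
    obtain ⟨m', hm'⟩ := hEf.cyc.2 (m - k) (by rw [map_sub, hmk, sub_self])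
    refine ⟨p.g m', ?_⟩
    have hk' : p.g k = 0 := hk
    rw [← comm_pow p.comm_β, ← hm', map_sub, hk', sub_zero]
  · let D := LinearMap.range r.h
    obtain ⟨θ', hθ'⟩ := Module.projective_lifting_property D.mkQ (θ ∘ₗ r.h.rangeRestrict)
      D.mkQ_surjective
    obtain ⟨L₀, hL₀, hL₀T⟩ := hEf.exists_ext r.β θ' fun s => by rw [hβb, LinearMap.zero_apply]
    let id' : Rep.Hom r r := ⟨LinearMap.id, LinearMap.id, fun _ => rfl, fun _ => rfl, fun _ => rfl⟩
    obtain ⟨L, hL⟩ := h.extend_right hE.lifting p hps hpi id'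
      ⟨Function.surjective_id, Function.surjective_id⟩ (L₀ ∘ₗ (LinearMap.ker p.g).subtype)
      fun w hw hw' => hL₀ w
    obtain ⟨F, hF⟩ := exists_factor p.g hps.2 (L₀ - L.g) fun u hu => by
      rw [LinearMap.sub_apply, hL u hu]
      exact sub_self _
    refine ⟨F, fun u => ?_, ?_⟩
    · obtain ⟨m, rfl⟩ := hps.2 u
      rw [← p.comm_β, hF, hF, LinearMap.sub_apply, LinearMap.sub_apply, hL₀, L.comm_β, map_sub]
    · rintro ⟨_, v, rfl⟩
      have h1 : F (r.h v) = θ' v - r.h (L.f (T v)) := by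
        rw [← L.comm_h, ← hL₀T]
        have h2 := hF (E.h (T v))
        rw [p.comm_h, hp] at h2
        exact h2
      have h2 : D.mkQ (r.h (L.f (T v))) = 0 := (Submodule.Quotient.mk_eq_zero D).2 ⟨_, rfl⟩
      change D.mkQ (F (r.h v)) = _
      rw [h1, map_sub, h2, sub_zero]
      exact LinearMap.congr_fun hθ' v

theorem Rep.Rigid.exists_label_true (hba : b ≤ a) (hb3 : b ≤ 3) {r : Rep K true a b}
    (h : r.Rigid) (hi : r.Indec) : ∃ l, r.HasLabel l := by
  by_cases hinj : Function.Injective r.h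
  swap
  · exact ⟨_, hi.label_of_not_injective hinj⟩
  by_cases hgen : LinearMap.range r.h ⊔ LinearMap.range r.β = ⊤
  swap
  · exact ⟨_, h.label_of_not_generated hba hi hgen⟩
  have hW : Nontrivial r.W := hi.1.elim (fun _ => hinj.nontrivial) id
  obtain ⟨hc, hp⟩ := h.pair_true hba hW hgen
  have hid : IdemPair r.β (LinearMap.range r.h) := fun E hE hE2 hED => by
    obtain ⟨f, hf⟩ := exists_lift_of_injective r.h hinj (E ∘ₗ r.h) fun v => hED _ ⟨v, rfl⟩
    have hf' : ∀ v, r.h (f v) = E (r.h v) := hf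
    have hα : r.α = 0 := r.rel.1
    exact (hi.2 ⟨f, E, fun v => by simp [hα], hE, fun v => (hf' v).symm⟩
      (fun v => hinj (by rw [hf', hf', hE2])) hE2).imp And.right And.right
  obtain ⟨l, hl⟩ := exists_hasNF hp hid hW (Nat.one_le_iff_ne_zero.2 (NeZero.ne b)) hb3 hc
    fun u => by rw [hc.1, LinearMap.zero_apply]; exact Submodule.zero_mem _
  exact ⟨some (some l), hinj, hl⟩

end RigidTrueLabels

section RigidFalseLabels

variable {K : Type} [Field K] {a b : ℕ}

theorem Rep.Indec.label_of_not_surjective {r : Rep K false a b} (hi : r.Indec)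
    (h : ¬ Function.Surjective r.h) : r.HasLabel none := by
  obtain ⟨w, hw⟩ := not_forall.1 h
  let R := LinearMap.range r.h
  have hd : R.mkQ w ≠ 0 := fun h0 => hw ((Submodule.Quotient.mk_eq_zero R).1 h0)
  obtain ⟨θ, hθ⟩ := exists_extend_eq (K := K) hd (1 : K)
  have hw0 : w ≠ 0 := fun h0 => hw ⟨0, by rw [h0, map_zero]⟩
  have hθR : ∀ v, θ (R.mkQ (r.h v)) = 0 := fun v => by
    have h0 : R.mkQ (r.h v) = 0 := (Submodule.Quotient.mk_eq_zero R).2 ⟨v, rfl⟩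
    rw [h0, map_zero]
  have hβ : r.β = 0 := r.rel.1
  let f : r.W →ₗ[K] K := θ ∘ₗ R.mkQ
  have hf : f w = 1 := hθ
  have hfR : ∀ v, f (r.h v) = 0 := hθR
  rcases hi.2 ⟨0, f.smulRight w, fun v => by simp, fun w => by simp [hβ],
    fun v => by simp [hfR]⟩ (fun w => by simp) (fun w => by simp [hf]) with h0 | h0
  · exact absurd (h0.2 w) (by simp [hf, hw0])
  · have : Subsingleton r.V := ⟨fun v v' => by rw [← h0.1 v, ← h0.1 v']; rfl⟩
    exact ⟨r.W, _, _, LinearMap.id,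
      (finrank_eq_one_iff_of_nonzero' w hw0).2 fun w => ⟨f w, h0.2 w⟩,
      Rep.isFree_false_of_subsingleton⟩

theorem exists_freeFalse [NeZero a] (hba : b ≤ a) (S : Type) [AddCommGroup S] [Module K S] :
    ∃ (E : Rep K false a b) (T : S →ₗ[K] E.V), E.IsFree T (0 : PUnit →ₗ[K] E.W) ∧
      IsFreeOn a E.α T ∧ Function.Surjective E.h ∧ ∀ v, E.h v = 0 → ∃ u, v = (E.α ^ b) u :=
  ⟨freeFalse hba S, single0 K a S, isFree_freeFalse hba S, isFreeOn_shift a,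
    trunc_surjective hba S, ker_trunc hba S⟩

theorem Rep.Rigid.pair_false [NeZero a] (hba : b ≤ a) {r : Rep K false a b} (h : r.Rigid)
    (hV : Nontrivial r.V) (hsurj : Function.Surjective r.h) :
    Cyc a r.α ∧ RigidPair b r.α (LinearMap.ker r.h) := by
  let B := LinearMap.range r.α
  obtain ⟨S, hS⟩ := Submodule.exists_isCompl B
  obtain ⟨E, T, hE, hEf, hEs, hEk⟩ := exists_freeFalse (K := K) hba S
  obtain ⟨p, hp, -⟩ := hE.1 r S.subtype 0
  have hαa : r.α ^ a = 0 := r.rel.2.1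
  have hSB : ∀ u, ∃ (s : S) (w : r.V), u = (s : r.V) + r.α w := fun u => by
    have hu : u ∈ S ⊔ B := by rw [hS.symm.sup_eq_top]; trivial
    obtain ⟨s, hs, _, ⟨w, rfl⟩, rfl⟩ := Submodule.mem_sup.1 hu
    exact ⟨⟨s, hs⟩, w, rfl⟩
  have hps : Function.Surjective p.f := fun v => by
    obtain ⟨q, v', rfl⟩ := exists_expansion hSB a v
    rw [hαa, LinearMap.zero_apply, add_zero]
    refine Submodule.sum_mem (LinearMap.range p.f) fun i _ => ⟨(E.α ^ i) (T (q i)), ?_⟩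
    rw [comm_pow p.comm_α, hp]
    rfl
  have hpS : p.Surj := ⟨hps, fun w => by
    obtain ⟨v, rfl⟩ := hsurj w
    obtain ⟨m, rfl⟩ := hps v
    exact ⟨E.h m, p.comm_h m⟩⟩
  have hker : LinearMap.ker p.f = ⊥ := by
    refine eq_bot_of_nilpotent (x := E.α) (n := a) E.rel.2.1 fun u hu => ?_
    by_contra hc
    push Not at hc
    obtain ⟨l, hl, hlm⟩ := exists_functional p.α_mem hu (fun v hv => hc v hv) (1 : K)
    have hB : ∃ w, B.mkQ w ≠ 0 := by
      by_contra! hcon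
      have h0 := eq_bot_of_nilpotent hαa (N := ⊤) fun u _ => by
        obtain ⟨v, hv⟩ := (Submodule.Quotient.mk_eq_zero B).1 (hcon u)
        exact ⟨v, trivial, hv.symm⟩
      exact bot_ne_top h0.symm
    obtain ⟨w, hw⟩ := hB
    obtain ⟨θ, hθ⟩ := exists_extend_eq (K := K) hw (1 : K)
    let Y : Rep K false a b := ⟨K, PUnit, 0, 0, 0, rfl, zero_pow (NeZero.ne a), fun _ => rfl⟩
    let q : Rep.Hom r Y := ⟨θ ∘ₗ B.mkQ, 0, fun v => by
      have h0 : B.mkQ (r.α v) = 0 := (Submodule.Quotient.mk_eq_zero B).2 ⟨v, rfl⟩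
      change θ (B.mkQ (r.α v)) = 0
      rw [h0, map_zero], fun _ => rfl, fun _ => rfl⟩
    have hq : q.Surj := ⟨fun c => ⟨c • w, by
      change θ (B.mkQ (c • w)) = c
      rw [map_smul, map_smul, hθ, smul_eq_mul, mul_one]⟩, fun v => ⟨0, rfl⟩⟩
    have : Subsingleton Y.W := inferInstanceAs (Subsingleton PUnit)
    obtain ⟨L, hL⟩ := h.extend_left hE.lifting p hpS q hq l fun w hw hw' => hl w hw
    have h1 : L.f u = 1 := (hL u hu).trans hlm
    obtain ⟨s, m, rfl⟩ := hEf.exists_split u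
    have h2 : (s : r.V) + r.α (p.f m) = 0 := by
      have h3 : p.f _ = 0 := hu
      rwa [map_add, p.comm_α, hp] at h3
    have hs : s = 0 := Subtype.ext (Submodule.disjoint_def.1 hS.symm.disjoint s s.2 (by
      rw [eq_neg_of_add_eq_zero_left h2]
      exact B.neg_mem ⟨_, rfl⟩))
    rw [hs, map_zero, zero_add, L.comm_α] at h1
    have h4 : (0 : K) = 1 := h1
    simp at h4
  have hpi : Function.Injective p.f := LinearMap.ker_eq_bot.1 hker
  let e := LinearEquiv.ofBijective p.f ⟨hpi, hps⟩
  have he : ∀ m, e.symm (p.f m) = m := e.symm_apply_apply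
  refine ⟨⟨hαa, fun u hu => ?_⟩, fun θ hθ => ?_⟩
  · obtain ⟨m, rfl⟩ := hps u
    obtain ⟨m', rfl⟩ := hEf.cyc.2 m (hpi (by rw [p.comm_α, hu, map_zero]))
    exact ⟨p.f m', comm_pow p.comm_α _ _⟩
  · let D := LinearMap.ker r.h
    obtain ⟨σ, hσ⟩ := E.h.exists_rightInverse_of_surjective (LinearMap.range_eq_top.2 hEs)
    replace hσ : ∀ w, E.h (σ w) = w := LinearMap.congr_fun hσ
    have hmem : ∀ w : LinearMap.ker p.g, p.f (σ w) ∈ D := fun w => by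
      have hw : p.g w = 0 := w.2
      change r.h _ = 0
      rw [← p.comm_h, hσ, hw]
    let j : D →ₗ[K] r.W := D.liftQ r.h le_rfl ∘ₗ θ
    let m : LinearMap.ker p.g →ₗ[K] r.W :=
      j ∘ₗ (p.f ∘ₗ σ ∘ₗ (LinearMap.ker p.g).subtype).codRestrict D hmem
    have hβE : E.β = 0 := E.rel.1
    have hβr : r.β = 0 := r.rel.1
    let id' : Rep.Hom r r := ⟨LinearMap.id, LinearMap.id, fun _ => rfl, fun _ => rfl, fun _ => rfl⟩
    obtain ⟨L, hL⟩ := h.extend_right hE.lifting p hpS hpi id'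
      ⟨Function.surjective_id, Function.surjective_id⟩ m fun w hw hw' => by
        have h0 : (⟨E.β w, hw'⟩ : LinearMap.ker p.g) = 0 := Subtype.ext (LinearMap.congr_fun hβE w)
        rw [h0, map_zero, hβr, LinearMap.zero_apply]
    refine ⟨L.f ∘ₗ e.symm.toLinearMap, fun u => ?_, ?_⟩
    · obtain ⟨u, rfl⟩ := hps u
      change L.f (e.symm _) = r.α (L.f (e.symm _))
      rw [← p.comm_α, he, he, L.comm_α]
    · rintro ⟨u, hu⟩
      obtain ⟨u, rfl⟩ := hps u
      have hu' : p.g (E.h u) = 0 := (p.comm_h u).trans hu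
      have h1 := hL (E.h u) hu'
      rw [L.comm_h] at h1
      obtain ⟨v, hv⟩ := hEk (σ (E.h u) - u) (by rw [map_sub, hσ, sub_self])
      have h2 : θ ⟨p.f (σ (E.h u)), hmem ⟨_, hu'⟩⟩ = θ ⟨p.f u, hu⟩ := by
        rw [← sub_eq_zero, ← map_sub]
        refine hθ _ ⟨p.f v, ?_⟩
        rw [← comm_pow p.comm_α, ← hv, map_sub]
        rfl
      have h3 : D.liftQ r.h le_rfl (D.mkQ (L.f u)) = D.liftQ r.h le_rfl (θ ⟨p.f u, hu⟩) := by
        rw [← h2]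
        exact h1
      have h4 : Function.Injective (D.liftQ r.h le_rfl) :=
        LinearMap.ker_eq_bot.1 (Submodule.ker_liftQ_eq_bot _ _ _ le_rfl)
      change D.mkQ (L.f (e.symm (p.f u))) = _
      rw [he]
      exact h4 h3

theorem Rep.Rigid.exists_label_false [NeZero a] [NeZero b] (hba : b ≤ a) (hb3 : b ≤ 3)
    {r : Rep K false a b} (h : r.Rigid) (hi : r.Indec) : ∃ l, r.HasLabel l := by
  by_cases hsurj : Function.Surjective r.h
  swap
  · exact ⟨_, hi.label_of_not_surjective hsurj⟩
  have hV : Nontrivial r.V := hi.1.elim id fun _ => hsurj.nontrivial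
  obtain ⟨hc, hp⟩ := h.pair_false hba hV hsurj
  have hid : IdemPair r.α (LinearMap.ker r.h) := fun E hE hE2 hED => by
    obtain ⟨g, hg⟩ := exists_factor r.h hsurj (r.h ∘ₗ E) fun v hv => hED v hv
    have hg' : ∀ v, g (r.h v) = r.h (E v) := hg
    have hβ : r.β = 0 := r.rel.1
    refine (hi.2 ⟨E, g, hE, fun v => by simp [hβ], hg'⟩ hE2 fun w => ?_).imp And.left And.left
    obtain ⟨v, rfl⟩ := hsurj w
    change g (g (r.h v)) = g (r.h v)
    rw [hg', hg', hE2]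
  obtain ⟨l, hl⟩ := exists_hasNF hp hid hV (Nat.one_le_iff_ne_zero.2 (NeZero.ne b)) hb3 hc
    r.rel.2.2
  exact ⟨some (some l), hsurj, hl⟩

end RigidFalseLabels

section FiniteCase

variable {K : Type} [Field K] {t : Bool} {a b : ℕ} {Λ : Type} [Ring Λ] [Algebra K Λ]

theorem Presented.isTauTiltingFinite (p : Presented K Λ t a b) [NeZero a] [NeZero b] (hba : b ≤ a)
    (hb3 : b ≤ 3) : IsTauTiltingFinite Λ := by
  refine isTauTiltingFinite_of_labels (L := Option (Option (Fin 3 × Fin 3)))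
    (fun l N _ _ => ∃ r : Rep K t a b, r.HasLabel l ∧ Nonempty (N ≃ₗ[Λᵐᵒᵖ] p.Mod r)) ?_ ?_
  · intro N _ _ hN hE
    obtain ⟨r, ⟨e⟩⟩ := p.exists_rep N
    have hr : r.Rigid := p.rigid_of_extends (hE.congr e)
    have hi : r.Indec := p.isIndecModule_mod.1 (hN.congr e)
    obtain ⟨l, hl⟩ : ∃ l, r.HasLabel l := by
      cases t with
      | true => exact hr.exists_label_true hba hb3 hi
      | false => exact hr.exists_label_false hba hb3 hi
    exact ⟨l, r, hl, ⟨e⟩⟩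
  · rintro l N N' _ _ _ _ ⟨r, hr, ⟨e⟩⟩ ⟨s, hs, ⟨e'⟩⟩
    obtain ⟨φ⟩ := p.mod_equiv (hr.iso hs)
    exact ⟨e.trans (φ.trans e'.symm)⟩

end FiniteCase

/-- Theorem 1.1(1).  Let `Λ = KQ(i,j,m,n)/I` be a finite dimensional
basic algebra over an algebraically closed field `K` given by an admissible ideal, with
`m + n = 1` and `i + j = 1`.  Then `Λ` is τ-tilting infinite if and only if it has `Γ₃` or
`Γ₃ᵒᵖ` as a factor algebra. -/
theorem tau_tilting_infinite_iff_factor_Gamma3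
    (K : Type) [Field K] [IsAlgClosed K] (i j m n : ℕ)
    (hmn : m + n = 1) (hij : i + j = 1)
    (Λ : Type) [Ring Λ] [Algebra K Λ] [FiniteDimensional K Λ]
    (hbasic : IsBasicAlgebra Λ)
    (π : PathAlgebra K i j m n →ₐ[K] Λ)
    (hπ : IsAdmissiblePresentation K Λ π) :
    ¬ IsTauTiltingFinite Λ ↔
      (IsFactorAlgebra K (Gamma3 K) Λ ∨ IsFactorAlgebra K ((Gamma3 K)ᵐᵒᵖ) Λ) := by
  obtain ⟨t, a, b, hb, hab, ⟨p⟩⟩ := exists_presented hmn hij hπ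
  have : NeZero b := ⟨by omega⟩
  have : NeZero a := ⟨by omega⟩
  by_cases h : 4 ≤ b
  · exact iff_of_true (p.not_isTauTiltingFinite hab h) (p.isFactor_gamma3 h hab)
  · exact iff_of_false (not_not.2 (p.isTauTiltingFinite hab (by omega)))
      (p.not_isFactor_gamma3 (by omega))

end TwoPoint
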